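/- Let ρ: sτtilt Λ → sτtilt Γ be a poset isomorphism and assume that sτtilt Λ is a lattice. Then there is a bijection ρ̃ from the set of isomorphism classes of basic τ-rigid pairs of Λ to the set of isomorphism classes of basic τ-rigid pairs of Γ such that for every basic τ-rigid pair X of Λ, ρ restricts to a poset isomorphism sτtilt_X Λ ≅ sτtilt_{ρ̃(X)} Γ. -/

import Mathlib

/-!
Common framework for formalizing statements from
"From support τ-tilting posets to algebras" (R. Kase).

Modules over the basic finite dimensional algebra `Λ` are taken to be *right*
modules, encoded as (left) modules over the opposite ring `Λᵐᵒᵖ`.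
τ-rigidity is encoded through the Auslander–Smalø criterion:
`Hom(M, τM) = 0` iff `Ext¹(M, Fac M) = 0`, and the vanishing of `Ext¹(M, X)`
is encoded by the splitting of all short exact sequences `0 → X → E → M → 0`.
-/

open MulOpposite

namespace TauTilting

/-- Bundled modules over `A` (in `Type 0`). -/
abbrev Mdl (A : Type) [Ring A] := ModuleCat.{0} A

variable {A B : Type} [Ring A] [Ring B]

/-- `X ∈ Fac M` : `X` is a factor of a finite direct sum of copies of `M`. -/
def MemFac (M X : Mdl A) : Prop :=
  ∃ (n : ℕ) (f : (Fin n → M) →ₗ[A] X), Function.Surjective f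

/-- Every short exact sequence `0 → X → E → M → 0` splits, i.e. `Ext¹(M, X) = 0`. -/
def Ext1Vanish (M X : Mdl A) : Prop :=
  ∀ (E : Mdl A) (f : X →ₗ[A] E) (g : E →ₗ[A] M),
    Function.Injective f → Function.Surjective g →
    LinearMap.range f = LinearMap.ker g →
    ∃ s : M →ₗ[A] E, g.comp s = LinearMap.id

/-- `M` is τ-rigid (Auslander–Smalø: `Hom(M, τM) = 0 ↔ Ext¹(M, Fac M) = 0`). -/
def IsTauRigid (M : Mdl A) : Prop :=
  Module.Finite A M ∧ ∀ X : Mdl A, MemFac M X → Ext1Vanish M X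

/-- `M` is indecomposable. -/
def IsIndec (M : Mdl A) : Prop :=
  Nontrivial M ∧ ∀ N N' : Submodule A M, IsCompl N N' → N = ⊥ ∨ N' = ⊥

/-- `F` is an (internal) decomposition of `M` into indecomposable direct summands. -/
def IsDecompOf (M : Mdl A) {n : ℕ} (F : Fin n → Submodule A M) : Prop :=
  iSupIndep F ∧ iSup F = ⊤ ∧ ∀ k, IsIndec (ModuleCat.of A (F k))

/-- `|M| = n` : `M` decomposes into `n` indecomposable direct summands. -/
def HasNumSummands (M : Mdl A) (n : ℕ) : Prop :=
  ∃ F : Fin n → Submodule A M, IsDecompOf M F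

/-- `M` is basic: its indecomposable direct summands are pairwise non-isomorphic. -/
def IsBasicMod (M : Mdl A) : Prop :=
  ∃ (n : ℕ) (F : Fin n → Submodule A M), IsDecompOf M F ∧
    ∀ k l : Fin n, k ≠ l → IsEmpty (↥(F k) ≃ₗ[A] ↥(F l))

def ModIso (M N : Mdl A) : Prop := Nonempty (M ≃ₗ[A] N)

/-- The order on support τ-tilting modules: `M ≤ N ↔ Fac M ⊆ Fac N`. -/
def FacLE (M N : Mdl A) : Prop := ∀ X : Mdl A, MemFac M X → MemFac N X
def FacLT (M N : Mdl A) : Prop := FacLE M N ∧ ¬ FacLE N M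
/-- Equality in the poset of iso-classes: mutual `≤`. -/
def PE (M N : Mdl A) : Prop := FacLE M N ∧ FacLE N M

/-- `N` is a direct summand of `M`. -/
def IsSummand (N M : Mdl A) : Prop :=
  ∃ (f : N →ₗ[A] M) (g : M →ₗ[A] N), g.comp f = LinearMap.id
/-- `N ∈ add M`. -/
def InAdd (N M : Mdl A) : Prop := ∃ n : ℕ, IsSummand N (ModuleCat.of A (Fin n → M))
def HomZero (R M : Mdl A) : Prop := ∀ f : R →ₗ[A] M, f = 0

/-- Direct sum of two bundled modules. -/
def dsum (M N : Mdl A) : Mdl A := ModuleCat.of A (M × N)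

/-- Hasse-quiver arrow `M → N` (so `N` is a direct successor of `M`, and `M` a
direct predecessor of `N`) in the poset of all modules satisfying `P`,
ordered by `FacLE`. -/
def HArrow (P : Mdl A → Prop) (M N : Mdl A) : Prop :=
  P M ∧ P N ∧ FacLT N M ∧ ∀ C, P C → FacLT N C → FacLT C M → False

def IsMaxOf (P : Mdl A → Prop) (T : Mdl A) : Prop := P T ∧ ∀ S, P S → FacLE S T
def IsMinOf (P : Mdl A → Prop) (T : Mdl A) : Prop := P T ∧ ∀ S, P S → FacLE T S

/-- `T` has exactly `n` direct successors (counted up to poset equality). -/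
def SuccsCard (P : Mdl A → Prop) (T : Mdl A) (n : ℕ) : Prop :=
  ∃ g : Fin n → Mdl A, (∀ k, HArrow P T (g k)) ∧
    (∀ k l, k ≠ l → ¬ PE (g k) (g l)) ∧ ∀ S, HArrow P T S → ∃ k, PE S (g k)

/-- `T` has exactly `n` direct predecessors (counted up to poset equality). -/
def PredsCard (P : Mdl A → Prop) (T : Mdl A) (n : ℕ) : Prop :=
  ∃ g : Fin n → Mdl A, (∀ k, HArrow P (g k) T) ∧
    (∀ k l, k ≠ l → ¬ PE (g k) (g l)) ∧ ∀ S, HArrow P S T → ∃ k, PE S (g k)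

/-- The poset of modules satisfying `P` (ordered by `FacLE`) is a lattice. -/
def IsLatticeP (P : Mdl A → Prop) : Prop :=
  ∀ M N, P M → P N →
    (∃ J, P J ∧ FacLE M J ∧ FacLE N J ∧ ∀ C, P C → FacLE M C → FacLE N C → FacLE J C) ∧
    (∃ W, P W ∧ FacLE W M ∧ FacLE W N ∧ ∀ C, P C → FacLE C M → FacLE C N → FacLE C W)

/-- A poset isomorphism between the posets (of isomorphism classes) of modules
satisfying `PA` resp. `PB`, ordered by `FacLE`. -/
structure PosetIsoP (PA : Mdl A → Prop) (PB : Mdl B → Prop) where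
  toFun : Mdl A → Mdl B
  invFun : Mdl B → Mdl A
  maps : ∀ M, PA M → PB (toFun M)
  maps' : ∀ N, PB N → PA (invFun N)
  le_iff : ∀ M N, PA M → PA N → (FacLE M N ↔ FacLE (toFun M) (toFun N))
  le_iff' : ∀ M N, PB M → PB N → (FacLE M N ↔ FacLE (invFun M) (invFun N))
  left_inv : ∀ M, PA M → PE (invFun (toFun M)) M
  right_inv : ∀ N, PB N → PE (toFun (invFun N)) N

/-- A poset isomorphism between the poset of modules satisfying `P` and an
abstract poset `(β, le)`. -/
structure PosetIsoTo (P : Mdl A → Prop) (β : Type) (le : β → β → Prop) where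
  toFun : Mdl A → β
  invFun : β → Mdl A
  maps' : ∀ b, P (invFun b)
  le_iff : ∀ M N, P M → P N → (FacLE M N ↔ le (toFun M) (toFun N))
  left_inv : ∀ M, P M → PE (invFun (toFun M)) M
  right_inv : ∀ b, toFun (invFun b) = b

/-! ### Ring-level notions -/

variable (Λ : Type) [Ring Λ]

/-- The right ideal generated by a subset, as a right module (i.e. `Λᵐᵒᵖ`-module). -/
def rSpan (S : Set Λ) : Submodule Λᵐᵒᵖ Λ := Submodule.span Λᵐᵒᵖ S
/-- The two-sided ideal `(q) = ΛqΛ`, as a right `Λ`-module. -/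
def tIdeal (q : Λ) : Submodule Λᵐᵒᵖ Λ := Submodule.span Λᵐᵒᵖ {y : Λ | ∃ a : Λ, y = a * q}
/-- The right `Λ`-module `Λ/S`. -/
def quotMod (S : Submodule Λᵐᵒᵖ Λ) : Mdl Λᵐᵒᵖ := ModuleCat.of Λᵐᵒᵖ (Λ ⧸ S)
/-- `Λ` as a right module over itself. -/
def regMod : Mdl Λᵐᵒᵖ := ModuleCat.of Λᵐᵒᵖ Λ
/-- The projective right module `xΛ ≅ Λ/(1-x)Λ` attached to an idempotent `x`. -/
def projMod (x : Λ) : Mdl Λᵐᵒᵖ := quotMod Λ (rSpan Λ {1 - x})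
/-- The right `Λ`-module `Λ/(1-x)`; for `x = e i` this is the module `X_i`. -/
def cyclicQuot (x : Λ) : Mdl Λᵐᵒᵖ := quotMod Λ (tIdeal Λ (1 - x))

/-- `x` is a primitive idempotent. -/
def IsPrimIdem (x : Λ) : Prop :=
  IsIdempotentElem x ∧ x ≠ 0 ∧
    ∀ a b : Λ, IsIdempotentElem a → IsIdempotentElem b →
      a * b = 0 → b * a = 0 → a + b = x → a = 0 ∨ b = 0

variable {ι : Type} [Fintype ι]

/-- `e` is a complete family of orthogonal primitive idempotents of `Λ`. -/
def CompletePrimIdems (e : ι → Λ) : Prop :=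
  (∀ i, IsPrimIdem Λ (e i)) ∧ (Pairwise fun i j => e i * e j = 0) ∧ ∑ i, e i = 1

/-- `Λ` is basic w.r.t. `e`: the `e i Λ` are pairwise non-isomorphic. -/
def IsBasicAlg (e : ι → Λ) : Prop :=
  ∀ i j : ι, i ≠ j → IsEmpty (↥(projMod Λ (e i)) ≃ₗ[Λᵐᵒᵖ] ↥(projMod Λ (e j)))

/-- The support `supp(M) = {i | M·eᵢ ≠ 0}` of a right module `M`. -/
def Supp (e : ι → Λ) (M : Mdl Λᵐᵒᵖ) : Set ι := {i | ∃ m : M, op (e i) • m ≠ 0}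

/-- Support τ-tilting module: τ-rigid with `|M| = #supp(M)`. -/
def IsSTT (e : ι → Λ) (M : Mdl Λᵐᵒᵖ) : Prop :=
  Module.Finite Λᵐᵒᵖ M ∧ IsTauRigid M ∧ HasNumSummands M (Supp Λ e M).ncard

/-- Basic support τ-tilting module. -/
def IsBSTT (e : ι → Λ) (M : Mdl Λᵐᵒᵖ) : Prop := IsSTT Λ e M ∧ IsBasicMod M

/-- τ-tilting module: τ-rigid with `|M| = #Q₀`. -/
def IsTauTiltingMod (e : ι → Λ) (M : Mdl Λᵐᵒᵖ) : Prop :=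
  IsSTT Λ e M ∧ HasNumSummands M (Fintype.card ι)

open scoped Classical in
/-- The idempotent `1 - e_M = Σ_{i ∉ supp M} e i`. -/
noncomputable def cIdem (e : ι → Λ) (M : Mdl Λᵐᵒᵖ) : Λ :=
  ∑ i : ι, if i ∈ Supp Λ e M then 0 else e i

/-- τ-rigid pair `(M, P)`. -/
def IsTauRigidPair (e : ι → Λ) (M P : Mdl Λᵐᵒᵖ) : Prop :=
  IsTauRigid M ∧ Module.Finite Λᵐᵒᵖ P ∧ Module.Projective Λᵐᵒᵖ P ∧
    InAdd P (projMod Λ (cIdem Λ e M))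

/-- Basic τ-rigid pair. -/
def IsBasicTRP (e : ι → Λ) (M P : Mdl Λᵐᵒᵖ) : Prop :=
  IsTauRigidPair Λ e M P ∧ IsBasicMod M ∧ IsBasicMod P

/-- `T ∈ sτtilt_{(N,R)} Λ`, i.e. `N ∈ add T` and `Hom(R, T) = 0`. -/
def InPairSet (N R T : Mdl Λᵐᵒᵖ) : Prop := InAdd N T ∧ HomZero R T

/-- `Λ` is τ-tilting finite: finitely many basic support τ-tilting modules up to iso. -/
def TauTiltingFinite (e : ι → Λ) : Prop :=
  ∃ (n : ℕ) (T : Fin n → Mdl Λᵐᵒᵖ), ∀ M, IsBSTT Λ e M → ∃ k, ModIso M (T k)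

/-- The Jacobson radical of `Λ`, as a `K`-subspace. -/
noncomputable def radK (K : Type) [CommRing K] (Λ : Type) [Ring Λ] [Algebra K Λ] :
    Submodule K Λ :=
  Submodule.restrictScalars K (sInf {I : Ideal Λ | I.IsMaximal})

/-- Powers of the radical, with `rad⁰ = Λ`. -/
noncomputable def radPow (K : Type) [CommRing K] (Λ : Type) [Ring Λ] [Algebra K Λ] :
    ℕ → Submodule K Λ
  | 0 => ⊤
  | n + 1 => radK K Λ ^ (n + 1)

/-! ### Quivers, paths and presentations -/

/-- Paths in a quiver with vertex set `ι` and arrow types `Arr i j`. -/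
inductive QPath {ι : Type} (Arr : ι → ι → Type) : ι → ι → Type
  | nil (i : ι) : QPath Arr i i
  | cons {i j k : ι} (a : Arr i j) (p : QPath Arr j k) : QPath Arr i k

namespace QPath

variable {ι : Type} {Arr : ι → ι → Type}

/-- The list of visited vertices. -/
def verts : ∀ {i j : ι}, QPath Arr i j → List ι
  | i, _, .nil _ => [i]
  | i, _, .cons _ p => i :: p.verts

/-- Evaluation of a path in the algebra `Λ` (trivial path at `i` ↦ `e i`). -/
def eval {Λ : Type} [Ring Λ] (e : ι → Λ) (arr : ∀ i j, Arr i j → Λ) :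
    ∀ {i j : ι}, QPath Arr i j → Λ
  | _, _, .nil i => e i
  | _, _, .cons a p => arr _ _ a * p.eval e arr

def append : ∀ {i j k : ι}, QPath Arr i j → QPath Arr j k → QPath Arr i k
  | _, _, _, .nil _, q => q
  | _, _, _, .cons a p, q => .cons a (p.append q)

def single {i j : ι} (a : Arr i j) : QPath Arr i j := .cons a (.nil j)

end QPath

/-- The condition `xΛe_j = e_iΛe_j = e_iΛx ≠ 0` on an element `x` of `e_iΛe_j`. -/
def Gcond (ei ej x : Λ) : Prop :=
  (Set.range fun b => x * b * ej) = (Set.range fun b => ei * b * ej) ∧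
  (Set.range fun b => ei * b * x) = (Set.range fun b => ei * b * ej) ∧
  ∃ b, ei * b * ej ≠ 0

/-- `w ∈ G(Q, I)` : `w` contains no cycle as a subpath (equivalently, visits no
vertex twice) and `wΛe_j = e_iΛe_j = e_iΛw ≠ 0`. -/
def GMem (e : ι → Λ) {Arr : ι → ι → Type} (arr : ∀ i j, Arr i j → Λ) {i j : ι}
    (w : QPath Arr i j) : Prop :=
  w.verts.Nodup ∧ Gcond Λ (e i) (e j) (w.eval e arr)

/-- Condition 1 for a bound quiver: if `e_iΛe_j ≠ 0` then `G^i_j ≠ ∅`. -/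
def Cond1 (e : ι → Λ) {Arr : ι → ι → Type} (arr : ∀ i j, Arr i j → Λ) : Prop :=
  ∀ i j : ι, (∃ x, e i * x * e j ≠ 0) → ∃ w : QPath Arr i j, GMem Λ e arr w

/-- Ring-level version of Condition 1 (Lemma `eqcd` (iii)). -/
def Cond1R : Prop :=
  ∀ x y : Λ, IsPrimIdem Λ x → IsPrimIdem Λ y → x * y = 0 → y * x = 0 →
    ∃ w : Λ, (∃ b, w = x * b * y) ∧
      (Set.range fun b => w * b * y) = (Set.range fun b => x * b * y) ∧
      (Set.range fun b => x * b * w) = (Set.range fun b => x * b * y)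

/-- `(e, Arr, arr)` presents `Λ` as the bound quiver algebra `KQ/I` with `Q` its
Gabriel quiver: `e` is a complete family of orthogonal primitive idempotents,
`Λ` is basic, each arrow `a : i → j` is sent to an element of `e_i (rad Λ) e_j`,
and the arrows form a `K`-basis of `rad Λ / rad² Λ`. -/
def IsGabrielPres (K : Type) [Field K] [Algebra K Λ] [DecidableEq ι] (e : ι → Λ)
    (Arr : ι → ι → Type) [∀ i j, Fintype (Arr i j)] (arr : ∀ i j, Arr i j → Λ) : Prop :=
  CompletePrimIdems Λ e ∧ IsBasicAlg Λ e ∧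
  (∀ i j (a : Arr i j), arr i j a ∈ radK K Λ ∧ e i * arr i j a * e j = arr i j a) ∧
  (radK K Λ ≤
    Submodule.span K (Set.range fun p : Σ i : ι, Σ j : ι, Arr i j => arr p.1 p.2.1 p.2.2) ⊔
      radK K Λ * radK K Λ) ∧
  (∀ c : (Σ i : ι, Σ j : ι, Arr i j) → K,
    (∑ p : Σ i : ι, Σ j : ι, Arr i j, c p • arr p.1 p.2.1 p.2.2) ∈ radK K Λ * radK K Λ →
    ∀ p, c p = 0)

/-! ### Partitions of a quiver, Condition 2 -/

/-- `x` and `y` are adjacent within the vertex subset `S` (undirected). -/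
def AdjIn {ι : Type} (Arr : ι → ι → Type) (S : Set ι) (x y : ι) : Prop :=
  x ∈ S ∧ y ∈ S ∧ (Nonempty (Arr x y) ∨ Nonempty (Arr y x))

/-- The full subquiver on `S` is connected. -/
def ConnectedOn {ι : Type} (Arr : ι → ι → Type) (S : Set ι) : Prop :=
  ∀ x ∈ S, ∀ y ∈ S, Relation.ReflTransGen (AdjIn Arr S) x y

/-- Adjacency of parts in the quotient quiver `Q^μ`. -/
def PartAdj {ι : Type} (Arr : ι → ι → Type) {ℓ : ℕ} (μ : ι → Fin ℓ) (u v : Fin ℓ) : Prop :=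
  u ≠ v ∧ ∃ x y, μ x = u ∧ μ y = v ∧ (Nonempty (Arr x y) ∨ Nonempty (Arr y x))

/-- Condition 2: there is a partition `μ` of `Q₀` into connected full subquivers
such that `Q^μ` is a tree (connected with `#arrows = #parts - 1`) and each
`sτtilt Λ^{a,b}_μ` — identified with the subposet of `sτtilt Λ` of modules
supported on the union of the two parts — is a lattice. -/
def Cond2 (e : ι → Λ) (Arr : ι → ι → Type) [∀ i j, Fintype (Arr i j)] : Prop :=
  ∃ (ℓ : ℕ) (μ : ι → Fin ℓ), Function.Surjective μ ∧
    (∀ a : Fin ℓ, ConnectedOn Arr {i | μ i = a}) ∧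
    (∀ u v : Fin ℓ, Relation.ReflTransGen (PartAdj Arr μ) u v) ∧
    Nat.card {p : Σ i : ι, Σ j : ι, Arr i j // μ p.1 ≠ μ p.2.1} = ℓ - 1 ∧
    ∀ a b : Fin ℓ, a ≠ b →
      IsLatticeP (fun T : Mdl Λᵐᵒᵖ => IsBSTT Λ e T ∧ Supp Λ e T ⊆ {i | μ i = a ∨ μ i = b})

/-! ### Correspondence of paths under a quiver isomorphism, and `∼` -/

/-- Transport of paths along a quiver isomorphism `σ : Q° → (Q')°` (defined on
non-loop arrows). -/
inductive PathCorr {ι ι' : Type} {Arr : ι → ι → Type} {Arr' : ι' → ι' → Type}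
    (σ : ι → ι') (σ1 : ∀ i j, i ≠ j → Arr i j → Arr' (σ i) (σ j)) :
    ∀ {i j : ι}, QPath Arr i j → QPath Arr' (σ i) (σ j) → Prop
  | nil (i : ι) : PathCorr σ σ1 (QPath.nil i) (QPath.nil (σ i))
  | cons {i j k : ι} (h : i ≠ j) (a : Arr i j) {p : QPath Arr j k}
      {p' : QPath Arr' (σ j) (σ k)} :
      PathCorr σ σ1 p p' → PathCorr σ σ1 (QPath.cons a p) (QPath.cons (σ1 i j h a) p')

/-- The relation `(Q, I) ∼ (Q', I')`: there is a quiver isomorphism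
`σ : Q° → (Q')°` with (a) `supp(e_{σ(i)}Γ) = σ(supp(e_iΛ))` and (b) `G(Γ) = σ(G(Λ))`. -/
def SimCond {Λ Γ : Type} [Ring Λ] [Ring Γ] {ι ι' : Type}
    (e : ι → Λ) {Arr : ι → ι → Type} (arr : ∀ i j, Arr i j → Λ)
    (f : ι' → Γ) {Arr' : ι' → ι' → Type} (arr' : ∀ i j, Arr' i j → Γ) : Prop :=
  ∃ (σ : ι ≃ ι') (σ1 : ∀ i j, i ≠ j → (Arr i j ≃ Arr' (σ i) (σ j))),
    (∀ i j : ι, (∃ x, e i * x * e j ≠ 0) ↔ ∃ y, f (σ i) * y * f (σ j) ≠ 0) ∧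
    (∀ (i j : ι) (w : QPath Arr i j), GMem Λ e arr w →
      ∃ w' : QPath Arr' (σ i) (σ j),
        PathCorr σ (fun i j h => σ1 i j h) w w' ∧ GMem Γ f arr' w') ∧
    (∀ (i j : ι) (w' : QPath Arr' (σ i) (σ j)), GMem Γ f arr' w' →
      ∃ w : QPath Arr i j,
        PathCorr σ (fun i j h => σ1 i j h) w w' ∧ GMem Λ e arr w)

end TauTilting

namespace TauTilting

section Trace
variable {A : Type} [Ring A]

/-- The trace of a family of modules `C` in `Y`. -/
def tr {κ : Type} (C : κ → Mdl A) (Y : Mdl A) : Submodule A Y :=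
  ⨆ j, ⨆ f : C j →ₗ[A] Y, LinearMap.range f

/-- `Y` is finitely generated and generated by the family `C`. -/
def Gen {κ : Type} (C : κ → Mdl A) (Y : Mdl A) : Prop :=
  Module.Finite A Y ∧ tr C Y = ⊤

/-- The restriction of a family of modules to a subset of its index type. -/
abbrev rst {κ : Type} (C : κ → Mdl A) (s : Set κ) : s → Mdl A := fun k => C k

variable {κ κ' : Type} {C : κ → Mdl A} {D : κ' → Mdl A} {X Y Z : Mdl A}

lemma range_le_tr {j : κ} (f : C j →ₗ[A] Y) : LinearMap.range f ≤ tr C Y :=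
  le_iSup_of_le j (le_iSup (fun f : C j →ₗ[A] Y => LinearMap.range f) f)

lemma apply_mem_tr {j : κ} (f : C j →ₗ[A] Y) (x : C j) : f x ∈ tr C Y :=
  range_le_tr f ⟨x, rfl⟩

lemma tr_le {N : Submodule A Y} (h : ∀ j (f : C j →ₗ[A] Y), LinearMap.range f ≤ N) :
    tr C Y ≤ N := iSup_le fun j => iSup_le fun f => h j f

lemma map_tr_le (g : Y →ₗ[A] Z) : (tr C Y).map g ≤ tr C Z := by
  rw [Submodule.map_le_iff_le_comap]
  refine tr_le fun j f => ?_
  rintro _ ⟨x, rfl⟩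
  exact apply_mem_tr (g ∘ₗ f) x

lemma Gen.of_surj (h : Gen C Y) (g : Y →ₗ[A] Z) (hg : Function.Surjective g) : Gen C Z := by
  have := h.1
  refine ⟨Module.Finite.of_surjective g hg, ?_⟩
  have := map_tr_le (C := C) g
  rw [h.2, Submodule.map_top, LinearMap.range_eq_top.2 hg] at this
  exact top_le_iff.1 this

lemma Gen.trans (hC : ∀ k, Gen C (D k)) (h : Gen D Y) : Gen C Y := by
  refine ⟨h.1, top_le_iff.1 ?_⟩
  rw [← h.2]
  refine tr_le fun j f => ?_
  have := map_tr_le (C := C) f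
  rwa [(hC j).2, Submodule.map_top] at this

lemma Gen.self (j : κ) [h : Module.Finite A (C j)] : Gen C (C j) :=
  ⟨h, top_le_iff.1 fun x _ => apply_mem_tr (LinearMap.id : C j →ₗ[A] C j) x⟩

lemma Gen.mono_rst {s t : Set κ} (hst : s ⊆ t) (h : Gen (rst C s) Y) : Gen (rst C t) Y := by
  refine ⟨h.1, top_le_iff.1 ?_⟩
  rw [← h.2]
  exact tr_le fun j f => range_le_tr (C := rst C t) (j := ⟨j, hst j.2⟩) f

lemma Gen.of_rst {s : Set κ} (h : Gen (rst C s) Y) : Gen C Y := by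
  refine ⟨h.1, top_le_iff.1 ?_⟩
  rw [← h.2]
  exact tr_le fun j f => range_le_tr (C := C) (j := j) f

lemma Gen.pi {l : Type} [Fintype l] {Y : l → Mdl A} (h : ∀ i, Gen C (Y i)) :
    Gen C (ModuleCat.of A (∀ i, Y i)) := by
  classical
  have := fun i => (h i).1
  refine ⟨inferInstanceAs (Module.Finite A (∀ i, Y i)), top_le_iff.1 fun x _ => ?_⟩
  have hx : x = ∑ i, LinearMap.single A (fun i => (Y i : Type)) i (x i) :=
    (Finset.univ_sum_single (M := fun i => (Y i : Type)) x).symm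
  rw [hx]
  refine Submodule.sum_mem _ fun i _ => ?_
  refine map_tr_le (C := C) (Y := Y i) (Z := ModuleCat.of A (∀ i, Y i))
    (LinearMap.single A (fun i => (Y i : Type)) i) ⟨x i, ?_, rfl⟩
  rw [(h i).2]; trivial

lemma gen_tr [IsNoetherian A Y] : Gen C (ModuleCat.of A (tr C Y)) := by
  refine ⟨inferInstanceAs (Module.Finite A (tr C Y)), ?_⟩
  have h : tr C Y ≤
      (tr C (ModuleCat.of A (tr C Y))).map (tr C Y).subtype := by
    refine tr_le fun j f => ?_
    rintro _ ⟨x, rfl⟩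
    exact ⟨⟨f x, apply_mem_tr f x⟩, apply_mem_tr (Y := ModuleCat.of A (tr C Y))
      (f.codRestrict (tr C Y) (apply_mem_tr f)) x, rfl⟩
  refine top_le_iff.1 fun x _ => ?_
  obtain ⟨y, hy, hyx⟩ := h x.2
  have : y = x := Subtype.ext hyx
  exact this ▸ hy

lemma Gen.congr (h : ∀ Y, Gen C Y → Gen D Y) (h' : ∀ Y, Gen D Y → Gen C Y) :
    Gen C Y ↔ Gen D Y := ⟨h Y, h' Y⟩

lemma eq_zero_of_tr_eq_top (h : tr C Y = ⊤) (g : Y →ₗ[A] Z)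
    (hg : ∀ j (f : C j →ₗ[A] Y), g ∘ₗ f = 0) : g = 0 := by
  rw [← LinearMap.ker_eq_top, ← top_le_iff, ← h]
  refine tr_le fun j f => ?_
  rintro _ ⟨x, rfl⟩
  exact LinearMap.congr_fun (hg j f) x

lemma exists_ne_zero_of_gen (h : tr C Y = ⊤) [Nontrivial Y] :
    ∃ j, ∃ f : C j →ₗ[A] Y, f ≠ 0 := by
  by_contra! hc
  have := eq_zero_of_tr_eq_top h (LinearMap.id : Y →ₗ[A] Y) (fun j f => by rw [hc j f]; rfl)
  obtain ⟨x, hx⟩ := exists_ne (0 : Y)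
  exact hx (LinearMap.congr_fun this x)

end Trace

section Local
variable {A : Type} [Ring A]

/-- Every endomorphism is invertible or nilpotent. -/
def Loc (X : Mdl A) : Prop :=
  Nontrivial X ∧ ∀ φ : Module.End A X, IsUnit φ ∨ IsNilpotent φ

variable {X Y : Mdl A}

lemma Loc.exists_isUnit_of_sum (hX : Loc X) {l : Type} (s : Finset l) (φ : l → Module.End A X)
    (h : IsUnit (∑ i ∈ s, φ i)) : ∃ i ∈ s, IsUnit (φ i) := by
  classical
  have := hX.1
  induction s using Finset.induction_on with
  | empty => simp at h
  | insert a s ha ih =>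
    rw [Finset.sum_insert ha] at h
    rcases hX.2 (↑(h.unit⁻¹) * φ a) with hu | hn
    · refine ⟨a, Finset.mem_insert_self _ _, ?_⟩
      have := (h.unit.isUnit).mul hu
      rwa [← mul_assoc, IsUnit.unit_spec, IsUnit.mul_val_inv, one_mul] at this
    · have h1 : ↑(h.unit⁻¹) * (∑ i ∈ s, φ i) = 1 - ↑(h.unit⁻¹) * φ a := by
        rw [eq_sub_iff_add_eq', ← mul_add, IsUnit.val_inv_mul]
      have h2 := hn.isUnit_one_sub
      rw [← h1] at h2
      have := (h.unit.isUnit).mul h2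
      rw [← mul_assoc, IsUnit.unit_spec, IsUnit.mul_val_inv, one_mul] at this
      obtain ⟨i, hi, hi'⟩ := ih this
      exact ⟨i, Finset.mem_insert_of_mem hi, hi'⟩

lemma Loc.bijective_of_comp (hX : Loc X) [Nontrivial Y] (g : X →ₗ[A] Y) (ψ : Y →ₗ[A] X)
    (h : Function.Bijective (g ∘ₗ ψ)) : Function.Bijective g := by
  refine ⟨?_, fun y => by obtain ⟨x, hx⟩ := h.2 y; exact ⟨ψ x, hx⟩⟩
  rcases hX.2 (ψ ∘ₗ g) with hu | ⟨n, hn⟩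
  · have := ((Module.End.isUnit_iff _).1 hu).1
    exact Function.Injective.of_comp (f := ψ) (g := g) this
  · exfalso
    have key : ∀ m, g ∘ₗ ((ψ ∘ₗ g : Module.End A X) ^ m) ∘ₗ ψ = (g ∘ₗ ψ : Module.End A Y) ^ (m+1) := by
      intro m
      induction m with
      | zero => ext; simp
      | succ m ih =>
        rw [pow_succ _ (m+1), ← ih, pow_succ]
        rfl
    have h0 := key n
    rw [hn] at h0
    have h1 := ((Module.End.isUnit_iff (M := Y) (g ∘ₗ ψ)).2 h).pow (n+1)
    rw [← h0] at h1
    obtain ⟨y, hy⟩ := exists_ne (0 : Y)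
    obtain ⟨z, hz⟩ := ((Module.End.isUnit_iff _).1 h1).2 y
    exact hy (by rw [← hz]; simp)

lemma Loc.bijective_of_not_isNilpotent (hX : Loc X) (hY : Loc Y) (g : X →ₗ[A] Y) (ψ : Y →ₗ[A] X)
    (h : ¬ IsNilpotent (g ∘ₗ ψ : Module.End A Y)) : Function.Bijective g := by
  have := hY.1
  exact hX.bijective_of_comp g ψ ((Module.End.isUnit_iff _).1 ((hY.2 _).resolve_right h))

lemma Loc.of_equiv (hX : Loc X) (e : X ≃ₗ[A] Y) : Loc Y := by
  refine ⟨have := hX.1; e.symm.toEquiv.nontrivial, fun φ => ?_⟩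
  have h := hX.2 ((e.conjRingEquiv).symm φ)
  rcases h with h | h
  · left; simpa using h.map (e.conjRingEquiv)
  · right; simpa using h.map (e.conjRingEquiv)

/-- A module with local endomorphism ring that is a retract of a finite product of such modules
is isomorphic to one of the factors. -/
lemma Loc.exists_equiv_of_retract {l : Type} [Finite l] [DecidableEq l] {C : l → Mdl A} (hC : ∀ i, Loc (C i))
    (hX : Loc X) (s : X →ₗ[A] ∀ i, C i) (r : (∀ i, C i) →ₗ[A] X) (h : r ∘ₗ s = LinearMap.id) :
    ∃ i, Function.Bijective (r ∘ₗ LinearMap.single A (fun i => (C i : Type)) i) := by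
  have := Fintype.ofFinite l
  have := hX.1
  have h1 : (∑ i, (r ∘ₗ LinearMap.single A (fun i => (C i : Type)) i) ∘ₗ (LinearMap.proj i ∘ₗ s) :
      Module.End A X) = 1 := by
    refine LinearMap.ext fun x => ?_
    have := LinearMap.congr_fun h x
    conv_rhs at this => rw [LinearMap.id_apply]
    rw [LinearMap.comp_apply, ← Finset.univ_sum_single (M := fun i => (C i : Type)) (s x),
      map_sum] at this
    rw [LinearMap.sum_apply]
    exact this
  obtain ⟨i, -, hi⟩ := hX.exists_isUnit_of_sum Finset.univ _ (h1 ▸ isUnit_one)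
  refine ⟨i, (hC i).bijective_of_comp _ (LinearMap.proj i ∘ₗ s) ((Module.End.isUnit_iff _).1 hi)⟩

lemma IsIndec.loc [IsNoetherian A X] [IsArtinian A X] (h : IsIndec X) : Loc X := by
  refine ⟨h.1, fun φ => ?_⟩
  have := h.1
  obtain ⟨n, hn⟩ := (LinearMap.eventually_isCompl_ker_pow_range_pow φ).exists_forall_of_atTop
  have hc := hn (n+1) (Nat.le_succ n)
  rcases h.2 _ _ hc with h0 | h0
  · left
    rw [h0] at hc
    have hs := eq_top_of_bot_isCompl hc
    refine (isUnit_pow_iff (Nat.succ_ne_zero n)).1 ((Module.End.isUnit_iff _).2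
      ⟨LinearMap.ker_eq_bot.1 h0, LinearMap.range_eq_top.1 hs⟩)
  · right
    exact ⟨n+1, LinearMap.range_eq_bot.1 h0⟩

lemma Loc.isIndec (h : Loc X) : IsIndec X := by
  refine ⟨h.1, fun N N' hN => ?_⟩
  set p : Module.End A X := N.subtype ∘ₗ N.projectionOnto N' hN with hp
  have hid : ∀ n, p ^ (n+1) = p := by
    intro n
    induction n with
    | zero => simp
    | succ n ih =>
      rw [pow_succ, ih]
      ext x
      simp [hp, Module.End.mul_apply]
  rcases h.2 p with hu | ⟨n, hn⟩
  · right
    have := LinearMap.ker_eq_bot.2 ((Module.End.isUnit_iff _).1 hu).1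
    rw [hp, LinearMap.ker_comp_of_ker_eq_bot _ (Submodule.ker_subtype N)] at this
    simpa using this
  · left
    have : p = 0 := by rw [← hid n, pow_succ, hn, zero_mul]
    rw [Submodule.eq_bot_iff]
    intro x hx
    have h2 := LinearMap.congr_fun this x
    have h3 := Submodule.projectionOnto_apply_left hN ⟨x, hx⟩
    simp only [hp, LinearMap.comp_apply, LinearMap.zero_apply] at h2
    erw [h3] at h2
    simpa using h2
end Local
end TauTilting

namespace TauTilting
open scoped ModuleCat

set_option linter.unusedSectionVars false
section Dim
variable {K A : Type} [Field K] [Ring A] [Algebra K A] [Module.Finite K A] {X Y Z M : Mdl A}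

lemma finite_base (K : Type) [Field K] [Algebra K A] [Module.Finite K A] (M : Mdl A)
    [Module.Finite A M] : Module.Finite K M := Module.Finite.trans A M

lemma finite_hom (K : Type) [Field K] [Algebra K A] [Module.Finite K A] (X Y : Mdl A)
    [Module.Finite A X] [Module.Finite A Y] : Module.Finite K (X →ₗ[A] Y) := by
  have := finite_base K X
  have := finite_base K Y
  exact Module.Finite.of_injective (LinearMap.restrictScalarsₗ K A X Y K)
    (LinearMap.restrictScalars_injective K)

/-- The dimension of the space of homomorphisms. -/
noncomputable def hd (K : Type) [Field K] [Algebra K A] (X Y : Mdl A) : ℕ :=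
  Module.finrank K (X →ₗ[A] Y)

/-- Postcomposition with a homomorphism. -/
def postc (K : Type) [Field K] [Algebra K A] (X : Mdl A) (p : Y →ₗ[A] Z) :
    (X →ₗ[A] Y) →ₗ[K] (X →ₗ[A] Z) where
  toFun f := p ∘ₗ f
  map_add' f g := LinearMap.comp_add f g p
  map_smul' c f := LinearMap.ext fun x => LinearMap.map_smul_of_tower p c (f x)

/-- Precomposition with a homomorphism. -/
def prec (K : Type) [Field K] [Algebra K A] (Z : Mdl A) (p : X →ₗ[A] Y) :
    (Y →ₗ[A] Z) →ₗ[K] (X →ₗ[A] Z) where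
  toFun f := f ∘ₗ p
  map_add' f g := LinearMap.add_comp p g f
  map_smul' _ _ := rfl

lemma hd_congr_left (e : X ≃ₗ[A] Y) (Z : Mdl A) : hd K X Z = hd K Y Z :=
  LinearEquiv.finrank_eq (LinearEquiv.ofLinearMap (prec K Z e.symm.toLinearMap) (prec K Z e.toLinearMap)
    (by ext; simp [prec]) (by ext; simp [prec]))

lemma hd_pi_left {l : Type} [Fintype l] (C : l → Mdl A) [∀ i, Module.Finite A (C i)] (Y : Mdl A)
    [Module.Finite A Y] : hd K (ModuleCat.of A (∀ i, C i)) Y = ∑ i, hd K (C i) Y := by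
  classical
  have := fun i => finite_hom K (C i) Y
  unfold hd
  rw [← Module.finrank_pi_fintype K (M := fun i => (C i →ₗ[A] Y))]
  refine (LinearEquiv.finrank_eq ?_).symm
  exact LinearMap.lsum A (fun i => (C i : Type)) K

lemma hd_eq_zero [Module.Finite A X] [Module.Finite A Y] : hd K X Y = 0 ↔ HomZero X Y := by
  have := finite_hom K X Y
  rw [hd, Module.finrank_zero_iff]
  exact ⟨fun h f => Subsingleton.elim f 0, fun h => ⟨fun f g => (h f).trans (h g).symm⟩⟩

lemma hd_le_of_exact [Module.Finite A M] [Module.Finite A X] [Module.Finite A Y] [Module.Finite A Z]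
    (f : X →ₗ[A] Y) (g : Y →ₗ[A] Z) (hf : Function.Injective f)
    (hfg : LinearMap.range f = LinearMap.ker g) : hd K M Y ≤ hd K M X + hd K M Z := by
  have := finite_hom K M X
  have := finite_hom K M Y
  have := finite_hom K M Z
  have h1 := (postc K M g).finrank_range_add_finrank_ker
  have h2 := Submodule.finrank_le (LinearMap.range (postc K M g))
  have h3 : LinearMap.ker (postc K M g) ≤ LinearMap.range (postc K M f) := by
    intro h hh
    have hh' : ∀ x, h x ∈ LinearMap.range f := fun x => hfg ▸ LinearMap.congr_fun hh x
    refine ⟨(LinearEquiv.ofInjective f hf).symm.toLinearMap ∘ₗ h.codRestrict _ hh', ?_⟩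
    ext x
    have := LinearEquiv.apply_symm_apply (LinearEquiv.ofInjective f hf) ⟨h x, hh' x⟩
    exact congrArg Subtype.val this
  have h4 := Submodule.finrank_mono h3
  have h5 := LinearMap.finrank_range_le (postc K M f)
  unfold hd
  omega

lemma hd_exact [Module.Finite A M] [Module.Finite A X] [Module.Finite A Y] [Module.Finite A Z]
    (f : X →ₗ[A] Y) (g : Y →ₗ[A] Z) (hf : Function.Injective f)
    (hfg : LinearMap.range f = LinearMap.ker g) (hl : ∀ h : M →ₗ[A] Z, ∃ h', g ∘ₗ h' = h) :
    hd K M Y = hd K M X + hd K M Z := by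
  refine le_antisymm (hd_le_of_exact f g hf hfg) ?_
  have := finite_hom K M X
  have := finite_hom K M Y
  have := finite_hom K M Z
  have h1 := (postc K M g).finrank_range_add_finrank_ker
  have h2 : LinearMap.range (postc K M g) = ⊤ := LinearMap.range_eq_top.2 hl
  have h3 : LinearMap.range (postc K M f) ≤ LinearMap.ker (postc K M g) := by
    rintro _ ⟨h, rfl⟩
    ext x
    have : f (h x) ∈ LinearMap.ker g := hfg ▸ ⟨h x, rfl⟩
    exact this
  have h4 := Submodule.finrank_mono h3
  have h5 := LinearMap.finrank_range_of_inj (f := postc K M f) (by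
    intro a b hab
    ext x
    exact hf (LinearMap.congr_fun hab x))
  rw [h2, finrank_top] at h1
  unfold hd
  omega

lemma exists_decomp (K : Type) [Field K] [Algebra K A] [Module.Finite K A] [IsArtinianRing A]
    (M : Mdl A) [Module.Finite A M] : ∃ (l : Type) (_ : Fintype l) (D : l → Mdl A),
      (∀ i, Module.Finite A (D i)) ∧ (∀ i, Loc (D i)) ∧ Nonempty (M ≃ₗ[A] ∀ i, D i) := by
  suffices H : ∀ (n : ℕ) (M : Mdl A) [Module.Finite A M], Module.finrank K M = n →
      ∃ (l : Type) (_ : Fintype l) (D : l → Mdl A),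
      (∀ i, Module.Finite A (D i)) ∧ (∀ i, Loc (D i)) ∧ Nonempty (M ≃ₗ[A] ∀ i, D i) from
    H _ M rfl
  intro n
  induction n using Nat.strong_induction_on with
  | _ n ih =>
  intro M _ hn
  have := finite_base K M
  by_cases h0 : Nontrivial M
  · by_cases h1 : IsIndec M
    · refine ⟨Unit, inferInstance, fun _ => M, fun _ => inferInstance, fun _ => h1.loc,
        ⟨(LinearEquiv.funUnique Unit A M).symm⟩⟩
    · simp only [IsIndec, h0, true_and] at h1
      push Not at h1
      obtain ⟨N, N', hc, hN, hN'⟩ := h1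
      have e := Submodule.prodEquivOfIsCompl N N' hc
      have hd := LinearEquiv.finrank_eq (e.restrictScalars K)
      have i1 : Module.Finite K N := Module.Finite.of_injective (N.subtype.restrictScalars K) Subtype.val_injective
      have i2 : Module.Finite K N' := Module.Finite.of_injective (N'.subtype.restrictScalars K) Subtype.val_injective
      rw [Module.finrank_prod] at hd
      have := Submodule.nontrivial_iff_ne_bot.2 hN
      have := Submodule.nontrivial_iff_ne_bot.2 hN'
      have p1 : 0 < Module.finrank K N := Module.finrank_pos
      have p2 : 0 < Module.finrank K N' := Module.finrank_pos
      have f1 : Module.Finite A (ModuleCat.of A N) := inferInstanceAs (Module.Finite A N)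
      have f2 : Module.Finite A (ModuleCat.of A N') := inferInstanceAs (Module.Finite A N')
      obtain ⟨l, _, D, hD, hD', ⟨u⟩⟩ := ih (Module.finrank K N) (by omega) (ModuleCat.of A N) rfl
      obtain ⟨l', _, D', hD2, hD2', ⟨u'⟩⟩ := ih (Module.finrank K N') (by omega) (ModuleCat.of A N') rfl
      have u1 : N ≃ₗ[A] ∀ i, D i := u
      have u2 : N' ≃ₗ[A] ∀ i, D' i := u'
      have e2 : M ≃ₗ[A] (∀ i, D i) × (∀ i, D' i) := e.symm.trans (u1.prodCongr u2)
      refine ⟨l ⊕ l', inferInstance, Sum.elim D D', by rintro (i | i); exacts [hD i, hD2 i],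
        by rintro (i | i); exacts [hD' i, hD2' i], ⟨?_⟩⟩
      have e3 := (LinearEquiv.sumPiEquivProdPi A l l' (fun i => ((Sum.elim D D' i : Mdl A) : Type))).symm
      exact LinearEquiv.trans e2 e3
  · rw [not_nontrivial_iff_subsingleton] at h0
    exact ⟨Empty, inferInstance, fun x => x.elim, fun x => x.elim, fun x => x.elim,
      ⟨{ toFun := fun _ x => x.elim, invFun := fun _ => 0, map_add' := fun _ _ => funext fun x => x.elim, map_smul' := fun _ _ => funext fun x => x.elim, left_inv := fun x => Subsingleton.elim _ _, right_inv := fun x => funext fun x => x.elim }⟩⟩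

/-- The set of scalars over which homomorphisms are finitely generated may be taken central. -/
lemma exists_hom_basis (K : Type) [Field K] [Algebra K A] [Module.Finite K A] (X Y : Mdl A)
    [Module.Finite A X] [Module.Finite A Y] : ∃ (n : ℕ) (u : Fin n → (X →ₗ[A] Y)),
      ∀ g, ∃ c : Fin n → K, g = ∑ i, c i • u i := by
  have := finite_hom K X Y
  refine ⟨_, Module.finBasis K (X →ₗ[A] Y), fun g => ⟨(Module.finBasis K (X →ₗ[A] Y)).repr g, ?_⟩⟩
  exact ((Module.finBasis K (X →ₗ[A] Y)).sum_repr g).symm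

lemma exists_minApprox (K : Type) [Field K] [Algebra K A] [Module.Finite K A]
    {κ : Type} [Fintype κ] (C : κ → Mdl A) [∀ k, Module.Finite A (C k)] (Y : Mdl A)
    [Module.Finite A Y] : ∃ (n : ℕ) (j : Fin n → κ) (f : (∀ l, C (j l)) →ₗ[A] Y),
      (∀ k (g : C k →ₗ[A] Y), ∃ h, f ∘ₗ h = g) ∧
      (∀ k l (g : C k →ₗ[A] ∀ l, C (j l)), f ∘ₗ g = 0 →
        ¬ Function.Bijective (LinearMap.proj l ∘ₗ g)) := by
  classical
  have hex : ∃ n, ∃ (j : Fin n → κ) (f : (∀ l, C (j l)) →ₗ[A] Y),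
      (∀ k (g : C k →ₗ[A] Y), ∃ h, f ∘ₗ h = g) := by
    choose n u hu using fun k => exists_hom_basis K (C k) Y
    let e := (Fintype.equivFin (Σ k, Fin (n k))).symm
    refine ⟨_, fun l => (e l).1, LinearMap.lsum A (fun l => (C (e l).1 : Type)) ℕ
      (fun l => u (e l).1 (e l).2), fun k g => ?_⟩
    obtain ⟨c, rfl⟩ := hu k g
    refine ⟨∑ i, c i • LinearMap.single A (fun l => (C (e l).1 : Type)) (e.symm ⟨k, i⟩) ∘ₗ
      (cast (by rw [e.apply_symm_apply]) (LinearMap.id : C k →ₗ[A] C k) : C k →ₗ[A] C (e (e.symm ⟨k, i⟩)).1), ?_⟩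
    have key : ∀ (a b : Σ k, Fin (n k)) (hab : a = b) (x : C a.1),
        u b.1 b.2 ((cast (by rw [hab]) (LinearMap.id : C a.1 →ₗ[A] C a.1) : C a.1 →ₗ[A] C b.1) x) = u a.1 a.2 x := by
      rintro a _ rfl x; rfl
    refine LinearMap.ext fun x => ?_
    rw [LinearMap.comp_apply, LinearMap.sum_apply, map_sum, LinearMap.sum_apply]
    refine Finset.sum_congr rfl fun i _ => ?_
    rw [LinearMap.smul_apply, LinearMap.smul_apply, LinearMap.map_smul_of_tower, LinearMap.comp_apply]
    congr 1
    have h1 := LinearMap.lsum_piSingle A (φ := fun l => (C (e l).1 : Type)) ℕ (fun l => u (e l).1 (e l).2) (e.symm ⟨k, i⟩)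
      ((cast (by rw [e.apply_symm_apply]) (LinearMap.id : C k →ₗ[A] C k) : C k →ₗ[A] C (e (e.symm ⟨k, i⟩)).1) x)
    exact h1.trans (key ⟨k, i⟩ _ (e.apply_symm_apply _).symm x)
  obtain ⟨j, f, hf⟩ := Nat.find_spec hex
  refine ⟨Nat.find hex, j, f, hf, fun k l g hg hb => ?_⟩
  obtain ⟨m, hm⟩ : ∃ m, Nat.find hex = m + 1 := ⟨Nat.find hex - 1, by have := l.pos; omega⟩
  refine Nat.find_min hex (m := m) (by omega) ?_
  generalize Nat.find hex = N at *
  subst hm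
  let f' : (∀ i : Fin m, C (j (l.succAbove i))) →ₗ[A] Y := 
    f ∘ₗ ∑ i, LinearMap.single A (fun l => (C (j l) : Type)) (l.succAbove i) ∘ₗ LinearMap.proj i
  let r : (∀ i, C (j i)) →ₗ[A] (∀ i : Fin m, C (j (l.succAbove i))) :=
    LinearMap.pi fun i => LinearMap.proj (l.succAbove i)
  let q : (∀ i, C (j i)) →ₗ[A] (∀ i, C (j i)) :=
    LinearMap.id - g ∘ₗ (LinearEquiv.ofBijective _ hb).symm.toLinearMap ∘ₗ LinearMap.proj l
  have hq : ∀ x, q x l = 0 := by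
    intro x
    have : (LinearMap.proj l ∘ₗ g) ((LinearEquiv.ofBijective _ hb).symm (x l)) = x l :=
      (LinearEquiv.ofBijective _ hb).apply_symm_apply (x l)
    simp only [LinearMap.comp_apply, LinearMap.proj_apply] at this
    simp [q, this]
  have hfq : ∀ x, f (q x) = f x := by
    intro x
    have := LinearMap.congr_fun hg ((LinearEquiv.ofBijective _ hb).symm (x l))
    simp only [LinearMap.comp_apply, LinearMap.zero_apply] at this
    simp [q, this]
  have hf'r : ∀ x : (∀ i, C (j i)), x l = 0 → f' (r x) = f x := by
    intro x hx
    conv_rhs => rw [← Finset.univ_sum_single (M := fun i => (C (j i) : Type)) x, Fin.sum_univ_succAbove _ l, hx]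
    simp [f', r]
  refine ⟨fun i => j (l.succAbove i), f', fun k' g' => ?_⟩
  obtain ⟨h, rfl⟩ := hf k' g'
  refine ⟨r ∘ₗ q ∘ₗ h, LinearMap.ext fun x => ?_⟩
  simp only [LinearMap.comp_apply]
  rw [hf'r _ (hq _), hfq]

lemma exists_minimal_map (K : Type) [Field K] [Algebra K A] [Module.Finite K A]
    {κ : Type} [Fintype κ] (C : κ → Mdl A) [∀ k, Module.Finite A (C k)] (hC : ∀ k, Loc (C k))
    (Q : Mdl A) [Module.Finite A Q] (k : κ) (f : C k →ₗ[A] Q) (hf : f ≠ 0) :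
    ∃ (j : κ) (p : C j →ₗ[A] Q), p ≠ 0 ∧
      ∀ k (φ : C k →ₗ[A] C j), ¬ Function.Bijective φ → p ∘ₗ φ = 0 := by
  suffices H : ∀ (n : ℕ) (k : κ) (f : C k →ₗ[A] Q), f ≠ 0 →
      ∑ i, Module.finrank K (LinearMap.range (postc K (C i) f)) = n → ∃ (j : κ) (p : C j →ₗ[A] Q),
      p ≠ 0 ∧ ∀ k (φ : C k →ₗ[A] C j), ¬ Function.Bijective φ → p ∘ₗ φ = 0 from H _ k f hf rfl
  intro n
  induction n using Nat.strong_induction_on with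
  | _ n ih =>
  intro k f hf hn
  by_contra hcon
  have h1 : ¬ ∀ k' (φ : C k' →ₗ[A] C k), ¬ Function.Bijective φ → f ∘ₗ φ = 0 :=
    fun h => hcon ⟨k, f, hf, h⟩
  push Not at h1
  obtain ⟨k', φ, hφ, hne⟩ := h1
  refine hcon (ih _ ?_ k' (f ∘ₗ φ) hne rfl)
  rw [← hn]
  have hfin := fun i => finite_hom K (C i) Q
  have hle : ∀ i, LinearMap.range (postc K (C i) (f ∘ₗ φ)) ≤ LinearMap.range (postc K (C i) f) := by
    rintro i _ ⟨g, rfl⟩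
    exact ⟨φ ∘ₗ g, rfl⟩
  refine Finset.sum_lt_sum (fun i _ => Submodule.finrank_mono (hle i)) ⟨k, Finset.mem_univ _, ?_⟩
  refine Submodule.finrank_lt_finrank_of_lt (lt_of_le_of_ne (hle k) fun heq => ?_)
  have : f ∈ LinearMap.range (postc K (C k) (f ∘ₗ φ)) := heq ▸ ⟨LinearMap.id, rfl⟩
  obtain ⟨ψ, hψ⟩ := this
  have hψ' : f ∘ₗ (φ ∘ₗ ψ) = f := hψ
  have hnil : IsNilpotent (φ ∘ₗ ψ : Module.End A (C k)) := by
    by_contra h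
    exact hφ ((hC k').bijective_of_not_isNilpotent (hC k) φ ψ h)
  obtain ⟨m, hm⟩ := hnil
  have : ∀ m, f ∘ₗ ((φ ∘ₗ ψ : Module.End A (C k)) ^ m) = f := by
    intro m
    induction m with
    | zero => rfl
    | succ m ih => rw [pow_succ, Module.End.mul_eq_comp, ← LinearMap.comp_assoc, ih, hψ']
  have h2 := this m
  rw [hm] at h2
  exact hf (h2.symm.trans (LinearMap.comp_zero f))

end Dim
end TauTilting

namespace TauTilting
open scoped ModuleCat
set_option linter.unusedSectionVars false

section Lift
variable {A : Type} [Ring A] {M N X Y Z E : Mdl A}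

lemma exists_lift_of_range_le (i : Y →ₗ[A] E) (hi : Function.Injective i) (u : X →ₗ[A] E)
    (h : LinearMap.range u ≤ LinearMap.range i) : ∃ v : X →ₗ[A] Y, i ∘ₗ v = u := by
  refine ⟨(LinearEquiv.ofInjective i hi).symm.toLinearMap ∘ₗ u.codRestrict _ (fun x => h ⟨x, rfl⟩), ?_⟩
  ext x
  have := LinearEquiv.apply_symm_apply (LinearEquiv.ofInjective i hi) ⟨u x, h ⟨x, rfl⟩⟩
  exact congrArg Subtype.val this

lemma exists_desc_of_ker_le (p : X →ₗ[A] Y) (hp : Function.Surjective p) (u : X →ₗ[A] E)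
    (h : LinearMap.ker p ≤ LinearMap.ker u) : ∃ v : Y →ₗ[A] E, v ∘ₗ p = u := by
  refine ⟨(LinearMap.ker p).liftQ u h ∘ₗ (p.quotKerEquivOfSurjective hp).symm.toLinearMap, ?_⟩
  ext x
  have : (p.quotKerEquivOfSurjective hp).symm (p x) = (LinearMap.ker p).mkQ x :=
    (LinearEquiv.symm_apply_eq _).2 rfl
  simp only [LinearMap.comp_apply, LinearEquiv.coe_coe, this]
  rfl

/-- `Ext¹(M, Y) = 0`, phrased as lifting of homomorphisms. -/
def Lift (M Y : Mdl A) : Prop :=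
  ∀ (E Z : Mdl A) (i : Y →ₗ[A] E) (g : E →ₗ[A] Z), Function.Injective i → Function.Surjective g →
    LinearMap.range i = LinearMap.ker g → ∀ h : M →ₗ[A] Z, ∃ h' : M →ₗ[A] E, g ∘ₗ h' = h

lemma lift_iff : Lift M Y ↔ Ext1Vanish M Y := by
  refine ⟨fun h E i g hi hg hig => h E M i g hi hg hig LinearMap.id, ?_⟩
  intro H E Z i g hi hg hig h
  let S : Submodule A (E × M) := LinearMap.ker (g ∘ₗ LinearMap.fst A E M - h ∘ₗ LinearMap.snd A E M)
  have hS : ∀ x : E × M, x ∈ S ↔ g x.1 = h x.2 := fun x => by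
    simp [S, LinearMap.mem_ker, sub_eq_zero]
  have hgi : ∀ y, g (i y) = 0 := fun y => by
    have : i y ∈ LinearMap.ker g := hig ▸ ⟨y, rfl⟩
    exact this
  let i' : Y →ₗ[A] S := (LinearMap.inl A E M ∘ₗ i).codRestrict S (fun y => (hS _).2 (by simp [hgi]))
  have h1 : Function.Injective i' := fun a b hab => hi (congrArg (fun x : S => x.1.1) hab)
  have h2 : Function.Surjective (LinearMap.snd A E M ∘ₗ S.subtype) := by
    intro m
    obtain ⟨x, hx⟩ := hg (h m)
    exact ⟨⟨(x, m), (hS _).2 hx⟩, rfl⟩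
  have h3 : LinearMap.range i' = LinearMap.ker (LinearMap.snd A E M ∘ₗ S.subtype) := by
    ext ⟨⟨x, m⟩, hx⟩
    constructor
    · rintro ⟨y, hy⟩
      exact (congrArg (fun x : S => x.1.2) hy).symm
    · intro hm
      have hm' : m = 0 := hm
      subst hm'
      have : x ∈ LinearMap.range i := by
        rw [hig]
        have := (hS _).1 hx
        simpa using this
      obtain ⟨y, rfl⟩ := this
      exact ⟨y, rfl⟩
  obtain ⟨s, hs⟩ := H (ModuleCat.of A S) i' (LinearMap.snd A E M ∘ₗ S.subtype) h1 h2 h3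
  refine ⟨LinearMap.fst A E M ∘ₗ S.subtype ∘ₗ s, LinearMap.ext fun m => ?_⟩
  have h1 := (hS _).1 (s m).2
  have h2 : (s m).1.2 = m := LinearMap.congr_fun hs m
  rw [h2] at h1
  exact h1

lemma Lift.of_retract (h : Lift M Y) (s : N →ₗ[A] M) (r : M →ₗ[A] N)
    (hrs : r ∘ₗ s = LinearMap.id) : Lift N Y := by
  intro E Z i g hi hg hig f
  obtain ⟨h', hh⟩ := h E Z i g hi hg hig (f ∘ₗ r)
  refine ⟨h' ∘ₗ s, ?_⟩
  rw [← LinearMap.comp_assoc, hh, LinearMap.comp_assoc, hrs, LinearMap.comp_id]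

lemma Lift.pi {l : Type} [Finite l] {C : l → Mdl A} (h : ∀ i, Lift (C i) Y) :
    Lift (ModuleCat.of A (∀ i, C i)) Y := by
  classical
  have := Fintype.ofFinite l
  intro E Z i g hi hg hig f
  choose h' hh using fun k => h k E Z i g hi hg hig (f ∘ₗ LinearMap.single A (fun i => (C i : Type)) k)
  refine ⟨LinearMap.lsum A (fun i => (C i : Type)) ℕ h', ?_⟩
  refine LinearMap.pi_ext' fun k => ?_
  rw [← hh k]
  ext x
  simp only [LinearMap.comp_apply]
  congr 1
  exact LinearMap.lsum_piSingle A (φ := fun i => (C i : Type)) ℕ h' k x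

/-- `Ext¹(M, Y') = 0` for all quotients `Y'` of `Y`; that is, `Hom(Y, τM) = 0`. -/
def DD (M Y : Mdl A) : Prop :=
  ∀ (Y' : Mdl A) (q : Y →ₗ[A] Y'), Function.Surjective q → Lift M Y'

lemma DD.lift (h : DD M Y) : Lift M Y := h Y LinearMap.id Function.surjective_id

lemma DD.of_surj (h : DD M Y) (g : Y →ₗ[A] Z) (hg : Function.Surjective g) : DD M Z :=
  fun Y' q hq => h Y' (q ∘ₗ g) (hq.comp hg)

lemma DD.of_retract (h : DD M Y) (s : N →ₗ[A] M) (r : M →ₗ[A] N)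
    (hrs : r ∘ₗ s = LinearMap.id) : DD N Y :=
  fun Y' q hq => (h Y' q hq).of_retract s r hrs

lemma DD.of_equiv (h : DD M Y) (e : M ≃ₗ[A] N) : DD N Y :=
  h.of_retract e.symm.toLinearMap e.toLinearMap (by ext; simp)

lemma DD.pi_left {l : Type} [Finite l] {C : l → Mdl A} (h : ∀ i, DD (C i) Y) :
    DD (ModuleCat.of A (∀ i, C i)) Y :=
  fun Y' q hq => Lift.pi fun i => h i Y' q hq

end Lift

section Simple
variable {A : Type} [Ring A] {X Y S : Mdl A}

lemma Loc.bijective_of_simple (hX : Loc X) (hY : Loc Y) [Module.Projective A Y]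
    [IsSimpleModule A S] (g : X →ₗ[A] Y) (q : Y →ₗ[A] S) (h : q ∘ₗ g ≠ 0) :
    Function.Bijective g := by
  obtain ⟨ψ, hψ⟩ := Module.projective_lifting_property (q ∘ₗ g) q (LinearMap.surjective_of_ne_zero h)
  refine hX.bijective_of_not_isNilpotent hY g ψ ?_
  rintro ⟨n, hn⟩
  have key : ∀ m, q ∘ₗ ((g ∘ₗ ψ : Module.End A Y) ^ m) = q := by
    intro m
    induction m with
    | zero => rfl
    | succ m ih => 
      rw [pow_succ, Module.End.mul_eq_comp, ← LinearMap.comp_assoc, ih, ← LinearMap.comp_assoc, hψ]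
  have := key n
  rw [hn] at this
  exact h (by rw [← this, LinearMap.comp_zero, LinearMap.zero_comp])

end Simple

/-- `P` is a complete irredundant family of indecomposable projective modules. -/
structure IsProjFam {A : Type} [Ring A] {ι : Type} (P : ι → Mdl A) : Prop where
  fin : ∀ i, Module.Finite A (P i)
  proj : ∀ i, Module.Projective A (P i)
  loc : ∀ i, Loc (P i)
  inj : ∀ i j, Nonempty (P i ≃ₗ[A] P j) → i = j
  tr_eq : ∀ Y : Mdl A, tr P Y = ⊤

lemma projective_pi {A : Type} [Ring A] {l : Type} [Finite l] {C : l → Mdl A}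
    (h : ∀ i, Module.Projective A (C i)) : Module.Projective A (∀ i, C i) := by
  classical
  have := Fintype.ofFinite l
  exact Module.Projective.of_equiv (DFinsupp.linearEquivFunOnFintype (R := A) (M := fun i => (C i : Type)))

/-- A projective presentation which is minimal in its first term. -/
structure Pres (K : Type) [Field K] {A : Type} [Ring A] [Algebra K A] {ι : Type} [Fintype ι]
    (P : ι → Mdl A) (M : Mdl A) where
  P0 : Mdl A
  P1 : Mdl A
  d : P1 →ₗ[A] P0
  π : P0 →ₗ[A] M
  fin0 : Module.Finite A P0
  fin1 : Module.Finite A P1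
  proj0 : Module.Projective A P0
  proj1 : Module.Projective A P1
  surj : Function.Surjective π
  exact : LinearMap.range d = LinearMap.ker π
  min : ∀ N : Submodule A P1, LinearMap.ker d ⊔ N = ⊤ → N = ⊤
  c : ι → ℤ
  hc : ∀ Y : Mdl A, Module.Finite A Y → (hd K P0 Y : ℤ) - hd K P1 Y = ∑ i, c i * hd K (P i) Y

section Pres
variable {K A : Type} [Field K] [Ring A] [Algebra K A] [Module.Finite K A] [IsArtinianRing A]
  {ι : Type} [Fintype ι] {P : ι → Mdl A} {M N X Y Z E : Mdl A}

lemma Pres.π_d (p : Pres K P M) (x : p.P1) : p.π (p.d x) = 0 := by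
  have : p.d x ∈ LinearMap.ker p.π := p.exact ▸ ⟨x, rfl⟩
  exact this

lemma surj_of_factors {κ : Type} {C : κ → Mdl A} (hY : tr C Y = ⊤) (f : X →ₗ[A] Y)
    (hf : ∀ k (g : C k →ₗ[A] Y), ∃ h, f ∘ₗ h = g) : Function.Surjective f := by
  rw [← LinearMap.range_eq_top, ← top_le_iff, ← hY]
  refine tr_le fun j g => ?_
  obtain ⟨h, rfl⟩ := hf j g
  rintro _ ⟨x, rfl⟩
  exact ⟨h x, rfl⟩

lemma hd_pi_count {m : ℕ} [DecidableEq ι] (hP : IsProjFam P) (j : Fin m → ι) (Y : Mdl A) [Module.Finite A Y] :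
    hd K (ModuleCat.of A (∀ l, P (j l))) Y =
      ∑ i, (Finset.univ.filter fun l => j l = i).card * hd K (P i) Y := by
  have := hP.fin
  rw [hd_pi_left]
  simp_rw [Finset.card_filter, Finset.sum_mul]
  rw [Finset.sum_comm]
  refine Finset.sum_congr rfl fun l _ => ?_
  simp

lemma IsProjFam.nonempty_pres (hP : IsProjFam P) (K : Type) [Field K] [Algebra K A]
    [Module.Finite K A] (M : Mdl A) [Module.Finite A M] : Nonempty (Pres K P M) := by
  classical
  have := hP.fin
  have := hP.proj
  obtain ⟨n, j, f, hf, -⟩ := exists_minApprox K P M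
  have fsurj := surj_of_factors (X := ModuleCat.of A (∀ l, P (j l))) (hP.tr_eq M) f hf
  have : Module.Finite A (ModuleCat.of A (LinearMap.ker f)) :=
    inferInstanceAs (Module.Finite A (LinearMap.ker f))
  obtain ⟨m, j', f', hf', hmin⟩ := exists_minApprox K P (ModuleCat.of A (LinearMap.ker f))
  have fsurj' := surj_of_factors (X := ModuleCat.of A (∀ l, P (j' l))) (hP.tr_eq _) f' hf'
  refine ⟨⟨ModuleCat.of A (∀ l, P (j l)), ModuleCat.of A (∀ l, P (j' l)),
    (LinearMap.ker f).subtype ∘ₗ f', f, inferInstanceAs (Module.Finite A (∀ l, P (j l))),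
    inferInstanceAs (Module.Finite A (∀ l, P (j' l))), projective_pi fun l => hP.proj (j l),
    projective_pi fun l => hP.proj (j' l), fsurj, ?_, ?_,
    fun i => (Finset.univ.filter fun l => j l = i).card - (Finset.univ.filter fun l => j' l = i).card, ?_⟩⟩
  · rw [LinearMap.range_comp, LinearMap.range_eq_top.2 fsurj', Submodule.map_top, Submodule.range_subtype]
  · intro N hN
    by_contra hne
    have : IsCoatomic (Submodule A (∀ l, P (j' l))) := inferInstance
    obtain ⟨H, hH, hNH⟩ := (eq_top_or_exists_le_coatom N).resolve_left hne
    have hs : IsSimpleModule A (ModuleCat.of A ((∀ l, P (j' l)) ⧸ H)) := isSimpleModule_iff_isCoatom.2 hH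
    have hker : LinearMap.ker ((LinearMap.ker f).subtype ∘ₗ f') = LinearMap.ker f' :=
      LinearMap.ker_comp_of_ker_eq_bot _ (Submodule.ker_subtype _)
    rw [hker] at hN
    have h1 : ¬ LinearMap.ker f' ≤ H := fun h => hH.1 (top_le_iff.1 (hN ▸ sup_le h hNH))
    have h2 : H.mkQ ∘ₗ (LinearMap.ker f').subtype ≠ 0 := by
      intro h0
      apply h1
      intro x hx
      have := LinearMap.congr_fun h0 ⟨x, hx⟩
      exact (Submodule.Quotient.mk_eq_zero H).1 this
    have h3 := mt (eq_zero_of_tr_eq_top (Y := ModuleCat.of A (LinearMap.ker f'))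
      (Z := ModuleCat.of A ((∀ l, P (j' l)) ⧸ H)) (hP.tr_eq _) (H.mkQ ∘ₗ (LinearMap.ker f').subtype)) h2
    push Not at h3
    obtain ⟨k, g, hg⟩ := h3
    let g' : P k →ₗ[A] ∀ l, P (j' l) := (LinearMap.ker f').subtype ∘ₗ g
    have hg'0 : f' ∘ₗ g' = 0 := LinearMap.ext fun x => (g x).2
    have hg' : H.mkQ ∘ₗ g' ≠ 0 := hg
    have : ∃ l, (H.mkQ ∘ₗ LinearMap.single A (fun l => (P (j' l) : Type)) l) ∘ₗ (LinearMap.proj l ∘ₗ g') ≠ 0 := by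
      by_contra! hcon
      apply hg'
      ext x
      rw [LinearMap.comp_apply, ← Finset.univ_sum_single (M := fun l => (P (j' l) : Type)) (g' x), map_sum]
      exact Finset.sum_eq_zero fun l _ => LinearMap.congr_fun (hcon l) x
    obtain ⟨l, hl⟩ := this
    exact hmin k l g' hg'0 ((hP.loc k).bijective_of_simple (hP.loc _) (LinearMap.proj l ∘ₗ g')
      (S := ModuleCat.of A ((∀ l, P (j' l)) ⧸ H)) _ hl)
  · intro Y hY
    rw [hd_pi_count hP, hd_pi_count hP]
    push_cast
    rw [← Finset.sum_sub_distrib]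
    exact Finset.sum_congr rfl fun i _ => by ring

lemma Pres.exists_extend (p : Pres K P M) (h : Lift M Y) (φ : p.P1 →ₗ[A] Y)
    (hφ : LinearMap.ker p.d ≤ LinearMap.ker φ) : ∃ v : p.P0 →ₗ[A] Y, v ∘ₗ p.d = φ := by
  let R : Submodule A (p.P0 × Y) := LinearMap.range (p.d.prod (-φ))
  let i : Y →ₗ[A] (p.P0 × Y) ⧸ R := R.mkQ ∘ₗ LinearMap.inr A p.P0 Y
  let g : ((p.P0 × Y) ⧸ R) →ₗ[A] M := R.liftQ (p.π ∘ₗ LinearMap.fst A p.P0 Y) (by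
    rintro _ ⟨x, rfl⟩
    simp [p.π_d])
  have hi : Function.Injective i := by
    rw [injective_iff_map_eq_zero]
    intro y hy
    obtain ⟨x, hx⟩ := (Submodule.Quotient.mk_eq_zero R).1 hy
    have h1 : p.d x = 0 := congrArg Prod.fst hx
    have h2 : -φ x = y := congrArg Prod.snd hx
    have h3 : φ x = 0 := hφ h1
    rw [← h2, h3, neg_zero]
  have hd : ∀ x, R.mkQ (p.d x, 0) = i (φ x) := by
    intro x
    refine (Submodule.Quotient.eq R).2 ⟨x, ?_⟩
    simp
  have hg : Function.Surjective g := fun m => by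
    obtain ⟨x, rfl⟩ := p.surj m
    exact ⟨R.mkQ (x, 0), rfl⟩
  have hig : LinearMap.range i = LinearMap.ker g := by
    ext e
    constructor
    · rintro ⟨y, rfl⟩
      simp [i, g]
    · intro he
      obtain ⟨⟨x, y⟩, rfl⟩ := R.mkQ_surjective e
      have hx : x ∈ LinearMap.range p.d := by
        rw [p.exact]; exact he
      obtain ⟨z, rfl⟩ := hx
      refine ⟨φ z + y, ?_⟩
      rw [map_add, ← hd]
      change R.mkQ _ + R.mkQ _ = _
      rw [← map_add]
      simp
  obtain ⟨s, hs⟩ := h (ModuleCat.of A ((p.P0 × Y) ⧸ R)) M i g hi hg hig LinearMap.id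
  obtain ⟨v, hv⟩ := exists_lift_of_range_le (X := p.P0) (E := ModuleCat.of A ((p.P0 × Y) ⧸ R)) i hi
    (R.mkQ ∘ₗ LinearMap.inl A p.P0 Y - s ∘ₗ p.π) (by
      rw [hig]
      rintro _ ⟨x, rfl⟩
      have : g (s (p.π x)) = p.π x := LinearMap.congr_fun hs (p.π x)
      rw [LinearMap.mem_ker, LinearMap.sub_apply, map_sub]
      exact sub_eq_zero.2 this.symm)
  refine ⟨v, LinearMap.ext fun x => hi ?_⟩
  have := LinearMap.congr_fun hv (p.d x)
  rw [← hd]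
  refine this.trans ?_
  rw [LinearMap.sub_apply, LinearMap.comp_apply s, p.π_d, map_zero, sub_zero]
  rfl

lemma Pres.dd_iff (p : Pres K P M) :
    DD M Y ↔ ∀ f : p.P1 →ₗ[A] Y, ∃ h : p.P0 →ₗ[A] Y, h ∘ₗ p.d = f := by
  have := p.proj0
  have := p.proj1
  constructor
  · intro H f
    let L : Submodule A Y := (LinearMap.ker p.d).map f
    obtain ⟨v, hv⟩ := p.exists_extend (H (ModuleCat.of A (Y ⧸ L)) L.mkQ L.mkQ_surjective) (L.mkQ ∘ₗ f)
      (fun x hx => (Submodule.Quotient.mk_eq_zero L).2 ⟨x, hx, rfl⟩)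
    obtain ⟨v', hv'⟩ := Module.projective_lifting_property L.mkQ v L.mkQ_surjective
    refine ⟨v', ?_⟩
    have h1 : LinearMap.ker (f - v' ∘ₗ p.d) = ⊤ := by
      refine p.min _ (top_le_iff.1 fun x _ => ?_)
      have hx : (f - v' ∘ₗ p.d) x ∈ L := by
        rw [← Submodule.Quotient.mk_eq_zero]
        have h2 := LinearMap.congr_fun hv x
        have h3 := LinearMap.congr_fun hv' (p.d x)
        rw [LinearMap.sub_apply, Submodule.Quotient.mk_sub]
        refine sub_eq_zero.2 ?_
        exact h2.symm.trans h3.symm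
      obtain ⟨k, hk, hkx⟩ := hx
      have : x = k + (x - k) := by abel
      rw [this]
      refine Submodule.add_mem_sup hk ?_
      have hk0 : p.d k = 0 := hk
      rw [LinearMap.mem_ker, map_sub, ← hkx, LinearMap.sub_apply, LinearMap.comp_apply, hk0]
      simp
    rw [LinearMap.ker_eq_top, sub_eq_zero] at h1
    exact h1.symm
  · intro H Y' q hq E Z i g hi hg hig h
    obtain ⟨u, hu⟩ := Module.projective_lifting_property g (h ∘ₗ p.π) hg
    have hud : ∀ x, g (u x) = h (p.π x) := fun x => LinearMap.congr_fun hu x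
    obtain ⟨f, hf⟩ := exists_lift_of_range_le i hi (u ∘ₗ p.d) (by
      rw [hig]
      rintro _ ⟨x, rfl⟩
      simp [hud, p.π_d])
    obtain ⟨f', hf'⟩ := Module.projective_lifting_property q f hq
    obtain ⟨v, hv⟩ := H f'
    have hgi : ∀ y, g (i y) = 0 := fun y => by
      have : i y ∈ LinearMap.ker g := hig ▸ ⟨y, rfl⟩
      exact this
    obtain ⟨h', hh'⟩ := exists_desc_of_ker_le p.π p.surj (u - i ∘ₗ q ∘ₗ v) (by
      rw [← p.exact]
      rintro _ ⟨x, rfl⟩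
      have h1 : i (f x) = u (p.d x) := LinearMap.congr_fun hf x
      have h2 : q (f' x) = f x := LinearMap.congr_fun hf' x
      have h3 : v (p.d x) = f' x := LinearMap.congr_fun hv x
      simp [h3, h2, h1])
    refine ⟨h', LinearMap.ext fun m => ?_⟩
    obtain ⟨x, rfl⟩ := p.surj m
    have h1 : h' (p.π x) = _ := LinearMap.congr_fun hh' x
    rw [LinearMap.comp_apply, h1, LinearMap.sub_apply, map_sub, hud]
    simp [hgi]

lemma IsProjFam.dd_pi_right (hP : IsProjFam P) (K : Type) [Field K] [Algebra K A] [Module.Finite K A]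
    [Module.Finite A M] {l : Type} {C : l → Mdl A} (h : ∀ i, DD M (C i)) :
    DD M (ModuleCat.of A (∀ i, C i)) := by
  obtain ⟨p⟩ := hP.nonempty_pres K M
  rw [p.dd_iff]
  intro f
  choose v hv using fun i => p.dd_iff.1 (h i) (LinearMap.proj i ∘ₗ f)
  refine ⟨LinearMap.pi v, LinearMap.ext fun x => funext fun i => ?_⟩
  exact LinearMap.congr_fun (hv i) x

lemma exists_surj_of_gen (K : Type) [Field K] [Algebra K A] [Module.Finite K A] {κ : Type} [Finite κ]
    {C : κ → Mdl A} [∀ k, Module.Finite A (C k)] (h : Gen C Y) :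
    ∃ (n : ℕ) (j : Fin n → κ) (f : (∀ l, C (j l)) →ₗ[A] Y), Function.Surjective f := by
  have := h.1
  have := Fintype.ofFinite κ
  obtain ⟨n, j, f, hf, -⟩ := exists_minApprox K C Y
  exact ⟨n, j, f, surj_of_factors (X := ModuleCat.of A (∀ l, C (j l))) h.2 f hf⟩

lemma IsProjFam.dd_of_gen (hP : IsProjFam P) (K : Type) [Field K] [Algebra K A] [Module.Finite K A]
    [Module.Finite A M] {κ : Type} [Finite κ]
    {C : κ → Mdl A} [∀ k, Module.Finite A (C k)] (hC : ∀ k, DD M (C k)) (h : Gen C Y) : DD M Y := by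
  obtain ⟨n, j, f, hf⟩ := exists_surj_of_gen K h
  exact (hP.dd_pi_right K (fun l => hC (j l))).of_surj (Y := ModuleCat.of A (∀ l, C (j l))) f hf

lemma IsProjFam.dd_ker (hP : IsProjFam P) (K : Type) [Field K] [Algebra K A] [Module.Finite K A]
    [Module.Finite A M] (f : X →ₗ[A] Y) (hX : DD M X) (hf : ∀ g : M →ₗ[A] Y, ∃ h, f ∘ₗ h = g) :
    DD M (ModuleCat.of A (LinearMap.ker f)) := by
  obtain ⟨p⟩ := hP.nonempty_pres K M
  rw [p.dd_iff] at hX ⊢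
  intro f0
  obtain ⟨h, hh⟩ := hX ((LinearMap.ker f).subtype ∘ₗ f0)
  have hh' : ∀ x, h (p.d x) = (f0 x).1 := fun x => LinearMap.congr_fun hh x
  obtain ⟨m, hm⟩ := exists_desc_of_ker_le p.π p.surj (f ∘ₗ h) (by
    rw [← p.exact]
    rintro _ ⟨x, rfl⟩
    rw [LinearMap.mem_ker, LinearMap.comp_apply, hh']
    exact (f0 x).2)
  obtain ⟨m', hm'⟩ := hf m
  refine ⟨(h - m' ∘ₗ p.π).codRestrict (LinearMap.ker f) (fun x => ?_), LinearMap.ext fun x => Subtype.ext ?_⟩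
  · have h1 : m (p.π x) = f (h x) := LinearMap.congr_fun hm x
    have h2 : f (m' (p.π x)) = m (p.π x) := LinearMap.congr_fun hm' _
    rw [LinearMap.mem_ker, LinearMap.sub_apply, map_sub, LinearMap.comp_apply, h2, h1, sub_self]
  · simp [hh', p.π_d]

lemma Pres.postc_ker (p : Pres K P M) [Module.Finite A M] (Y : Mdl A) [Module.Finite A Y] :
    (hd K M Y : ℤ) = hd K p.P0 Y - Module.finrank K (LinearMap.range (prec K Y p.d)) := by
  have := p.fin0
  have := p.fin1
  have := finite_hom K M Y
  have := finite_hom K p.P0 Y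
  have h1 := (prec K Y p.d).finrank_range_add_finrank_ker
  have h2 : LinearMap.ker (prec K Y p.d) = LinearMap.range (prec K Y p.π) := by
    ext u
    constructor
    · intro hu
      obtain ⟨v, hv⟩ := exists_desc_of_ker_le p.π p.surj u (by
        rw [← p.exact]
        rintro _ ⟨x, rfl⟩
        exact LinearMap.congr_fun hu x)
      exact ⟨v, hv⟩
    · rintro ⟨v, rfl⟩
      ext x
      simp [prec, p.π_d]
  have h3 := LinearMap.finrank_range_of_inj (f := prec K Y p.π) (by
    intro a b hab
    ext x
    obtain ⟨x, rfl⟩ := p.surj x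
    exact LinearMap.congr_fun hab x)
  rw [h2, h3] at h1
  unfold hd
  omega

lemma Pres.sum_le (p : Pres K P M) [Module.Finite A M] (Y : Mdl A) [Module.Finite A Y] :
    ∑ i, p.c i * hd K (P i) Y ≤ hd K M Y := by
  rw [← p.hc Y inferInstance, p.postc_ker]
  have := p.fin1
  have := finite_hom K p.P1 Y
  have := Submodule.finrank_le (LinearMap.range (prec K Y p.d))
  unfold hd
  omega

lemma Pres.sum_eq (p : Pres K P M) [Module.Finite A M] (Y : Mdl A) [Module.Finite A Y]
    (h : DD M Y) : ∑ i, p.c i * hd K (P i) Y = hd K M Y := by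
  rw [← p.hc Y inferInstance, p.postc_ker]
  have : LinearMap.range (prec K Y p.d) = ⊤ := LinearMap.range_eq_top.2 fun f => p.dd_iff.1 h f
  rw [this, finrank_top]
  rfl

end Pres
end TauTilting

namespace TauTilting
open scoped ModuleCat
set_option linter.unusedSectionVars false

/-- A τ-rigid family of pairwise non-isomorphic modules with local endomorphism rings. -/
structure RF {A : Type} [Ring A] {κ : Type} (C : κ → Mdl A) : Prop where
  fin : ∀ k, Module.Finite A (C k)
  loc : ∀ k, Loc (C k)
  inj : ∀ j k, Nonempty (C j ≃ₗ[A] C k) → j = k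
  dd : ∀ j k, DD (C j) (C k)

/-- The sum of the images of the non-invertible maps from members of the family to `C j`. -/
def rad {A : Type} [Ring A] {κ : Type} (C : κ → Mdl A) (j : κ) : Submodule A (C j) :=
  ⨆ φ : (Σ k, {φ : C k →ₗ[A] C j // ¬ Function.Bijective φ}), LinearMap.range φ.2.1

/-- `Hom(P j, Y) = 0` for all `j ∈ J`. -/
def Van {A : Type} [Ring A] {ι : Type} (P : ι → Mdl A) (J : Set ι) (Y : Mdl A) : Prop :=
  ∀ j ∈ J, HomZero (P j) Y

/-- The support of a family of modules with respect to the projectives `P`. -/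
def spp {A : Type} [Ring A] {ι κ : Type} (P : ι → Mdl A) (C : κ → Mdl A) : Set ι :=
  {i | ∃ k, ¬ HomZero (P i) (C k)}

section RF
variable {A : Type} [Ring A] {ι κ : Type} {P : ι → Mdl A} {C : κ → Mdl A} {X Y Z : Mdl A}

lemma gen_iSup [IsNoetherian A Y] {I : Type} (X : I → Mdl A) (f : ∀ i, X i →ₗ[A] Y)
    (h : ∀ i, tr C (X i) = ⊤) : Gen C (ModuleCat.of A ↥(⨆ i, LinearMap.range (f i))) := by
  set N := ⨆ i, LinearMap.range (f i) with hN
  refine ⟨inferInstanceAs (Module.Finite A N), ?_⟩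
  have key : N ≤ (tr C (ModuleCat.of A N)).map N.subtype := by
    conv_lhs => rw [hN]
    refine iSup_le fun i => ?_
    have hfi : ∀ x, f i x ∈ N := fun x => le_iSup (fun i => LinearMap.range (f i)) i ⟨x, rfl⟩
    have h1 := map_tr_le (C := C) (Z := ModuleCat.of A N) ((f i).codRestrict N hfi)
    rw [h i, Submodule.map_top] at h1
    rintro _ ⟨x, rfl⟩
    exact ⟨⟨f i x, hfi x⟩, h1 ⟨x, rfl⟩, rfl⟩
  refine top_le_iff.1 fun x _ => ?_
  obtain ⟨y, hy, hyx⟩ := key x.2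
  have : y = x := Subtype.ext hyx
  exact this ▸ hy

lemma HomZero.of_surj [Module.Projective A X] (h : HomZero X Y) (g : Y →ₗ[A] Z)
    (hg : Function.Surjective g) : HomZero X Z := by
  intro f
  obtain ⟨f', rfl⟩ := Module.projective_lifting_property g f hg
  rw [h f', LinearMap.comp_zero]

lemma HomZero.of_inj (h : HomZero X Z) (g : Y →ₗ[A] Z) (hg : Function.Injective g) : HomZero X Y :=
  fun f => LinearMap.ext fun x => hg ((LinearMap.congr_fun (h (g ∘ₗ f)) x).trans (map_zero g).symm)

lemma Van.of_surj (hP : IsProjFam P) {J : Set ι} (h : Van P J Y) (g : Y →ₗ[A] Z)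
    (hg : Function.Surjective g) : Van P J Z :=
  fun j hj => have := hP.proj j; (h j hj).of_surj g hg

lemma Van.of_inj {J : Set ι} (h : Van P J Z) (g : Y →ₗ[A] Z) (hg : Function.Injective g) :
    Van P J Y := fun j hj => (h j hj).of_inj g hg

lemma Van.pi {J : Set ι} {l : Type} {C : l → Mdl A} (h : ∀ i, Van P J (C i)) :
    Van P J (ModuleCat.of A (∀ i, C i)) :=
  fun j hj f => LinearMap.ext fun x => funext fun i =>
    LinearMap.congr_fun (h i j hj (LinearMap.proj i ∘ₗ f)) x

lemma Van.of_gen (hP : IsProjFam P) {J : Set ι} (h : ∀ k, Van P J (C k)) (hY : Gen C Y) :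
    Van P J Y := by
  intro j hj f
  by_contra hf
  have := (hP.loc j).1
  have := hP.proj j
  have h1 : LinearMap.range f ≤ tr C Y := hY.2 ▸ le_top
  let π : (DirectSum (Σ k, (C k →ₗ[A] Y)) fun x => C x.1) →ₗ[A] Y :=
    by classical exact DirectSum.toModule A _ _ fun x => x.2
  have hπ : Function.Surjective π := by
    classical
    rw [← LinearMap.range_eq_top, ← top_le_iff, ← hY.2]
    refine tr_le fun k g => ?_
    rintro _ ⟨x, rfl⟩
    exact ⟨DirectSum.lof A _ (fun x : (Σ k, (C k →ₗ[A] Y)) => (C x.1 : Type)) ⟨k, g⟩ x,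
      DirectSum.toModule_lof A _ _⟩
  obtain ⟨f', hf'⟩ := Module.projective_lifting_property π f hπ
  apply hf
  rw [← hf']
  have : f' = 0 := by
    refine LinearMap.ext fun x => DFinsupp.ext fun y => ?_
    exact LinearMap.congr_fun (h y.1 j hj (DirectSum.component A _ _ y ∘ₗ f')) x
  rw [this, LinearMap.comp_zero]

lemma van_spp_compl (k : κ) : Van P (spp P C)ᶜ (C k) := by
  intro j hj
  by_contra h
  exact hj ⟨k, h⟩

lemma RF.restrict (h : RF C) (s : Set κ) : RF (rst C s) :=
  ⟨fun k => h.fin k, fun k => h.loc k, fun j k e => Subtype.ext (h.inj j k e), fun j k => h.dd j k⟩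

lemma apply_mem_rad {j k : κ} (φ : C k →ₗ[A] C j) (hφ : ¬ Function.Bijective φ) (x : C k) :
    φ x ∈ rad C j :=
  le_iSup (fun φ : (Σ k, {φ : C k →ₗ[A] C j // ¬ Function.Bijective φ}) => LinearMap.range φ.2.1)
    ⟨k, φ, hφ⟩ ⟨x, rfl⟩

end RF

section K
variable {K A : Type} [Field K] [Ring A] [Algebra K A] [Module.Finite K A] [IsArtinianRing A]
  {ι κ : Type} [Fintype ι] [Finite κ] {P : ι → Mdl A} {C : κ → Mdl A} {M N X Y Z E : Mdl A}

lemma RF.dd_gen (hC : RF C) (hP : IsProjFam P) (K : Type) [Field K] [Algebra K A]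
    [Module.Finite K A] (j : κ) (h : Gen C Y) : DD (C j) Y :=
  have := hC.fin
  hP.dd_of_gen K (hC.dd j) h

lemma RF.gen_self (hC : RF C) (j : κ) : Gen C (C j) := have := hC.fin; Gen.self j

lemma RF.gen_rad (hC : RF C) (j : κ) : Gen C (ModuleCat.of A (rad C j)) := by
  have := hC.fin
  exact gen_iSup (C := C) (Y := C j)
    (fun φ : (Σ k, {φ : C k →ₗ[A] C j // ¬ Function.Bijective φ}) => C φ.1) _ fun i => (hC.gen_self i.1).2

lemma RF.exists_rad_ne_top (hC : RF C) (K : Type) [Field K] [Algebra K A] [Module.Finite K A]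
    [Module.Finite A Y] (k : κ) (f : C k →ₗ[A] Y) (hf : f ≠ 0) :
    ∃ j, ∃ p : C j →ₗ[A] Y, p ≠ 0 ∧ rad C j ≤ LinearMap.ker p := by
  have := hC.fin
  have := Fintype.ofFinite κ
  obtain ⟨j, p, hp, h⟩ := exists_minimal_map K C hC.loc Y k f hf
  refine ⟨j, p, hp, iSup_le fun φ => ?_⟩
  rintro _ ⟨x, rfl⟩
  exact LinearMap.congr_fun (h _ φ.2.1 φ.2.2) x

lemma ne_top_of_le_ker {S : Submodule A X} {p : X →ₗ[A] Y} (hp : p ≠ 0) (h : S ≤ LinearMap.ker p) :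
    S ≠ ⊤ := by
  rintro rfl
  exact hp (LinearMap.ker_eq_top.1 (top_le_iff.1 h))

/-- Nakayama-type lemma: if `C j` is not generated by the other members, its radical is proper. -/
lemma RF.rad_ne_top (hC : RF C) (hP : IsProjFam P) (K : Type) [Field K] [Algebra K A]
    [Module.Finite K A] (j : κ) (hj : ¬ Gen (rst C {j}ᶜ) (C j)) : rad C j ≠ ⊤ := by
  have hfin := hC.fin
  set N := tr (TauTilting.rst C {j}ᶜ) (C j) with hN
  have hNt : N ≠ ⊤ := fun h => hj ⟨hC.fin j, h⟩
  have hgN : Gen C (ModuleCat.of A N) := Gen.of_rst gen_tr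
  have hz : ∀ k, k ≠ j → HomZero (C k) (ModuleCat.of A (C j ⧸ N)) := by
    intro k hk h
    obtain ⟨h', rfl⟩ := (hC.dd_gen hP K k hgN).lift (C j) (ModuleCat.of A (C j ⧸ N)) N.subtype N.mkQ
      Subtype.val_injective N.mkQ_surjective (by simp) h
    refine LinearMap.ext fun x => (Submodule.Quotient.mk_eq_zero N).2 ?_
    exact apply_mem_tr (C := TauTilting.rst C {j}ᶜ) (j := ⟨k, hk⟩) h' x
  have : Module.Finite A (ModuleCat.of A (C j ⧸ N)) := inferInstanceAs (Module.Finite A (C j ⧸ N))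
  obtain ⟨j', p, hp, hker⟩ := hC.exists_rad_ne_top (Y := ModuleCat.of A (C j ⧸ N)) K j N.mkQ (by
    intro h0
    apply hNt
    rw [← Submodule.ker_mkQ N, LinearMap.ker_eq_top]
    exact h0)
  have : j' = j := by
    by_contra hne
    exact hp (hz j' hne p)
  subst this
  exact ne_top_of_le_ker hp hker

/-- The top of `C j` relative to the family `C`. -/
abbrev rtop (C : κ → Mdl A) (j : κ) : Mdl A := ModuleCat.of A (C j ⧸ rad C j)

lemma RF.homZero_rtop (hC : RF C) (hP : IsProjFam P) (K : Type) [Field K] [Algebra K A]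
    [Module.Finite K A] {j k : κ} (hkj : k ≠ j) : HomZero (C k) (rtop C j) := by
  intro h
  obtain ⟨h', rfl⟩ := (hC.dd_gen hP K k (hC.gen_rad j)).lift (C j) (rtop C j) (rad C j).subtype
    (rad C j).mkQ Subtype.val_injective (rad C j).mkQ_surjective (by simp) h
  refine LinearMap.ext fun x => (Submodule.Quotient.mk_eq_zero _).2 ?_
  exact apply_mem_rad h' (fun hb => hkj (hC.inj _ _ ⟨LinearEquiv.ofBijective h' hb⟩)) x

lemma not_homZero_rtop {j : κ} (hj : rad C j ≠ ⊤) : ¬ HomZero (C j) (rtop C j) := by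
  intro h
  apply hj
  rw [← Submodule.ker_mkQ (rad C j), LinearMap.ker_eq_top]
  exact h _

lemma RF.finite_rtop (hC : RF C) (j : κ) : Module.Finite A (rtop C j) :=
  have := hC.fin j
  inferInstanceAs (Module.Finite A (C j ⧸ rad C j))

lemma sum_restrict [Fintype ι] {J : Set ι} (hY : Van P J Y) (hP : IsProjFam P) [Module.Finite A Y]
    (g : ι → ℚ) [Fintype {i // i ∉ J}] :
    ∑ i : {i // i ∉ J}, g i * (hd K (P i) Y : ℚ) = ∑ i, g i * (hd K (P i) Y : ℚ) := by
  classical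
  have := hP.fin
  rw [← Finset.sum_subtype (Finset.univ.filter (· ∉ J)) (by simp)
    (fun i => g i * (hd K (P i) Y : ℚ))]
  refine Finset.sum_filter_of_ne fun i _ hi hiJ => hi ?_
  rw [hd_eq_zero.2 (hY i hiJ), Nat.cast_zero, mul_zero]

lemma RF.linearIndependent [Fintype κ] (hC : RF C) (hP : IsProjFam P) {J : Set ι}
    (hJ : ∀ k, Van P J (C k)) (p : ∀ k, Pres K P (C k)) :
    LinearIndependent ℚ (fun k (i : {i // i ∉ J}) => ((p k).c i : ℚ)) := by
  classical
  have hfin := hC.fin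
  rw [Fintype.linearIndependent_iff]
  intro g hg
  by_contra! hne
  obtain ⟨k0, hk0⟩ := hne
  let s : Set κ := {k | g k ≠ 0}
  have hs := hC.restrict s
  have := (hC.loc k0).1
  obtain ⟨⟨j, hj⟩, q, hq, hqr⟩ := hs.exists_rad_ne_top (Y := C k0) K ⟨k0, hk0⟩ LinearMap.id (by
    intro h
    obtain ⟨x, hx⟩ := exists_ne (0 : C k0)
    exact hx (LinearMap.congr_fun h x))
  have hrad := ne_top_of_le_ker hq hqr
  set B := rtop (rst C s) ⟨j, hj⟩ with hB
  have hBfin : Module.Finite A B := hs.finite_rtop _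
  let π : C j →ₗ[A] B := (rad (rst C s) ⟨j, hj⟩).mkQ
  have hπ : Function.Surjective π := (rad (rst C s) ⟨j, hj⟩).mkQ_surjective
  have hvan : Van P J B := (hJ j).of_surj hP π hπ
  have h1 : ∀ k, ∑ i : {i // i ∉ J}, ((p k).c i : ℚ) * (hd K (P i) B : ℚ) = hd K (C k) B := by
    intro k
    rw [sum_restrict hvan hP (fun i => ((p k).c i : ℚ))]
    exact_mod_cast (p k).sum_eq B ((hC.dd k j).of_surj π hπ)
  have h2 : ∑ k, g k * (hd K (C k) B : ℚ) = 0 := by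
    simp_rw [← h1, Finset.mul_sum]
    rw [Finset.sum_comm]
    refine Finset.sum_eq_zero fun i _ => ?_
    have := congrFun hg i
    simp only [Finset.sum_apply, Pi.smul_apply, smul_eq_mul, Pi.zero_apply] at this
    simp_rw [← mul_assoc, ← Finset.sum_mul, this, zero_mul]
  rw [Finset.sum_eq_single j] at h2
  · rcases mul_eq_zero.1 h2 with h | h
    · exact hj h
    · exact not_homZero_rtop hrad (hd_eq_zero.1 (by exact_mod_cast h))
  · intro k _ hkj
    by_cases hk : g k = 0
    · rw [hk, zero_mul]
    · rw [hd_eq_zero.2 (hs.homZero_rtop (k := ⟨k, hk⟩) hP K (by simpa using hkj)), Nat.cast_zero, mul_zero]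
  · simp

lemma RF.card_le (hC : RF C) (hP : IsProjFam P) (K : Type) [Field K] [Algebra K A]
    [Module.Finite K A] {J : Set ι} (hJ : ∀ k, Van P J (C k)) : Nat.card κ ≤ Jᶜ.ncard := by
  classical
  have := Fintype.ofFinite κ
  have := hC.fin
  have h := (hC.linearIndependent (K := K) hP hJ
    (fun k => (hP.nonempty_pres K (C k)).some)).fintype_card_le_finrank
  rw [Module.finrank_fintype_fun_eq_card] at h
  rw [Nat.card_eq_fintype_card, ← Nat.card_coe_set_eq]
  exact h.trans_eq (Nat.card_eq_fintype_card (α := {i // i ∉ J})).symm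

end K
end TauTilting

namespace TauTilting
open scoped ModuleCat
set_option linter.unusedSectionVars false

section LB
variable {K A : Type} [Field K] [Ring A] [Algebra K A] [Module.Finite K A] [IsArtinianRing A]
  {ι κ : Type} [Fintype ι] {P : ι → Mdl A} {C : κ → Mdl A} {M N X Y Z E : Mdl A}

lemma hd_exact_left [Module.Finite A X] [Module.Finite A Y] [Module.Finite A Z] [Module.Finite A E]
    (f : X →ₗ[A] Y) (q : Y →ₗ[A] Z) (hq : Function.Surjective q)
    (hfq : LinearMap.range f = LinearMap.ker q) (hl : ∀ g : X →ₗ[A] E, ∃ h, h ∘ₗ f = g) :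
    hd K Y E = hd K Z E + hd K X E := by
  have := finite_hom K X E
  have := finite_hom K Y E
  have := finite_hom K Z E
  have h1 := (prec K E f).finrank_range_add_finrank_ker
  have h2 : LinearMap.ker (prec K E f) = LinearMap.range (prec K E q) := by
    ext u
    constructor
    · intro hu
      obtain ⟨v, hv⟩ := exists_desc_of_ker_le q hq u (by
        rw [← hfq]
        rintro _ ⟨x, rfl⟩
        exact LinearMap.congr_fun (show u ∘ₗ f = 0 from hu) x)
      exact ⟨v, hv⟩
    · rintro ⟨v, rfl⟩
      refine LinearMap.ext fun x => ?_
      have : q (f x) = 0 := by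
        have : f x ∈ LinearMap.ker q := hfq ▸ ⟨x, rfl⟩
        exact this
      show v (q (f x)) = 0
      rw [this, map_zero]
  have h3 : LinearMap.range (prec K E f) = ⊤ := LinearMap.range_eq_top.2 hl
  have h4 : Module.finrank K (LinearMap.range (prec K E q)) = hd K Z E :=
    LinearMap.finrank_range_of_inj fun u v huv => LinearMap.ext fun z => by
      obtain ⟨y, rfl⟩ := hq z
      exact LinearMap.congr_fun (show u ∘ₗ q = v ∘ₗ q from huv) y
  rw [h2, h3, h4, finrank_top] at h1
  unfold hd at *
  omega

lemma ncard_spp_le [Fintype κ] (hC : RF C) (hP : IsProjFam P)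
    (ha : ∀ i ∈ spp P C, ∃ a : κ → ℤ, ∀ Y, Gen C Y →
      (hd K (P i) Y : ℤ) = ∑ k, a k * hd K (C k) Y) : (spp P C).ncard ≤ Nat.card κ := by
  classical
  have hPfin := hP.fin
  have hPproj := hP.proj
  have hCfin := hC.fin
  choose a ha using fun i : spp P C => ha i i.2
  have hLI : LinearIndependent ℚ (fun (i : spp P C) k => (a i k : ℚ)) := by
    rw [Fintype.linearIndependent_iff]
    intro x hx
    have key : ∀ Y, Gen C Y → ∑ i : spp P C, x i * (hd K (P i) Y : ℚ) = 0 := by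
      intro Y hY
      have h1 : ∀ i : spp P C, (hd K (P i) Y : ℚ) = ∑ k, (a i k : ℚ) * hd K (C k) Y := by
        intro i
        exact_mod_cast ha i Y hY
      simp_rw [h1, Finset.mul_sum]
      rw [Finset.sum_comm]
      refine Finset.sum_eq_zero fun k _ => ?_
      have := congrFun hx k
      simp only [Finset.sum_apply, Pi.smul_apply, smul_eq_mul, Pi.zero_apply] at this
      simp_rw [← mul_assoc, ← Finset.sum_mul, this, zero_mul]
    rintro ⟨i, hi⟩
    obtain ⟨k, hk⟩ := hi
    have hk' := hk
    unfold HomZero at hk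
    push Not at hk
    obtain ⟨f, hf⟩ := hk
    set Q := LinearMap.range f with hQ
    have hQnt : Nontrivial Q := by
      rw [Submodule.nontrivial_iff_ne_bot, hQ, Ne, LinearMap.range_eq_bot]
      exact hf
    obtain ⟨N, hN⟩ := IsCoatomic.exists_coatom (Submodule A Q)
    let S : Mdl A := ModuleCat.of A (Q ⧸ N)
    have hSs : IsSimpleModule A S := isSimpleModule_iff_isCoatom.2 hN
    have hSfin : Module.Finite A S := inferInstanceAs (Module.Finite A (Q ⧸ N))
    let NN := N.map Q.subtype
    let Y1 : Mdl A := ModuleCat.of A (C k ⧸ NN)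
    let Y2 : Mdl A := ModuleCat.of A (C k ⧸ Q)
    have hY1 : Gen C Y1 := (hC.gen_self k).of_surj NN.mkQ NN.mkQ_surjective
    have hY2 : Gen C Y2 := (hC.gen_self k).of_surj Q.mkQ Q.mkQ_surjective
    have := hY1.1
    have := hY2.1
    have hle : NN ≤ Q := by
      rintro _ ⟨y, _, rfl⟩
      exact y.2
    let s : S →ₗ[A] Y1 := N.mapQ NN Q.subtype (Submodule.le_comap_map _ _)
    let g : Y1 →ₗ[A] Y2 := Submodule.factor hle
    have hs : Function.Injective s := by
      rw [injective_iff_map_eq_zero]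
      intro z hz
      obtain ⟨y, rfl⟩ := N.mkQ_surjective z
      have h1 : (y : C k) ∈ NN := (Submodule.Quotient.mk_eq_zero NN).1 hz
      obtain ⟨y', hy', hyy⟩ := h1
      have : y' = y := Subtype.ext hyy
      exact (Submodule.Quotient.mk_eq_zero N).2 (this ▸ hy')
    have hsg : LinearMap.range s = LinearMap.ker g := by
      ext z
      constructor
      · rintro ⟨z, rfl⟩
        obtain ⟨y, rfl⟩ := N.mkQ_surjective z
        exact (Submodule.Quotient.mk_eq_zero Q).2 y.2
      · intro hz
        obtain ⟨y, rfl⟩ := NN.mkQ_surjective z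
        have h1 : y ∈ Q := (Submodule.Quotient.mk_eq_zero Q).1 hz
        exact ⟨N.mkQ ⟨y, h1⟩, rfl⟩
    have hgs : Function.Surjective g := Submodule.factor_surjective hle
    have hex : ∀ t, hd K (P t) Y1 = hd K (P t) S + hd K (P t) Y2 := fun t =>
      hd_exact s g hs hsg fun h => Module.projective_lifting_property g h hgs
    let q : P i →ₗ[A] S := N.mkQ ∘ₗ f.rangeRestrict
    have hq : Function.Surjective q := N.mkQ_surjective.comp f.surjective_rangeRestrict
    have hS0 : ∀ t, t ≠ i → hd K (P t) S = 0 := by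
      intro t hti
      refine hd_eq_zero.2 fun h => ?_
      by_contra hne
      obtain ⟨h', hh'⟩ := Module.projective_lifting_property q h hq
      have hb := (hP.loc t).bijective_of_simple (hP.loc i) h' q (by rwa [hh'])
      exact hti (hP.inj _ _ ⟨LinearEquiv.ofBijective h' hb⟩)
    have hSi : hd K (P i) S ≠ 0 := by
      intro h0
      have := hSs.nontrivial
      obtain ⟨z, hz⟩ := exists_ne (0 : S)
      obtain ⟨y, rfl⟩ := hq z
      exact hz (LinearMap.congr_fun (hd_eq_zero.1 h0 q) y)
    have e1 := key Y1 hY1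
    simp_rw [hex, Nat.cast_add, mul_add, Finset.sum_add_distrib, key Y2 hY2, add_zero] at e1
    rw [Finset.sum_eq_single ⟨i, k, hk'⟩] at e1
    · exact (mul_eq_zero.1 e1).resolve_right (by exact_mod_cast hSi)
    · intro t _ ht
      rw [hS0 t fun h => ht (Subtype.ext h), Nat.cast_zero, mul_zero]
    · simp
  have h := hLI.fintype_card_le_finrank
  rw [Module.finrank_fintype_fun_eq_card] at h
  rwa [Nat.card_eq_fintype_card, ← Nat.card_coe_set_eq, Nat.card_eq_fintype_card]

lemma exists_reps {L : Type} [Fintype L] (E : L → Mdl A) :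
    ∃ (κ : Type) (_ : Fintype κ) (r : κ → L), (∀ j k, Nonempty (E (r j) ≃ₗ[A] E (r k)) → j = k) ∧
      ∀ l, ∃ k, Nonempty (E l ≃ₗ[A] E (r k)) := by
  classical
  let s : Setoid L := ⟨fun a b => Nonempty (E a ≃ₗ[A] E b),
    fun a => ⟨LinearEquiv.refl A _⟩, fun ⟨h⟩ => ⟨h.symm⟩, fun ⟨h⟩ ⟨h'⟩ => ⟨h.trans h'⟩⟩
  refine ⟨Quotient s, inferInstance, Quotient.out, fun j k h => ?_, fun l => ⟨⟦l⟧, ?_⟩⟩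
  · exact Quotient.out_equiv_out.1 h
  · exact Setoid.symm (Quotient.mk_out (s := s) l)

/-- A family of representatives of the summands of a basic support τ-tilting module. -/
structure ST {A : Type} [Ring A] {ι κ : Type} (P : ι → Mdl A) (C : κ → Mdl A) : Prop extends RF C where
  card : Nat.card κ = (spp P C).ncard

lemma exists_st (hP : IsProjFam P) (K : Type) [Field K] [Algebra K A] [Module.Finite K A]
    [Module.Finite A M] (hM : DD M M) :
    ∃ (κ : Type) (_ : Fintype κ) (C : κ → Mdl A), ST P C ∧
      ∀ Y, Gen C Y ↔ Gen (fun _ : Unit => M) Y := by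
  classical
  have hPfin := hP.fin
  have hPproj := hP.proj
  choose n u hu using fun i => exists_hom_basis K (P i) M
  let Mn : ι → Mdl A := fun i => ModuleCat.of A (∀ _ : Fin (n i), M)
  let f : ∀ i, P i →ₗ[A] Mn i := fun i => LinearMap.pi (u i)
  let T : ι → Mdl A := fun i => ModuleCat.of A (Mn i ⧸ LinearMap.range (f i))
  have hMMn : ∀ i, Module.Finite A (Mn i) := fun i => inferInstanceAs (Module.Finite A (∀ _, M))
  have hgM : Gen (fun _ : Unit => M) M := Gen.self (C := fun _ : Unit => M) ()
  have hgMn : ∀ i, Gen (fun _ : Unit => M) (Mn i) := fun i => Gen.pi fun _ => hgM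
  have hgT : ∀ i, Gen (fun _ : Unit => M) (T i) := fun i =>
    (hgMn i).of_surj (LinearMap.range (f i)).mkQ (Submodule.mkQ_surjective _)
  have hTfin := fun i => (hgT i).1
  have hMY : ∀ Y, Gen (fun _ : Unit => M) Y → DD M Y := fun Y hY =>
    hP.dd_of_gen K (fun _ => hM) hY
  have hext : ∀ i Y, Gen (fun _ : Unit => M) Y → ∀ v : P i →ₗ[A] Y, ∃ w, w ∘ₗ f i = v := by
    intro i Y hY v
    obtain ⟨m, j, p, hp⟩ := exists_surj_of_gen K hY
    obtain ⟨v', rfl⟩ := Module.projective_lifting_property p v hp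
    choose c hc using fun l => hu i (LinearMap.proj l ∘ₗ v')
    refine ⟨p ∘ₗ LinearMap.pi fun l => ∑ t, c l t • LinearMap.proj t, ?_⟩
    rw [LinearMap.comp_assoc]
    congr 1
    refine LinearMap.ext fun x => funext fun l => ?_
    have := LinearMap.congr_fun (hc l) x
    rw [LinearMap.comp_apply, LinearMap.proj_apply] at this
    rw [this]
    simp only [LinearMap.comp_apply, f, LinearMap.pi_apply, LinearMap.sum_apply, LinearMap.smul_apply]
    rfl
  have hTY : ∀ i Y, Gen (fun _ : Unit => M) Y → Lift (T i) Y := by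
    intro i Y hY E Z a g ha hg hag h
    have hl : Lift (Mn i) Y := Lift.pi fun _ => (hMY Y hY).lift
    obtain ⟨h', hh'⟩ := hl E Z a g ha hg hag (h ∘ₗ (LinearMap.range (f i)).mkQ)
    obtain ⟨v, hv⟩ := exists_lift_of_range_le a ha (h' ∘ₗ f i) (by
      rw [hag]
      rintro _ ⟨x, rfl⟩
      have h2 : (LinearMap.range (f i)).mkQ (f i x) = 0 :=
        (Submodule.Quotient.mk_eq_zero _).2 ⟨x, rfl⟩
      have := LinearMap.congr_fun hh' (f i x)
      rw [LinearMap.comp_apply, LinearMap.comp_apply, h2, map_zero] at this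
      exact this)
    obtain ⟨w, hw⟩ := hext i Y hY v
    have hker : LinearMap.range (f i) ≤ LinearMap.ker (h' - a ∘ₗ w) := by
      rintro _ ⟨x, rfl⟩
      have e1 := LinearMap.congr_fun hv x
      have e2 := LinearMap.congr_fun hw x
      simp only [LinearMap.comp_apply] at e1 e2
      simp [e2, e1]
    refine ⟨(LinearMap.range (f i)).liftQ _ hker, ?_⟩
    refine LinearMap.ext fun z => ?_
    obtain ⟨y, rfl⟩ := Submodule.mkQ_surjective _ z
    have e3 : g (a (w y)) = 0 := by
      have : a (w y) ∈ LinearMap.ker g := hag ▸ ⟨_, rfl⟩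
      exact this
    have e4 := LinearMap.congr_fun hh' y
    simp only [LinearMap.comp_apply] at e4
    rw [← e4, LinearMap.comp_apply, Submodule.mkQ_apply, Submodule.liftQ_apply, LinearMap.sub_apply,
      map_sub, LinearMap.comp_apply, e3, sub_zero]
  have hTd : ∀ i Y, Gen (fun _ : Unit => M) Y → DD (T i) Y := fun i Y hY Y' q hq =>
    hTY i Y' (hY.of_surj q hq)
  let D : Option ι → Mdl A := fun o => o.elim M T
  have hDg : ∀ o, Gen (fun _ : Unit => M) (D o) := by
    rintro (_ | i)
    exacts [hgM, hgT i]
  have hDfin := fun o => (hDg o).1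
  have hDd : ∀ o Y, Gen (fun _ : Unit => M) Y → DD (D o) Y := by
    rintro (_ | i)
    exacts [hMY, hTd i]
  choose l hl E hEfin hEloc hE using fun o => exists_decomp K (D o)
  obtain ⟨κ, hκ, r, hr, hr'⟩ := exists_reps (L := Σ o, l o) (fun x => E x.1 x.2)
  let C : κ → Mdl A := fun k => E (r k).1 (r k).2
  have hEg : ∀ o x, Gen (fun _ : Unit => M) (E o x) := by
    intro o x
    obtain ⟨φ⟩ := hE o
    exact (hDg o).of_surj (LinearMap.proj x ∘ₗ φ.toLinearMap)
      (fun y => by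
        classical
        exact ⟨φ.symm (Pi.single x y), by simp⟩)
  have hEd : ∀ o x Y, Gen (fun _ : Unit => M) Y → DD (E o x) Y := by
    intro o x Y hY
    obtain ⟨φ⟩ := hE o
    exact (hDd o Y hY).of_retract
      (φ.symm.toLinearMap ∘ₗ LinearMap.single A (fun x => (E o x : Type)) x)
      (LinearMap.proj x ∘ₗ φ.toLinearMap) (by ext y; simp)
  have hCrf : RF C := ⟨fun k => hEfin _ _, fun k => hEloc _ _, hr, fun j k => hEd _ _ _ (hEg _ _)⟩
  have hCg : ∀ Y, Gen C Y ↔ Gen (fun _ : Unit => M) Y := by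
    refine fun Y => ⟨Gen.trans fun k => hEg _ _, Gen.trans fun _ => ?_⟩
    obtain ⟨φ⟩ := hE none
    have h1 : Gen C (ModuleCat.of A (∀ x, E none x)) := Gen.pi fun x => by
      obtain ⟨k, ⟨ψ⟩⟩ := hr' ⟨none, x⟩
      exact (hCrf.gen_self k).of_surj ψ.symm.toLinearMap ψ.symm.surjective
    exact h1.of_surj (Y := ModuleCat.of A (∀ x, E none x)) φ.symm.toLinearMap φ.symm.surjective
  have hCfin := hCrf.fin
  have hDa : ∀ o, ∃ a : κ → ℤ, ∀ Y, Gen C Y → (hd K (D o) Y : ℤ) = ∑ k, a k * hd K (C k) Y := by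
    intro o
    obtain ⟨φ⟩ := hE o
    choose k hk using fun x => hr' ⟨o, x⟩
    refine ⟨fun t => ∑ x, if k x = t then 1 else 0, fun Y hY => ?_⟩
    have := hY.1
    have h1 : hd K (D o) Y = hd K (ModuleCat.of A (∀ x, E o x)) Y :=
      hd_congr_left (Y := ModuleCat.of A (∀ x, E o x)) φ Y
    rw [h1, hd_pi_left]
    simp_rw [Finset.sum_mul]
    rw [Finset.sum_comm]
    push_cast
    refine Finset.sum_congr rfl fun x _ => ?_
    simp only [ite_mul, one_mul, zero_mul, Finset.sum_ite_eq, Finset.mem_univ, if_true]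
    obtain ⟨ψ⟩ := hk x
    exact_mod_cast hd_congr_left ψ Y
  refine ⟨κ, hκ, C, ⟨hCrf, le_antisymm ?_ ?_⟩, hCg⟩
  · have := hCrf.card_le hP K (fun k => van_spp_compl (P := P) k)
    rwa [compl_compl] at this
  · refine ncard_spp_le (K := K) hCrf hP fun i _ => ?_
    obtain ⟨a, ha⟩ := hDa none
    obtain ⟨b, hb⟩ := hDa (some i)
    refine ⟨fun k => n i * a k - b k, fun Y hY => ?_⟩
    have := hY.1
    have h1 : hd K (Mn i) Y = hd K (T i) Y + hd K (P i) Y :=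
      hd_exact_left (f i) (LinearMap.range (f i)).mkQ (Submodule.mkQ_surjective _)
        (by rw [Submodule.ker_mkQ]) (hext i Y ((hCg Y).1 hY))
    have h2 : hd K (Mn i) Y = n i * hd K M Y := by
      rw [hd_pi_left (fun _ : Fin (n i) => M)]
      simp
    have e1 := ha Y hY
    have e2 := hb Y hY
    simp_rw [sub_mul, Finset.sum_sub_distrib, mul_assoc, ← Finset.mul_sum, ← e1, ← e2]
    change _ = (n i : ℤ) * (hd K M Y : ℤ) - (hd K (T i) Y : ℤ)
    have e3 : (n i : ℤ) * (hd K M Y : ℤ) = hd K (T i) Y + hd K (P i) Y := by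
      exact_mod_cast h2.symm.trans h1
    rw [e3]
    ring

end LB
end TauTilting

namespace TauTilting
open scoped ModuleCat
set_option linter.unusedSectionVars false

section Bongartz
variable {K A : Type} [Field K] [Ring A] [Algebra K A] [Module.Finite K A] [IsArtinianRing A]
  {ι κ : Type} [Fintype ι] {P : ι → Mdl A} {C : κ → Mdl A} {M N X Y Z E : Mdl A}

/-- `Y` is finite, `Hom(P j, Y) = 0` for `j ∈ J`, and `Ext¹(M, Fac Y) = 0`. -/
structure Tors {A : Type} [Ring A] {ι : Type} (P : ι → Mdl A) (J : Set ι) (M Y : Mdl A) : Prop where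
  fin : Module.Finite A Y
  dd : DD M Y
  van : Van P J Y

lemma tr_eq_bot_of_van {J : Set ι} (h : Van P J Y) (f : X →ₗ[A] Y) :
    tr (rst P J) X ≤ LinearMap.ker f := by
  refine tr_le fun j g => ?_
  rintro _ ⟨x, rfl⟩
  exact LinearMap.congr_fun (h j j.2 (f ∘ₗ g)) x

set_option maxHeartbeats 2000000 in
/-- Bongartz completion relative to a finitely generated projective module `G`. -/
lemma exists_bongartz (hP : IsProjFam P) (K : Type) [Field K] [Algebra K A] [Module.Finite K A]
    (G : Mdl A) [Module.Finite A G] [Module.Projective A G] {J : Set ι} (p : Pres K P M)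
    (hM : DD M M) (hJ : Van P J M) :
    ∃ (E : Mdl A) (φ : G →ₗ[A] E) (k : ℕ) (q : E →ₗ[A] (Fin k → M)), Tors P J M E ∧
      (∀ Y, Tors P J M Y → Lift E Y ∧ ∀ g : G →ₗ[A] Y, ∃ h, h ∘ₗ φ = g) ∧
      Function.Surjective q ∧ LinearMap.ker q ≤ LinearMap.range φ ∧
      ∀ y, φ y = 0 → ∃ (x : Fin k → p.P1) (u : Fin k → (p.P1 →ₗ[A] G)),
        (∀ l, p.d (x l) = 0) ∧ y + ∑ l, u l (x l) ∈ tr (rst P J) G := by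
  classical
  have hPproj := hP.proj
  have := p.fin0
  have := p.fin1
  have := p.proj0
  have := p.proj1
  obtain ⟨k, u, hu⟩ := exists_hom_basis K p.P1 G
  have hproj : Module.Projective A (Fin k → p.P0) := projective_pi (C := fun _ => p.P0) fun _ => p.proj0
  let F : Mdl A := ModuleCat.of A ((Fin k → p.P0) × G)
  have hFproj : Module.Projective A F := inferInstanceAs (Module.Projective A ((Fin k → p.P0) × G))
  have hFfin : Module.Finite A F := inferInstanceAs (Module.Finite A ((Fin k → p.P0) × G))
  let D : (Fin k → p.P1) →ₗ[A] (Fin k → p.P0) := LinearMap.pi fun l => p.d ∘ₗ LinearMap.proj l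
  let U : (Fin k → p.P1) →ₗ[A] G := ∑ l, u l ∘ₗ LinearMap.proj l
  have hU : ∀ x, U x = ∑ l, u l (x l) := fun x => by simp [U]
  let δ : (Fin k → p.P1) →ₗ[A] F := D.prod (-U)
  let W : Submodule A F := LinearMap.range δ ⊔ tr (rst P J) F
  let E : Mdl A := ModuleCat.of A (F ⧸ W)
  let mk : F →ₗ[A] E := W.mkQ
  have hmk : Function.Surjective mk := W.mkQ_surjective
  have hmk0 : ∀ x, mk x = 0 ↔ x ∈ W := fun x => Submodule.Quotient.mk_eq_zero W
  have hEfin : Module.Finite A E := inferInstanceAs (Module.Finite A (F ⧸ W))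
  let φ : G →ₗ[A] E := mk ∘ₗ LinearMap.inr A _ _
  have hφ : ∀ x, φ (U x) = mk (D x, 0) := by
    intro x
    rw [eq_comm, ← sub_eq_zero]
    change mk _ - mk _ = 0
    rw [← map_sub, hmk0]
    refine Submodule.mem_sup_left ⟨x, ?_⟩
    refine Prod.ext ?_ ?_
    · change D x = D x - 0
      rw [sub_zero]
    · change -(U x) = 0 - U x
      rw [zero_sub]
  have hvanE : Van P J E := by
    intro j hj f
    obtain ⟨f', rfl⟩ := Module.projective_lifting_property mk f hmk
    refine LinearMap.ext fun x => (hmk0 _).2 (Submodule.mem_sup_right ?_)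
    exact apply_mem_tr (C := rst P J) (j := ⟨j, hj⟩) f' x
  have desc : ∀ (Y : Mdl A) (h : F →ₗ[A] Y), (∀ x, h (δ x) = 0) → tr (rst P J) F ≤ LinearMap.ker h →
      ∃ h' : E →ₗ[A] Y, h' ∘ₗ mk = h := by
    intro Y h h1 h2
    refine exists_desc_of_ker_le mk hmk h ?_
    rw [show LinearMap.ker mk = W from W.ker_mkQ]
    refine sup_le ?_ h2
    rintro _ ⟨x, rfl⟩
    exact h1 x
  have hlift : ∀ v : p.P1 →ₗ[A] p.P0, (∀ x, v x ∈ LinearMap.ker p.π) →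
      ∃ s : p.P1 →ₗ[A] p.P1, ∀ x, p.d (s x) = v x := by
    intro v hv
    obtain ⟨s, hs⟩ := Module.projective_lifting_property p.d.rangeRestrict
      (v.codRestrict (LinearMap.range p.d) fun x => p.exact ▸ hv x) p.d.surjective_rangeRestrict
    exact ⟨s, fun x => congrArg Subtype.val (LinearMap.congr_fun hs x)⟩
  have hddE : DD M E := by
    rw [p.dd_iff]
    intro f
    obtain ⟨f', rfl⟩ := Module.projective_lifting_property mk f hmk
    have hv : ∀ l, ∃ v : p.P0 →ₗ[A] M,
        v ∘ₗ p.d = p.π ∘ₗ LinearMap.proj l ∘ₗ LinearMap.fst A (Fin k → p.P0) G ∘ₗ f' :=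
      fun l => p.dd_iff.1 hM _
    choose v hv using hv
    choose s' hs' using fun l => Module.projective_lifting_property p.π (v l) p.surj
    have hs : ∀ l, ∃ s : p.P1 →ₗ[A] p.P1, ∀ x, p.d (s x) = (f' x).1 l - s' l (p.d x) := by
      intro l
      refine hlift (LinearMap.proj l ∘ₗ LinearMap.fst A (Fin k → p.P0) G ∘ₗ f' - s' l ∘ₗ p.d) ?_
      intro x
      have e1 := LinearMap.congr_fun (hv l) x
      have e2 := LinearMap.congr_fun (hs' l) (p.d x)
      simp only [LinearMap.comp_apply] at e1 e2
      rw [LinearMap.mem_ker, LinearMap.sub_apply, map_sub, LinearMap.comp_apply, LinearMap.comp_apply,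
        LinearMap.comp_apply, e2, e1, sub_self]
    choose s hs using hs
    let S : p.P1 →ₗ[A] (Fin k → p.P1) := LinearMap.pi s
    let b : p.P1 →ₗ[A] G := LinearMap.snd A (Fin k → p.P0) G ∘ₗ f' + U ∘ₗ S
    obtain ⟨c, hc⟩ := hu b
    let T : p.P1 →ₗ[A] (Fin k → p.P1) := LinearMap.pi fun l => c l • LinearMap.id
    have hT : ∀ x, b x = U (T x) := by
      intro x
      rw [hc, hU, LinearMap.sum_apply]
      refine Finset.sum_congr rfl fun l _ => ?_
      exact ((u l).map_smul_of_tower (c l) x).symm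
    let T0 : p.P0 →ₗ[A] (Fin k → p.P0) := LinearMap.pi fun l => c l • LinearMap.id
    have hT0 : ∀ x, T0 (p.d x) = D (T x) := by
      intro x
      funext l
      exact (p.d.map_smul_of_tower (c l) x).symm
    refine ⟨mk ∘ₗ LinearMap.inl A _ _ ∘ₗ (LinearMap.pi s' + T0), LinearMap.ext fun x => ?_⟩
    have e1 : f' x = ((LinearMap.pi s' (p.d x), 0) : (Fin k → p.P0) × G) + (D (S x), 0) +
        (0, (f' x).2) := by
      refine Prod.ext ?_ ?_
      · funext l
        have := hs l x
        change _ = s' l (p.d x) + p.d (s l x) + 0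
        rw [this]
        simp
      · change (f' x).2 = 0 + 0 + (f' x).2
        rw [add_zero, zero_add]
    have e2 : mk ((0 : Fin k → p.P0), (f' x).2) = φ (f' x).2 := rfl
    have e3 : b x = (f' x).2 + U (S x) := rfl
    have e4 : mk (D (T x), 0) = φ (f' x).2 + mk (D (S x), 0) := by
      rw [← hφ, ← hφ, ← map_add, ← e3, hT]
    have e5 : mk (f' x) = mk (LinearMap.pi s' (p.d x), 0) + mk (D (S x), 0) + φ (f' x).2 := by
      conv_lhs => rw [e1]
      exact (map_add mk _ _).trans (congrArg₂ _ (map_add mk _ _) e2)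
    have e6 : mk (LinearMap.pi s' (p.d x) + D (T x), 0) =
        mk (LinearMap.pi s' (p.d x), 0) + mk (D (T x), 0) := by
      rw [← map_add]
      congr 1
      exact Prod.ext rfl (add_zero _).symm
    change mk (LinearMap.pi s' (p.d x) + T0 (p.d x), 0) = mk (f' x)
    rw [hT0, e6, e4, e5]
    abel
  let q0 : F →ₗ[A] ModuleCat.of A (Fin k → M) :=
    LinearMap.pi fun l => p.π ∘ₗ LinearMap.proj l ∘ₗ LinearMap.fst A (Fin k → p.P0) G
  have hq0 : ∀ x, q0 (δ x) = 0 := fun x => funext fun l => p.π_d (x l)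
  have hq1 : tr (rst P J) F ≤ LinearMap.ker q0 :=
    tr_eq_bot_of_van (Y := ModuleCat.of A (Fin k → M)) (Van.pi fun _ => hJ) q0
  obtain ⟨q, hq⟩ := desc (ModuleCat.of A (Fin k → M)) q0 hq0 hq1
  have hq' : ∀ a l, q (mk a) l = p.π (a.1 l) := fun a l => congrFun (LinearMap.congr_fun hq a) l
  refine ⟨E, φ, k, q, ⟨hEfin, hddE, hvanE⟩, ?_, ?_, ?_, ?_⟩
  · rintro Y ⟨-, hYd, hYv⟩
    constructor
    · intro E' Z i g hi hg hig h
      obtain ⟨h1, hh1⟩ := Module.projective_lifting_property g (h ∘ₗ mk) hg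
      have hh1' : ∀ x, g (h1 x) = h (mk x) := fun x => LinearMap.congr_fun hh1 x
      obtain ⟨v, hv⟩ := exists_lift_of_range_le (X := ModuleCat.of A (Fin k → p.P1)) i hi (h1 ∘ₗ δ) (by
        rw [hig]
        rintro _ ⟨x, rfl⟩
        have : mk (δ x) = 0 := (hmk0 _).2 (Submodule.mem_sup_left ⟨x, rfl⟩)
        rw [LinearMap.mem_ker, LinearMap.comp_apply, hh1', this, map_zero])
      choose w hw using fun l => p.dd_iff.1 hYd
        (v ∘ₗ LinearMap.single A (fun _ : Fin k => (p.P1 : Type)) l)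
      let w' : (Fin k → p.P0) →ₗ[A] Y := ∑ l, w l ∘ₗ LinearMap.proj l
      have hw' : ∀ x, w' (D x) = v x := by
        intro x
        have e1 : x = ∑ l, Pi.single l (x l) := (Finset.univ_sum_single x).symm
        conv_rhs => rw [e1, map_sum]
        simp only [w', LinearMap.sum_apply]
        exact Finset.sum_congr rfl fun l _ => LinearMap.congr_fun (hw l) (x l)
      let h2 : F →ₗ[A] E' := h1 - i ∘ₗ w' ∘ₗ LinearMap.fst A (Fin k → p.P0) G
      have hgi : ∀ y, g (i y) = 0 := fun y => by
        have : i y ∈ LinearMap.ker g := hig ▸ ⟨y, rfl⟩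
        exact this
      have hgh2 : ∀ x, g (h2 x) = h (mk x) := fun x => by
        change g (h1 x - i _) = _
        rw [map_sub, hgi, sub_zero, hh1']
      obtain ⟨h', hh'⟩ := desc E' h2 (fun x => by
        change h1 (δ x) - i (w' (D x)) = 0
        rw [hw', sub_eq_zero]
        exact (LinearMap.congr_fun hv x).symm) (by
        refine tr_le fun j f => ?_
        obtain ⟨t, ht⟩ := exists_lift_of_range_le i hi (h2 ∘ₗ f) (by
          rw [hig]
          rintro _ ⟨x, rfl⟩
          have : mk (f x) = 0 := (hmk0 _).2 (Submodule.mem_sup_right (apply_mem_tr f x))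
          rw [LinearMap.mem_ker, LinearMap.comp_apply, hgh2, this, map_zero])
        rw [hYv j j.2 t, LinearMap.comp_zero] at ht
        rintro _ ⟨x, rfl⟩
        exact (LinearMap.congr_fun ht x).symm)
      refine ⟨h', LinearMap.ext fun z => ?_⟩
      obtain ⟨x, rfl⟩ := hmk z
      rw [LinearMap.comp_apply, show h' (mk x) = h2 x from LinearMap.congr_fun hh' x, hgh2]
    · intro g
      choose w hw using fun l => p.dd_iff.1 hYd (g ∘ₗ u l)
      let w' : (Fin k → p.P0) →ₗ[A] Y := ∑ l, w l ∘ₗ LinearMap.proj l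
      have hw' : ∀ x, w' (D x) = g (U x) := by
        intro x
        rw [hU, map_sum]
        simp only [w', LinearMap.sum_apply]
        exact Finset.sum_congr rfl fun l _ => LinearMap.congr_fun (hw l) (x l)
      obtain ⟨h, hh⟩ := desc Y (w'.coprod g) (fun x => by
        change w' (D x) + g (-U x) = 0
        rw [hw', map_neg, add_neg_cancel]) (tr_eq_bot_of_van hYv _)
      refine ⟨h, LinearMap.ext fun y => ?_⟩
      have := LinearMap.congr_fun hh ((0 : Fin k → p.P0), y)
      change h (mk (0, y)) = w' 0 + g y at this
      rw [map_zero, zero_add] at this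
      exact this
  · intro m
    choose a ha using fun l => p.surj (m l)
    exact ⟨mk (a, 0), funext fun l => (hq' _ l).trans (ha l)⟩
  · intro z hz
    obtain ⟨⟨a, y⟩, rfl⟩ := hmk z
    have h1 : ∀ l, ∃ x, p.d x = a l := by
      intro l
      have h2 : a l ∈ LinearMap.ker p.π := (hq' (a, y) l).symm.trans (congrFun hz l)
      rw [← p.exact] at h2
      exact h2
    choose x hx using h1
    refine ⟨y + U x, ?_⟩
    have hDx : D x = a := funext hx
    rw [map_add, hφ, hDx, add_comm]
    change mk _ + mk _ = _
    rw [← map_add]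
    congr 1
    exact Prod.ext (add_zero a) (zero_add y)
  · intro y hy
    obtain ⟨_, ⟨x, rfl⟩, t, ht, hxt⟩ := Submodule.mem_sup.1 ((hmk0 _).1 hy)
    have h1 : ∀ l, p.d (x l) ∈ tr (rst P J) p.P0 := by
      intro l
      have h2 := map_tr_le (C := rst P J) (Y := F) (LinearMap.proj l ∘ₗ LinearMap.fst A (Fin k → p.P0) G)
        ⟨t, ht, rfl⟩
      have h3 : p.d (x l) + t.1 l = 0 := congrFun (congrArg Prod.fst hxt) l
      rw [eq_neg_of_add_eq_zero_left h3]
      exact neg_mem h2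
    have h4 : tr (rst P J) p.P0 ≤ (tr (rst P J) p.P1).map p.d := by
      refine tr_le fun j f => ?_
      have hproj' : Module.Projective A (rst P J j) := hP.proj j
      obtain ⟨s, hs⟩ := Module.projective_lifting_property p.d.rangeRestrict
        (f.codRestrict (LinearMap.range p.d) fun x => by
          rw [p.exact]
          exact LinearMap.congr_fun (hJ j j.2 (p.π ∘ₗ f)) x) p.d.surjective_rangeRestrict
      rintro _ ⟨x, rfl⟩
      exact ⟨s x, apply_mem_tr s x, congrArg Subtype.val (LinearMap.congr_fun hs x)⟩
    choose x' hx' hdx' using fun l => h4 (h1 l)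
    refine ⟨fun l => x l - x' l, u, fun l => by rw [map_sub, hdx', sub_self], ?_⟩
    have h7 : t.2 ∈ tr (rst P J) G :=
      map_tr_le (C := rst P J) (Y := F) (LinearMap.snd A (Fin k → p.P0) G) ⟨t, ht, rfl⟩
    have h8 : y + ∑ l, u l (x l - x' l) = t.2 - ∑ l, u l (x' l) := by
      have h6 : -U x + t.2 = y := congrArg Prod.snd hxt
      simp_rw [← h6, map_sub, Finset.sum_sub_distrib, ← hU]
      abel
    rw [h8]
    exact sub_mem h7 (sum_mem fun l _ => map_tr_le (C := rst P J) (u l) ⟨_, hx' l, rfl⟩)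

lemma tr_ne_top_of_notMem (hP : IsProjFam P) {J : Set ι} {i : ι} (hi : i ∉ J) :
    tr (rst P J) (P i) ≠ ⊤ := by
  intro h
  have := hP.fin i
  have := hP.proj
  have := (hP.loc i).1
  obtain ⟨H, hH⟩ := IsCoatomic.exists_coatom (Submodule A (P i))
  let S : Mdl A := ModuleCat.of A (P i ⧸ H)
  have hS : IsSimpleModule A S := isSimpleModule_iff_isCoatom.2 hH
  let q : P i →ₗ[A] S := H.mkQ
  have hq0 : q = 0 := by
    refine eq_zero_of_tr_eq_top h q fun j g => ?_
    by_contra hne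
    have hb := (hP.loc j).bijective_of_simple (hP.loc i) g q hne
    exact hi (hP.inj _ _ ⟨LinearEquiv.ofBijective g hb⟩ ▸ j.2)
  apply hH.1
  rw [← H.ker_mkQ, LinearMap.ker_eq_top]
  exact hq0

lemma Tors.exists_not_homZero (hP : IsProjFam P) (K : Type) [Field K] [Algebra K A] [Module.Finite K A]
    [Module.Finite A M] {J : Set ι} (hM : DD M M) (hJ : Van P J M) {i : ι} (hi : i ∉ J) :
    ∃ Y, Tors P J M Y ∧ ¬ HomZero (P i) Y := by
  obtain ⟨p⟩ := hP.nonempty_pres K M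
  have := hP.fin i
  have := hP.proj i
  have := (hP.loc i).1
  obtain ⟨E, φ, k, q, hE, -, -, -, hker⟩ := exists_bongartz hP K (P i) p hM hJ
  refine ⟨E, hE, fun h0 => ?_⟩
  obtain ⟨H, hH, htr⟩ := (eq_top_or_exists_le_coatom (tr (rst P J) (P i))).resolve_left
    (tr_ne_top_of_notMem hP hi)
  let S : Mdl A := ModuleCat.of A (P i ⧸ H)
  have hS : IsSimpleModule A S := isSimpleModule_iff_isCoatom.2 hH
  let q : P i →ₗ[A] S := H.mkQ
  have hq : ∀ u : p.P1 →ₗ[A] P i, ∀ x, p.d x = 0 → q (u x) = 0 := by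
    intro u x hx
    rcases LinearMap.surjective_or_eq_zero (q ∘ₗ u) with h | h
    · have hco : IsCoatom (LinearMap.ker (q ∘ₗ u)) := LinearMap.isCoatom_ker_of_surjective h
      by_contra hne
      have hsup : LinearMap.ker p.d ⊔ LinearMap.ker (q ∘ₗ u) = ⊤ :=
        hco.2 _ (right_lt_sup.2 fun hle => hne (hle (show x ∈ LinearMap.ker p.d from hx)))
      exact hco.1 (p.min _ hsup)
    · exact LinearMap.congr_fun h x
  apply hH.1
  refine top_le_iff.1 fun y _ => ?_
  obtain ⟨x, u, hx, hxu⟩ := hker y (LinearMap.congr_fun (h0 φ) y)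
  have h1 : q (y + ∑ l, u l (x l)) = 0 := (Submodule.Quotient.mk_eq_zero H).2 (htr hxu)
  rw [map_add, map_sum, Finset.sum_eq_zero fun l _ => hq (u l) (x l) (hx l), add_zero] at h1
  exact (Submodule.Quotient.mk_eq_zero H).1 h1

end Bongartz
end TauTilting

namespace TauTilting
open scoped ModuleCat
set_option linter.unusedSectionVars false

section Completion
variable {K A : Type} [Field K] [Ring A] [Algebra K A] [Module.Finite K A] [IsArtinianRing A]
  {ι κ : Type} [Fintype ι] {P : ι → Mdl A} {C : κ → Mdl A} {M N X Y Z E : Mdl A} {J : Set ι}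

lemma DD.pi_iff {l : Type} [Finite l] {C : l → Mdl A} :
    DD (ModuleCat.of A (∀ i, C i)) Y ↔ ∀ i, DD (C i) Y := by
  classical
  refine ⟨fun h i => h.of_retract (LinearMap.single A (fun i => (C i : Type)) i)
    (LinearMap.proj i) ?_, DD.pi_left⟩
  ext x
  simp

lemma Tors.of_surj (hP : IsProjFam P) (h : Tors P J M Y) (g : Y →ₗ[A] Z)
    (hg : Function.Surjective g) : Tors P J M Z := by
  have := h.fin
  exact ⟨Module.Finite.of_surjective g hg, h.dd.of_surj g hg, h.van.of_surj hP g hg⟩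

lemma Tors.pi (hP : IsProjFam P) (K : Type) [Field K] [Algebra K A] [Module.Finite K A]
    [Module.Finite A M] {l : Type} [Finite l] {C : l → Mdl A} (h : ∀ i, Tors P J M (C i)) :
    Tors P J M (ModuleCat.of A (∀ i, C i)) := by
  have := fun i => (h i).fin
  exact ⟨inferInstanceAs (Module.Finite A (∀ i, C i)), hP.dd_pi_right K fun i => (h i).dd,
    Van.pi fun i => (h i).van⟩

lemma Tors.of_gen (hP : IsProjFam P) (K : Type) [Field K] [Algebra K A] [Module.Finite K A]
    [Module.Finite A M] [Finite κ] (h : ∀ i, Tors P J M (C i)) (hY : Gen C Y) :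
    Tors P J M Y := by
  have := fun i => (h i).fin
  exact ⟨hY.1, hP.dd_of_gen K (fun i => (h i).dd) hY, Van.of_gen hP (fun i => (h i).van) hY⟩

lemma exists_completion (hP : IsProjFam P) (K : Type) [Field K] [Algebra K A] [Module.Finite K A]
    [Module.Finite A M] (hM : DD M M) (hJ : Van P J M) :
    ∃ (E : Mdl A) (x : E) (k : ℕ) (q : E →ₗ[A] (Fin k → M)), Tors P J M E ∧
      (∀ Y, Tors P J M Y → DD E Y ∧ ∀ y : Y, ∃ h : E →ₗ[A] Y, h x = y) ∧
      Function.Surjective q ∧ ∀ z, q z = 0 → ∃ a : A, z = a • x := by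
  obtain ⟨p⟩ := hP.nonempty_pres K M
  have h1 : Module.Finite A (ModuleCat.of A A : Mdl A) := inferInstanceAs (Module.Finite A A)
  have h2 : Module.Projective A (ModuleCat.of A A : Mdl A) := inferInstanceAs (Module.Projective A A)
  obtain ⟨E, φ, k, q, hE, hY, hqs, hq, -⟩ := exists_bongartz hP K (ModuleCat.of A A) p hM hJ
  refine ⟨E, φ (1 : A), k, q, hE, fun Y h => ⟨fun Y' g hg => (hY Y' (h.of_surj hP g hg)).1,
    fun y => ?_⟩, hqs, fun z hz => ?_⟩
  · obtain ⟨h', hh⟩ := (hY Y h).2 (LinearMap.toSpanSingleton A Y y)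
    refine ⟨h', ?_⟩
    have := LinearMap.congr_fun hh (1 : A)
    change h' (φ (1 : A)) = (1 : A) • y at this
    rwa [one_smul] at this
  · obtain ⟨a, rfl⟩ := hq hz
    refine ⟨a, ?_⟩
    rw [← map_smul]
    exact congrArg φ (mul_one (a : A)).symm

/-- A maximality property of support τ-tilting families. -/
lemma ST.exists_equiv [Fintype κ] (hC : ST P C) (hP : IsProjFam P) (K : Type) [Field K]
    [Algebra K A] [Module.Finite K A] [Module.Finite A N] (hN : Loc N) (hv : Van P (spp P C)ᶜ N)
    (h1 : ∀ j, DD (C j) N) (h2 : ∀ j, DD N (C j)) (h3 : DD N N) :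
    ∃ j, Nonempty (N ≃ₗ[A] C j) := by
  by_contra! hne
  let D : Option κ → Mdl A := fun o => o.elim N C
  have hD : RF D := by
    refine ⟨?_, ?_, ?_, ?_⟩
    · rintro (_ | k)
      exacts [‹Module.Finite A N›, hC.fin k]
    · rintro (_ | k)
      exacts [hN, hC.loc k]
    · rintro (_ | j) (_ | k) ⟨φ⟩
      · rfl
      · exact ((hne k).false φ).elim
      · exact ((hne j).false φ.symm).elim
      · exact congrArg some (hC.inj j k ⟨φ⟩)
    · rintro (_ | j) (_ | k)
      exacts [h3, h2 k, h1 j, hC.dd j k]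
  have := hD.card_le hP K (J := (spp P C)ᶜ) (by
    rintro (_ | k)
    exacts [hv, van_spp_compl k])
  rw [compl_compl, ← hC.card, Finite.card_option] at this
  omega

lemma ST.gen_of_dd [Fintype κ] (hC : ST P C) (hP : IsProjFam P) (K : Type) [Field K]
    [Algebra K A] [Module.Finite K A] [Module.Finite A Y] (hd : ∀ j, DD (C j) Y)
    (hv : Van P (spp P C)ᶜ Y) : Gen C Y := by
  have hfin := hC.fin
  let M : Mdl A := ModuleCat.of A (∀ k, C k)
  have hMfin : Module.Finite A M := inferInstanceAs (Module.Finite A (∀ k, C k))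
  have hMC : ∀ k, Tors P (spp P C)ᶜ M (C k) := fun k =>
    ⟨hfin k, DD.pi_left fun i => hC.dd i k, van_spp_compl k⟩
  have hMt : Tors P (spp P C)ᶜ M M := Tors.pi hP K hMC
  obtain ⟨E, x, -, -, hE, hEY, -, -⟩ := exists_completion hP K hMt.dd hMt.van
  have := hE.fin
  obtain ⟨l, _, D, hDfin, hDloc, ⟨φ⟩⟩ := exists_decomp K E
  classical
  have hDt : ∀ i, Tors P (spp P C)ᶜ M (D i) := fun i =>
    hE.of_surj hP (LinearMap.proj i ∘ₗ φ.toLinearMap)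
      fun y => ⟨φ.symm (Pi.single i y), by simp⟩
  have hDY : ∀ i Y, Tors P (spp P C)ᶜ M Y → DD (D i) Y := fun i Y hY =>
    (hEY Y hY).1.of_retract (φ.symm.toLinearMap ∘ₗ LinearMap.single A (fun i => (D i : Type)) i)
      (LinearMap.proj i ∘ₗ φ.toLinearMap) (by ext y; simp)
  have hDC : ∀ i, Gen C (D i) := fun i => by
    obtain ⟨j, ⟨ψ⟩⟩ := hC.exists_equiv hP K (hDloc i) (hDt i).van
      (fun j => DD.pi_iff.1 (hDt i).dd j) (fun j => hDY i _ (hMC j)) (hDY i _ (hDt i))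
    exact (hC.gen_self j).of_surj ψ.symm.toLinearMap ψ.symm.surjective
  have hEC : Gen C E :=
    (Gen.pi hDC).of_surj (Y := ModuleCat.of A (∀ i, D i)) φ.symm.toLinearMap φ.symm.surjective
  refine Gen.trans (D := fun _ : Unit => E) (fun _ => hEC) ⟨‹_›, ?_⟩
  refine top_le_iff.1 fun y _ => ?_
  obtain ⟨h, rfl⟩ := (hEY Y ⟨‹_›, DD.pi_left hd, hv⟩).2 y
  exact apply_mem_tr (C := fun _ : Unit => E) (j := ()) h x

lemma ST.dd_of_gen [Fintype κ] (hC : ST P C) (hP : IsProjFam P) (K : Type) [Field K]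
    [Algebra K A] [Module.Finite K A] (h : Gen C Y) :
    (∀ j, DD (C j) Y) ∧ Van P (spp P C)ᶜ Y :=
  ⟨fun j => hC.dd_gen hP K j h, Van.of_gen hP (fun k => van_spp_compl k) h⟩

end Completion
end TauTilting

namespace TauTilting
open scoped ModuleCat
set_option linter.unusedSectionVars false

section Ad
variable {A : Type} [Ring A] {κ κ' : Type} {C : κ → Mdl A} {D : κ' → Mdl A} {X Y Z : Mdl A}

/-- `Y` is a direct summand of a finite direct sum of members of the family `C`. -/
def Ad {κ : Type} (C : κ → Mdl A) (Y : Mdl A) : Prop :=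
  ∃ (l : Type) (_ : Fintype l) (k : l → κ) (a : Y →ₗ[A] ∀ i, C (k i)) (b : (∀ i, C (k i)) →ₗ[A] Y),
    b ∘ₗ a = LinearMap.id

lemma Ad.self (k : κ) : Ad C (C k) :=
  ⟨Unit, inferInstance, fun _ => k, LinearMap.pi fun _ => LinearMap.id, LinearMap.proj (), rfl⟩

lemma Ad.of_retract (h : Ad C Y) (s : Z →ₗ[A] Y) (r : Y →ₗ[A] Z) (hrs : r ∘ₗ s = LinearMap.id) :
    Ad C Z := by
  obtain ⟨l, _, k, a, b, hab⟩ := h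
  refine ⟨l, ‹_›, k, a ∘ₗ s, r ∘ₗ b, ?_⟩
  rw [LinearMap.comp_assoc, ← LinearMap.comp_assoc s a b, hab, LinearMap.id_comp, hrs]

lemma Ad.of_equiv (h : Ad C Y) (φ : Y ≃ₗ[A] Z) : Ad C Z :=
  h.of_retract φ.symm.toLinearMap φ.toLinearMap (by ext; simp)

lemma Ad.pi {m : Type} [Fintype m] {Y : m → Mdl A} (h : ∀ i, Ad C (Y i)) :
    Ad C (ModuleCat.of A (∀ i, Y i)) := by
  choose l hl k a b hab using h
  refine ⟨Σ i, l i, inferInstance, fun x => k x.1 x.2,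
    LinearMap.pi fun x => LinearMap.proj x.2 ∘ₗ a x.1 ∘ₗ LinearMap.proj x.1,
    LinearMap.pi fun i => b i ∘ₗ LinearMap.pi fun x => LinearMap.proj (⟨i, x⟩ : Σ i, l i), ?_⟩
  refine LinearMap.ext fun y => funext fun i => ?_
  exact LinearMap.congr_fun (hab i) (y i)

lemma Ad.trans (hC : ∀ k, Ad D (C k)) (h : Ad C Y) : Ad D Y := by
  obtain ⟨l, _, k, a, b, hab⟩ := h
  exact (Ad.pi fun i => hC (k i)).of_retract (Y := ModuleCat.of A (∀ i, C (k i))) a b hab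

lemma Ad.of_sum (hX : Ad C X) (hY : Ad C Y) (s : Z →ₗ[A] X) (s' : Z →ₗ[A] Y) (r : X →ₗ[A] Z)
    (r' : Y →ₗ[A] Z) (h : ∀ z, r (s z) + r' (s' z) = z) : Ad C Z := by
  let W : Option Unit → Mdl A := fun o => o.elim X fun _ => Y
  have hW : Ad C (ModuleCat.of A (∀ o, W o)) := Ad.pi (by
    rintro (_ | _)
    exacts [hX, hY])
  let a : ∀ o, Z →ₗ[A] W o
    | none => s
    | some _ => s'
  let b : (∀ o, W o) →ₗ[A] Z :=
    r ∘ₗ LinearMap.proj (φ := fun o => (W o : Type)) none +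
      r' ∘ₗ LinearMap.proj (φ := fun o => (W o : Type)) (some ())
  exact hW.of_retract (Y := ModuleCat.of A (∀ o, W o)) (LinearMap.pi a) b (LinearMap.ext fun z => h z)

lemma Ad.exists_equiv (hC : ∀ k, Loc (C k)) (hX : Loc X) (h : Ad C X) :
    ∃ k, Nonempty (X ≃ₗ[A] C k) := by
  classical
  obtain ⟨l, _, k, a, b, hab⟩ := h
  obtain ⟨i, hi⟩ := Loc.exists_equiv_of_retract (fun i => hC (k i)) hX a b hab
  exact ⟨k i, ⟨(LinearEquiv.ofBijective _ hi).symm⟩⟩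

lemma inAdd_iff : InAdd X Y ↔ Ad (fun _ : Unit => Y) X := by
  constructor
  · rintro ⟨n, a, b, hab⟩
    exact ⟨Fin n, inferInstance, fun _ => (), a, b, hab⟩
  · rintro ⟨l, _, k, a, b, hab⟩
    let φ := LinearEquiv.funCongrLeft A Y (Fintype.equivFin l)
    refine ⟨Fintype.card l, φ.symm.toLinearMap ∘ₗ a, b ∘ₗ φ.toLinearMap, LinearMap.ext fun x => ?_⟩
    have := LinearMap.congr_fun hab x
    change b (φ (φ.symm (a x))) = x
    rw [φ.apply_symm_apply]
    exact this

end Ad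

section Covers
variable {K A : Type} [Field K] [Ring A] [Algebra K A] [Module.Finite K A] [IsArtinianRing A]
  {ι κ κ' : Type} [Fintype ι] {P : ι → Mdl A} {C : κ → Mdl A} {C' : κ' → Mdl A}
  {M N X Y Z E Q : Mdl A} {J : Set ι}

lemma RF.homZero_quot_tr (hC : RF C) (hP : IsProjFam P) (K : Type) [Field K] [Algebra K A]
    [Module.Finite K A] [Finite κ] [Module.Finite A Y] (k : κ) :
    HomZero (C k) (ModuleCat.of A (Y ⧸ tr C Y)) := by
  intro g
  have h1 : Gen C (ModuleCat.of A (tr C Y)) := gen_tr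
  obtain ⟨h, hh⟩ := (hC.dd_gen hP K k h1).lift Y (ModuleCat.of A (Y ⧸ tr C Y)) (tr C Y).subtype
    (tr C Y).mkQ Subtype.val_injective (Submodule.mkQ_surjective _)
    ((Submodule.range_subtype _).trans (Submodule.ker_mkQ _).symm) g
  rw [← hh]
  exact LinearMap.ext fun x => (Submodule.Quotient.mk_eq_zero _).2 (apply_mem_tr h x)

lemma HomZero.of_gen (h : ∀ k, HomZero (C k) Q) (hY : Gen C Y) : HomZero Y Q := fun g =>
  eq_zero_of_tr_eq_top hY.2 g fun j f => h j (g ∘ₗ f)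

/-- A minimal right approximation by the family `C`, with generated kernel. -/
lemma ST.exists_approx [Fintype κ] (hC : ST P C) (hP : IsProjFam P) (K : Type) [Field K]
    [Algebra K A] [Module.Finite K A] (hY : Gen C Y) :
    ∃ (n : ℕ) (j : Fin n → κ) (f : (∀ l, C (j l)) →ₗ[A] Y), Function.Surjective f ∧
      (∀ k (g : C k →ₗ[A] Y), ∃ h, f ∘ₗ h = g) ∧
      (∀ k l (g : C k →ₗ[A] ∀ l, C (j l)), f ∘ₗ g = 0 →
        ¬ Function.Bijective (LinearMap.proj l ∘ₗ g)) ∧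
      Gen C (ModuleCat.of A (LinearMap.ker f)) := by
  have := hY.1
  have := hC.fin
  obtain ⟨n, j, f, hf, hmin⟩ := exists_minApprox K C Y
  have hfin : Module.Finite A (ModuleCat.of A (∀ l, C (j l)) : Mdl A) :=
    inferInstanceAs (Module.Finite A (∀ l, C (j l)))
  have hG : Gen C (ModuleCat.of A (∀ l, C (j l))) := Gen.pi fun l => hC.gen_self (j l)
  have hker : Module.Finite A (ModuleCat.of A (LinearMap.ker f) : Mdl A) :=
    inferInstanceAs (Module.Finite A (LinearMap.ker f))
  refine ⟨n, j, f, surj_of_factors (X := ModuleCat.of A (∀ l, C (j l))) hY.2 f hf, hf, hmin,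
    hC.gen_of_dd hP K (fun k => ?_) ?_⟩
  · exact hP.dd_ker K (X := ModuleCat.of A (∀ l, C (j l))) f (hC.dd_gen hP K k hG) (hf k)
  · exact (ST.dd_of_gen hC hP K hG).2.of_inj (Y := ModuleCat.of A (LinearMap.ker f))
      (LinearMap.ker f).subtype Subtype.val_injective

lemma ST.exists_split [Fintype κ] (hC : ST P C) (hP : IsProjFam P) (K : Type) [Field K]
    [Algebra K A] [Module.Finite K A] [Nontrivial Q] (hQ : Gen C Q) :
    ∃ j, ¬ Gen (rst C {j}ᶜ) (C j) ∧ ∀ Y, Gen C Y → HomZero Y Q → Gen (rst C {j}ᶜ) Y := by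
  have := hQ.1
  have := hC.fin
  obtain ⟨k, f, hf⟩ := exists_ne_zero_of_gen hQ.2
  obtain ⟨j, p, hp, hp'⟩ := exists_minimal_map K C hC.loc Q k f hf
  refine ⟨j, fun h => hp (eq_zero_of_tr_eq_top h.2 p fun i g => hp' i g fun hb =>
    i.2 (hC.inj _ _ ⟨LinearEquiv.ofBijective g hb⟩)), fun Y hY h0 => ?_⟩
  obtain ⟨n, r, f, hfs, hf, hmin, hker⟩ := hC.exists_approx hP K hY
  have hr : ∀ l, r l ≠ j := by
    rintro l rfl
    have h1 : p ∘ₗ LinearMap.proj l ∘ₗ (LinearMap.ker f).subtype = 0 :=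
      eq_zero_of_tr_eq_top (Y := ModuleCat.of A (LinearMap.ker f)) hker.2 _ fun i g =>
        hp' i (LinearMap.proj l ∘ₗ (LinearMap.ker f).subtype ∘ₗ g)
          (hmin i l ((LinearMap.ker f).subtype ∘ₗ g) (LinearMap.ext fun x => (g x).2))
    obtain ⟨v, hv⟩ := exists_desc_of_ker_le (X := ModuleCat.of A (∀ l, C (r l))) f hfs
      (p ∘ₗ LinearMap.proj l) fun x hx => LinearMap.congr_fun h1 ⟨x, hx⟩
    rw [h0 v, LinearMap.zero_comp] at hv
    refine hp (LinearMap.ext fun x => ?_)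
    have := LinearMap.congr_fun hv (LinearMap.single A (fun l => (C (r l) : Type)) l x)
    simpa using this.symm
  exact (Gen.pi fun l => Gen.self (C := rst C {j}ᶜ) ⟨r l, hr l⟩).of_surj
    (Y := ModuleCat.of A (∀ l, C (r l))) f hfs

lemma ST.exists_split_of_lt [Fintype κ] [Finite κ'] (hC : ST P C) (hP : IsProjFam P) (K : Type)
    [Field K] [Algebra K A] [Module.Finite K A] (hC' : RF C') (hle : ∀ Y, Gen C' Y → Gen C Y)
    (hlt : ¬ ∀ Y, Gen C Y → Gen C' Y) :
    ∃ j, ¬ Gen (rst C {j}ᶜ) (C j) ∧ ∀ Y, Gen C' Y → Gen (rst C {j}ᶜ) Y := by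
  push Not at hlt
  obtain ⟨Y, hY, hY'⟩ := hlt
  have := hY.1
  let Q : Mdl A := ModuleCat.of A (Y ⧸ tr C' Y)
  have hQ : Gen C Q := hY.of_surj (tr C' Y).mkQ (Submodule.mkQ_surjective _)
  have hnt : Nontrivial Q := Submodule.Quotient.nontrivial_iff.2 fun h => hY' ⟨this, h⟩
  obtain ⟨j, hj, h⟩ := hC.exists_split hP K hQ
  exact ⟨j, hj, fun Z hZ => h Z (hle Z hZ)
    (HomZero.of_gen (fun k => hC'.homZero_quot_tr hP K k) hZ)⟩

lemma ST.gen_of_cover [Fintype κ] [Finite κ'] (hC : ST P C) (hP : IsProjFam P) (K : Type)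
    [Field K] [Algebra K A] [Module.Finite K A] (hC' : RF C') (hle : ∀ Y, Gen C' Y → Gen C Y)
    (hlt : ¬ ∀ Y, Gen C Y → Gen C' Y) {j : κ} (hj : ∀ Y, Gen (rst C {j}ᶜ) Y → Gen C' Y)
    (hY : Gen C' Y) : Gen (rst C {j}ᶜ) Y := by
  obtain ⟨i, hi, h⟩ := hC.exists_split_of_lt hP K hC' hle hlt
  by_cases hij : i = j
  · exact hij ▸ h Y hY
  · have := hC.fin
    exact (hi (h _ (hj _ (Gen.self (C := rst C {j}ᶜ) ⟨i, hij⟩)))).elim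

lemma ST.gen_rst [Fintype κ] (hC : ST P C) (hP : IsProjFam P) (K : Type)
    [Field K] [Algebra K A] [Module.Finite K A] {s : Set κ}
    (hs : ∀ j, j ∉ s → ¬ Gen (rst C {j}ᶜ) (C j)) (hY : Gen C Y)
    (h : ∀ j, j ∉ s → Gen (rst C {j}ᶜ) Y) : Gen (rst C s) Y := by
  classical
  have := hY.1
  have hfin := hC.fin
  let Q : Mdl A := ModuleCat.of A (Y ⧸ tr (rst C s) Y)
  let mk : Y →ₗ[A] Q := (tr (rst C s) Y).mkQ
  have hmk : Function.Surjective mk := Submodule.mkQ_surjective _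
  have h0 : ∀ k : s, HomZero (C k) Q := fun k => (hC.restrict s).homZero_quot_tr hP K k
  obtain ⟨n, r, f, hfs, hf, hmin, hker⟩ := hC.exists_approx hP K (hY.of_surj mk hmk)
  rcases Nat.eq_zero_or_pos n with rfl | hn
  · refine ⟨this, ?_⟩
    refine top_le_iff.1 fun y _ => ?_
    obtain ⟨x, hx⟩ := hfs (mk y)
    rw [Subsingleton.elim x 0, map_zero] at hx
    exact (Submodule.Quotient.mk_eq_zero _).1 hx.symm
  · let l : Fin n := ⟨0, hn⟩
    have hl : r l ∉ s := by
      intro hl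
      refine hmin (r l) l (LinearMap.single A (fun l => (C (r l) : Type)) l) (h0 ⟨r l, hl⟩ _) ?_
      rw [LinearMap.proj_comp_single_same]
      exact Function.bijective_id
    refine (hC.rad_ne_top hP K (r l) (hs _ hl) ?_).elim
    refine top_le_iff.1 fun x _ => ?_
    have hQ : tr (rst C {r l}ᶜ) Q ≤
        (tr (rst C {r l}ᶜ) (ModuleCat.of A (∀ l, C (r l)))).map f := by
      refine tr_le fun k g => ?_
      obtain ⟨g', rfl⟩ := hf k g
      rintro _ ⟨x, rfl⟩
      exact ⟨g' x, apply_mem_tr (C := rst C {r l}ᶜ) (Y := ModuleCat.of A (∀ l, C (r l))) g' x, rfl⟩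
    have hQ' := ((h _ hl).of_surj mk hmk).2
    obtain ⟨y, hy, hyx⟩ := hQ (hQ' ▸ Submodule.mem_top :
      f (LinearMap.single A (fun l => (C (r l) : Type)) l x) ∈ _)
    have h1 : LinearMap.single A (fun l => (C (r l) : Type)) l x - y ∈ LinearMap.ker f := by
      rw [LinearMap.mem_ker, map_sub, hyx, sub_self]
    have h2 : tr (rst C {r l}ᶜ) (ModuleCat.of A (∀ l, C (r l))) ≤
        (rad C (r l)).comap (LinearMap.proj l) := by
      refine tr_le fun k g => ?_
      rintro _ ⟨x, rfl⟩
      let g' : C k →ₗ[A] C (r l) := LinearMap.proj (φ := fun l => (C (r l) : Type)) l ∘ₗ g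
      exact apply_mem_rad g' (fun hb => k.2 (hC.inj _ _ ⟨LinearEquiv.ofBijective g' hb⟩)) x
    have h3 : ∀ z : LinearMap.ker f, LinearMap.proj (φ := fun l => (C (r l) : Type)) (R := A) l z.1 ∈
        rad C (r l) := by
      intro z
      have : tr C (ModuleCat.of A (LinearMap.ker f)) ≤
          (rad C (r l)).comap (LinearMap.proj l ∘ₗ (LinearMap.ker f).subtype) := by
        refine tr_le fun k g => ?_
        rintro _ ⟨x, rfl⟩
        exact apply_mem_rad (LinearMap.proj l ∘ₗ (LinearMap.ker f).subtype ∘ₗ g)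
          (hmin k l ((LinearMap.ker f).subtype ∘ₗ g) (LinearMap.ext fun x => (g x).2)) x
      rw [hker.2] at this
      exact this (Submodule.mem_top (x := z))
    have h4 := add_mem (h3 ⟨_, h1⟩) (h2 hy)
    rw [← map_add, sub_add_cancel] at h4
    simpa using h4

end Covers
end TauTilting

namespace TauTilting
open scoped ModuleCat
set_option linter.unusedSectionVars false

section Dimension
variable {K A : Type} [Field K] [Ring A] [Algebra K A] [Module.Finite K A] [IsArtinianRing A]
  {ι κ κ' : Type} [Fintype ι] {P : ι → Mdl A} {C : κ → Mdl A}
  {M N X Y Z E Q : Mdl A} {J : Set ι}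

/-- A vector orthogonal to linearly independent vectors which are as many as the coordinates. -/
lemma eq_zero_of_orthogonal {I : Type} [Fintype I] [Fintype κ] (v : κ → I → ℚ)
    (hv : LinearIndependent ℚ v) (hc : Fintype.card κ = Fintype.card I) (w : I → ℚ)
    (hw : ∀ k, ∑ i, v k i * w i = 0) : w = 0 := by
  classical
  have hspan := hv.span_eq_top_of_card_eq_finrank' (by rw [hc, Module.finrank_fintype_fun_eq_card])
  let φ : (I → ℚ) →ₗ[ℚ] ℚ := ∑ i, w i • LinearMap.proj i
  have hφ : ∀ x, φ x = ∑ i, x i * w i := fun x => by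
    simp only [φ, LinearMap.sum_apply, LinearMap.smul_apply, LinearMap.proj_apply, smul_eq_mul]
    exact Finset.sum_congr rfl fun i _ => mul_comm _ _
  have h0 : φ = 0 := LinearMap.ext_on_range hspan fun k => by
    rw [hφ, hw, LinearMap.zero_apply]
  funext i
  have := LinearMap.congr_fun h0 (Pi.single i 1)
  rw [hφ, Finset.sum_eq_single i] at this
  · simpa using this
  · intro j _ hj
    simp [Pi.single_eq_of_ne hj]
  · simp

lemma ST.homZero_of_orthogonal [Fintype κ] (hC : ST P C) (hP : IsProjFam P) (K : Type) [Field K]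
    [Algebra K A] [Module.Finite K A] {s : Set κ}
    (hs : ∀ j, j ∉ s → ¬ Gen (rst C {j}ᶜ) (C j)) [Module.Finite A Q]
    (hd' : ∀ j ∈ s, DD (C j) Q) (hv : Van P (spp P C)ᶜ Q) (h0 : ∀ k, HomZero (C k) Q) (i : ι) :
    HomZero (P i) Q := by
  classical
  have hPfin := hP.fin
  have hCfin := hC.fin
  have hBfin := hC.finite_rtop
  have p : ∀ k, Pres K P (C k) := fun k => (hP.nonempty_pres K (C k)).some
  have hBgen : ∀ j, Gen C (rtop C j) := fun j =>
    (hC.gen_self j).of_surj (rad C j).mkQ (Submodule.mkQ_surjective _)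
  let q : ι → ℚ := fun i => hd K (P i) Q
  let b : κ → ι → ℚ := fun j i => hd K (P i) (rtop C j)
  let c : κ → ι → ℚ := fun k i => (p k).c i
  let S : κ → ℚ := fun k => ∑ i, c k i * q i
  have hS : ∀ k, S k ≤ 0 := by
    intro k
    have := (p k).sum_le Q
    rw [hd_eq_zero.2 (h0 k)] at this
    change ∑ i, (((p k).c i : ℤ) : ℚ) * ((hd K (P i) Q : ℕ) : ℚ) ≤ 0
    exact_mod_cast this
  have hS0 : ∀ k ∈ s, S k = 0 := by
    intro k hk
    have := (p k).sum_eq Q (hd' k hk)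
    rw [hd_eq_zero.2 (h0 k)] at this
    change ∑ i, (((p k).c i : ℤ) : ℚ) * ((hd K (P i) Q : ℕ) : ℚ) = 0
    exact_mod_cast this
  have hcb : ∀ k j, ∑ i, c k i * b j i = hd K (C k) (rtop C j) := by
    intro k j
    have := (p k).sum_eq (rtop C j) (hC.dd_gen hP K k (hBgen j))
    change ∑ i, (((p k).c i : ℤ) : ℚ) * ((hd K (P i) (rtop C j) : ℕ) : ℚ) = _
    exact_mod_cast this
  let β : κ → ℚ := fun j => hd K (C j) (rtop C j)
  have hβ : ∀ j, j ∉ s → 0 < β j := by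
    intro j hj
    have h1 : hd K (C j) (rtop C j) ≠ 0 := fun h =>
      not_homZero_rtop (hC.rad_ne_top hP K j (hs j hj)) (hd_eq_zero.1 h)
    exact Nat.cast_pos.2 (Nat.pos_of_ne_zero h1)
  let t : κ → ℚ := fun j => if j ∈ s then 0 else - S j / β j
  have ht : ∀ j, 0 ≤ t j := by
    intro j
    by_cases hj : j ∈ s
    · simp [t, hj]
    · simp only [t, hj, if_false]
      exact div_nonneg (neg_nonneg.2 (hS j)) (hβ j hj).le
  let w : ι → ℚ := fun i => q i + ∑ j, t j * b j i
  have hbn : ∀ j i, 0 ≤ t j * b j i := fun j i => mul_nonneg (ht j) (Nat.cast_nonneg _)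
  have hcw : ∀ k, ∑ i, c k i * w i = 0 := by
    intro k
    have h1 : ∑ i, c k i * w i = S k + ∑ j, t j * ∑ i, c k i * b j i := by
      simp only [w, mul_add, Finset.sum_add_distrib, Finset.mul_sum, S]
      rw [Finset.sum_comm]
      congr 1
      refine Finset.sum_congr rfl fun j _ => Finset.sum_congr rfl fun i _ => by ring
    rw [h1, Finset.sum_eq_single k]
    · rw [hcb]
      by_cases hk : k ∈ s
      · simp [t, hk, hS0 k hk]
      · have : β k ≠ 0 := (hβ k hk).ne'
        simp only [t, hk, if_false]
        change S k + -S k / β k * β k = 0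
        rw [div_mul_cancel₀ _ this, add_neg_cancel]
    · intro j _ hj
      rw [hcb, hd_eq_zero.2 (hC.homZero_rtop hP K hj.symm), Nat.cast_zero, mul_zero]
    · simp
  have hwJ : ∀ i ∈ (spp P C)ᶜ, w i = 0 := by
    intro i hi
    have h1 : q i = 0 := by
      change ((hd K (P i) Q : ℕ) : ℚ) = 0
      rw [hd_eq_zero.2 (hv i hi), Nat.cast_zero]
    have h2 : ∀ j, b j i = 0 := fun j => by
      change ((hd K (P i) (rtop C j) : ℕ) : ℚ) = 0
      rw [hd_eq_zero.2 ((ST.dd_of_gen hC hP K (hBgen j)).2 i hi), Nat.cast_zero]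
    simp [w, h1, h2]
  have hli := hC.linearIndependent hP (J := (spp P C)ᶜ) (fun k => van_spp_compl k) p
  have hcard : Fintype.card κ = Fintype.card {i // i ∉ (spp P C)ᶜ} := by
    rw [← Nat.card_eq_fintype_card, hC.card, ← Nat.card_eq_fintype_card]
    simp only [Set.mem_compl_iff, not_not]
    rfl
  have hw0 : ∀ i, w i = 0 := by
    intro i
    by_cases hi : i ∈ (spp P C)ᶜ
    · exact hwJ i hi
    · refine congrFun (eq_zero_of_orthogonal _ hli hcard (fun i => w i) fun k => ?_) ⟨i, hi⟩
      rw [← hcw k, ← Finset.sum_subtype (Finset.univ.filter (· ∉ (spp P C)ᶜ)) (by simp)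
        (fun i => c k i * w i)]
      refine Finset.sum_filter_of_ne fun i _ hne hi => hne ?_
      rw [hwJ i hi, mul_zero]
  have h1 : q i ≤ 0 := by
    have := hw0 i
    have h2 : 0 ≤ ∑ j, t j * b j i := Finset.sum_nonneg fun j _ => hbn j i
    change q i + ∑ j, t j * b j i = 0 at this
    linarith
  refine (hd_eq_zero (K := K)).1 ?_
  change ((hd K (P i) Q : ℕ) : ℚ) ≤ 0 at h1
  exact Nat.le_zero.1 (Nat.cast_le.1 (h1.trans_eq Nat.cast_zero.symm))

lemma ST.gen_of_dd_subset [Fintype κ] (hC : ST P C) (hP : IsProjFam P) (K : Type) [Field K]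
    [Algebra K A] [Module.Finite K A] {s : Set κ}
    (hs : ∀ j, j ∉ s → ¬ Gen (rst C {j}ᶜ) (C j)) [hQ : Module.Finite A Q]
    (hd' : ∀ j ∈ s, DD (C j) Q) (hv : Van P (spp P C)ᶜ Q) : Gen C Q := by
  refine ⟨hQ, ?_⟩
  let R : Mdl A := ModuleCat.of A (Q ⧸ tr C Q)
  let mk : Q →ₗ[A] R := (tr C Q).mkQ
  have hmk : Function.Surjective mk := Submodule.mkQ_surjective _
  have hR : Module.Finite A R := Module.Finite.of_surjective mk hmk
  have h := hC.homZero_of_orthogonal hP K hs (Q := R) (fun j hj => (hd' j hj).of_surj mk hmk)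
    (hv.of_surj hP mk hmk) (fun k => hC.homZero_quot_tr hP K k)
  have hmk0 : mk = 0 := eq_zero_of_tr_eq_top (hP.tr_eq Q) mk fun i f => h i (mk ∘ₗ f)
  exact (Submodule.ker_mkQ _).symm.trans (LinearMap.ker_eq_top.2 hmk0)

end Dimension
end TauTilting

namespace TauTilting
open scoped ModuleCat
set_option linter.unusedSectionVars false

section Intervals
variable {K A : Type} [Field K] [Ring A] [Algebra K A] [Module.Finite K A] [IsArtinianRing A]
  {ι κ κ' m : Type} [Fintype ι] {P : ι → Mdl A} {C : κ → Mdl A} {D : m → Mdl A}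
  {M N X Y Z E Q : Mdl A} {J : Set ι}

lemma Ad.gen (hC : ∀ k, Module.Finite A (C k)) (h : Ad C Y) : Gen C Y := by
  obtain ⟨l, _, k, a, b, hab⟩ := h
  exact (Gen.pi fun i => Gen.self (C := C) (k i)).of_surj (Y := ModuleCat.of A (∀ i, C (k i))) b
    fun y => ⟨a y, LinearMap.congr_fun hab y⟩

/-- The summands of a τ-rigid module inside its Bongartz completion `C`; the other summands of the
completion are split projective. -/
lemma ST.exists_subset [Fintype κ] (hC : ST P C) (hP : IsProjFam P) (K : Type) [Field K]
    [Algebra K A] [Module.Finite K A] [Module.Finite A M] (hM : DD M M) (hJ : Van P J M)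
    (hCM : ∀ Y, Gen C Y ↔ Tors P J M Y) [Fintype m] (hD : ∀ i, Loc (D i)) (φ : M ≃ₗ[A] ∀ i, D i) :
    ∃ s : Set κ, (∀ j, j ∉ s → ¬ Gen (rst C {j}ᶜ) (C j)) ∧
      (∀ j ∈ s, ∃ i, Nonempty (D i ≃ₗ[A] C j)) ∧ ∀ i, ∃ j ∈ s, Nonempty (D i ≃ₗ[A] C j) := by
  classical
  have hCfin := hC.fin
  have hMt : Tors P J M M := ⟨‹_›, hM, hJ⟩
  have hDt : ∀ i, Tors P J M (D i) := fun i =>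
    hMt.of_surj hP (LinearMap.proj i ∘ₗ φ.toLinearMap) fun y => ⟨φ.symm (Pi.single i y), by simp⟩
  have hDfin := fun i => (hDt i).fin
  have hMD : ∀ {Y}, DD M Y → ∀ i, DD (D i) Y := fun h =>
    DD.pi_iff.1 (h.of_equiv (N := ModuleCat.of A (∀ i, D i)) φ)
  have hσ : ∀ i, ∃ j, Nonempty (D i ≃ₗ[A] C j) := fun i => by
    have h1 := ST.dd_of_gen hC hP K ((hCM _).2 (hDt i))
    exact hC.exists_equiv hP K (hD i) h1.2 h1.1
      (fun j => hMD ((hCM _).1 (hC.gen_self j)).dd i) (hMD (hDt i).dd i)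
  refine ⟨{j | ∃ i, Nonempty (D i ≃ₗ[A] C j)}, fun j hj hgen => ?_, fun j hj => hj, fun i => ?_⟩
  swap
  · obtain ⟨j, hj⟩ := hσ i
    exact ⟨j, ⟨i, hj⟩, hj⟩
  have hall : ∀ k, Gen (rst C {j}ᶜ) (C k) := by
    intro k
    by_cases hk : k = j
    · exact hk ▸ hgen
    · exact Gen.self (C := rst C {j}ᶜ) ⟨k, hk⟩
  have hMad : Ad (rst C {j}ᶜ) M := by
    refine (Ad.pi (C := rst C {j}ᶜ) (Y := D) fun i => ?_).of_equiv φ.symm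
    obtain ⟨k, ⟨ψ⟩⟩ := hσ i
    exact (Ad.self (C := rst C {j}ᶜ) ⟨k, fun h => hj ⟨i, h ▸ ⟨ψ⟩⟩⟩).of_equiv ψ.symm
  obtain ⟨E, x, k, q, hE, hEY, hqs, hq⟩ := exists_completion hP K hM hJ
  have hEfin := hE.fin
  have hEad : Ad (rst C {j}ᶜ) E := by
    obtain ⟨n, r, F, hF⟩ := exists_surj_of_gen K (Gen.trans hall ((hCM E).2 hE))
    obtain ⟨y, hy⟩ := hF x
    let R : Mdl A := ModuleCat.of A (∀ l, rst C {j}ᶜ (r l))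
    have hR : Tors P J M R := Tors.pi hP K fun l => (hCM _).1 (hC.gen_self _)
    obtain ⟨h, hh⟩ := (hEY R hR).2 y
    obtain ⟨v, hv⟩ := exists_desc_of_ker_le (Y := ModuleCat.of A (Fin k → M)) q hqs
      (F ∘ₗ h - LinearMap.id) (by
        intro z hz
        obtain ⟨a, rfl⟩ := hq z hz
        rw [LinearMap.mem_ker, map_smul, LinearMap.sub_apply, LinearMap.comp_apply, hh, hy,
          LinearMap.id_apply, sub_self, smul_zero])
    refine Ad.of_sum (X := R) (Y := ModuleCat.of A (Fin k → M)) (Ad.pi fun l => Ad.self _)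
      (Ad.pi fun _ => hMad) h q F (-v) fun z => ?_
    have := LinearMap.congr_fun hv z
    change v (q z) = F (h z) - z at this
    change F (h z) + -v (q z) = z
    rw [this]
    abel
  let W : Option Unit → Mdl A := fun o => o.elim E fun _ => M
  have hWad : ∀ o, Ad (rst C {j}ᶜ) (W o) := by
    rintro (_ | _)
    exacts [hEad, hMad]
  have hWt : ∀ o, Tors P J M (W o) := by
    rintro (_ | _)
    exacts [hE, hMt]
  have hWfin := fun o => (hWt o).fin
  have hCj : Tors P J M (C j) := (hCM _).1 (hC.gen_self j)
  obtain ⟨n, r, f, hf, -⟩ := exists_minApprox K W (C j)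
  let R : Mdl A := ModuleCat.of A (∀ l, W (r l))
  have hR : Tors P J M R := Tors.pi hP K fun l => hWt _
  have hfs : Function.Surjective f := by
    intro y
    obtain ⟨h, rfl⟩ := (hEY _ hCj).2 y
    obtain ⟨h', rfl⟩ := hf none h
    exact ⟨h' x, rfl⟩
  have hRfin := hR.fin
  have hker : Tors P J M (ModuleCat.of A (LinearMap.ker f)) :=
    ⟨inferInstanceAs (Module.Finite A (LinearMap.ker f)),
      hP.dd_ker K (X := R) f hR.dd (hf (some ())),
      hR.van.of_inj (Y := ModuleCat.of A (LinearMap.ker f)) (LinearMap.ker f).subtype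
        Subtype.val_injective⟩
  obtain ⟨g, hg⟩ := (hC.dd_gen hP K j ((hCM _).2 hker)).lift R (C j) (LinearMap.ker f).subtype f
    Subtype.val_injective hfs (Submodule.range_subtype _) LinearMap.id
  have had : Ad (rst C {j}ᶜ) (C j) :=
    Ad.trans hWad ((Ad.pi fun l => Ad.self (C := W) (r l)).of_retract (Y := R) g f hg)
  obtain ⟨i, hi⟩ := had.exists_equiv (fun i => hC.loc _) (hC.loc j)
  exact i.2 (hC.inj _ _ hi).symm

lemma nonempty_pi_equiv (hD : ∀ i j, Nonempty (D i ≃ₗ[A] D j) → i = j)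
    (hC : ∀ i j, Nonempty (C i ≃ₗ[A] C j) → i = j) (h1 : ∀ i, ∃ j, Nonempty (D i ≃ₗ[A] C j))
    (h2 : ∀ j, ∃ i, Nonempty (D i ≃ₗ[A] C j)) :
    ∃ σ : m ≃ κ, (∀ i, Nonempty (D i ≃ₗ[A] C (σ i))) ∧
      Nonempty ((∀ i, D i) ≃ₗ[A] ∀ j, C j) := by
  choose σ hσ using h1
  have hinj : Function.Injective σ := by
    intro i j hij
    obtain ⟨a⟩ := hσ i
    obtain ⟨b⟩ := hσ j
    rw [← hij] at b
    exact hD i j ⟨a.trans b.symm⟩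
  have hsurj : Function.Surjective σ := by
    intro j
    obtain ⟨i, ⟨a⟩⟩ := h2 j
    obtain ⟨b⟩ := hσ i
    exact ⟨i, hC _ _ ⟨b.symm.trans a⟩⟩
  let τ := Equiv.ofBijective σ ⟨hinj, hsurj⟩
  refine ⟨τ, hσ, ⟨?_⟩⟩
  exact (LinearEquiv.piCongrRight fun i => (hσ i).some).trans
    (LinearEquiv.piCongrLeft A (fun j => (C j : Type)) τ)

end Intervals
end TauTilting

namespace TauTilting
open scoped ModuleCat
set_option linter.unusedSectionVars false

section Order
variable {A B : Type} [Ring A] [Ring B]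

lemma FacLE.trans {X Y Z : Mdl A} (h : FacLE X Y) (h' : FacLE Y Z) : FacLE X Z :=
  fun W hW => h' W (h W hW)

/-- `[U, V]` is an interval whose lower end is the meet of `V` with some of its direct
successors. -/
def IsMeetInterval (Q : Mdl A → Prop) (U V : Mdl A) : Prop :=
  ∃ S : Mdl A → Prop, (∀ s, S s → HArrow Q V s) ∧ FacLE U V ∧ (∀ s, S s → FacLE U s) ∧
    ∀ W, Q W → FacLE W V → (∀ s, S s → FacLE W s) → FacLE W U

/-- The inverse of a poset isomorphism. -/
def PosetIsoP.symm {QA : Mdl A → Prop} {QB : Mdl B → Prop} (ρ : PosetIsoP QA QB) :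
    PosetIsoP QB QA where
  toFun := ρ.invFun
  invFun := ρ.toFun
  maps := ρ.maps'
  maps' := ρ.maps
  le_iff := ρ.le_iff'
  le_iff' := ρ.le_iff
  left_inv := ρ.right_inv
  right_inv := ρ.left_inv

lemma PosetIsoP.le_toFun {QA : Mdl A → Prop} {QB : Mdl B → Prop} (ρ : PosetIsoP QA QB) {X : Mdl A}
    {Y : Mdl B} (hX : QA X) (hY : QB Y) : FacLE (ρ.invFun Y) X ↔ FacLE Y (ρ.toFun X) := by
  rw [ρ.le_iff _ _ (ρ.maps' Y hY) hX]
  exact ⟨(ρ.right_inv Y hY).2.trans, (ρ.right_inv Y hY).1.trans⟩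

lemma PosetIsoP.toFun_le {QA : Mdl A → Prop} {QB : Mdl B → Prop} (ρ : PosetIsoP QA QB) {X : Mdl A}
    {Y : Mdl B} (hX : QA X) (hY : QB Y) : FacLE X (ρ.invFun Y) ↔ FacLE (ρ.toFun X) Y := by
  rw [ρ.le_iff _ _ hX (ρ.maps' Y hY)]
  exact ⟨fun h => h.trans (ρ.right_inv Y hY).1, fun h => h.trans (ρ.right_inv Y hY).2⟩

lemma IsMeetInterval.map {QA : Mdl A → Prop} {QB : Mdl B → Prop} (ρ : PosetIsoP QA QB) {U V : Mdl A}
    (hU : QA U) (hV : QA V) (h : IsMeetInterval QA U V) :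
    IsMeetInterval QB (ρ.toFun U) (ρ.toFun V) := by
  obtain ⟨S, hS, hUV, hUS, hmax⟩ := h
  have hSQ : ∀ s, S s → QA s := fun s hs => (hS s hs).2.1
  refine ⟨fun t => QB t ∧ ∃ s, S s ∧ PE t (ρ.toFun s), ?_, (ρ.le_iff _ _ hU hV).1 hUV, ?_, ?_⟩
  · rintro t ⟨ht, s, hs, hts⟩
    obtain ⟨-, hsQ, hsV, hcov⟩ := hS s hs
    refine ⟨ρ.maps V hV, ht, ⟨hts.1.trans ((ρ.le_iff _ _ hsQ hV).1 hsV.1), fun h =>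
      hsV.2 ((ρ.le_iff _ _ hV hsQ).2 (h.trans hts.1))⟩, fun W hW htW hWV => ?_⟩
    refine hcov (ρ.invFun W) (ρ.maps' W hW) ⟨?_, fun h => ?_⟩ ⟨?_, fun h => ?_⟩
    · exact (ρ.toFun_le hsQ hW).2 (hts.2.trans htW.1)
    · exact htW.2 (((ρ.le_toFun hsQ hW).1 h).trans hts.2)
    · exact (ρ.le_toFun hV hW).2 hWV.1
    · exact hWV.2 ((ρ.toFun_le hV hW).1 h)
  · rintro t ⟨ht, s, hs, hts⟩
    exact ((ρ.le_iff _ _ hU (hSQ s hs)).1 (hUS s hs)).trans hts.2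
  · intro W hW hWV hWS
    refine (ρ.le_toFun hU hW).1 (hmax _ (ρ.maps' W hW) ((ρ.le_toFun hV hW).2 hWV) fun s hs => ?_)
    exact (ρ.le_toFun (hSQ s hs) hW).2 (hWS _ ⟨ρ.maps s (hSQ s hs), s, hs, fun _ => id, fun _ => id⟩)

end Order

section Intervals
variable {K A : Type} [Field K] [Ring A] [Algebra K A] [Module.Finite K A] [IsArtinianRing A]
  {ι κ κ' m : Type} [Fintype ι] {P : ι → Mdl A} {C : κ → Mdl A}
  {M M' N T U V X Y Z E Q : Mdl A} {J J' : Set ι}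

/-- `T` is the direct sum of a support τ-tilting family. -/
def BT {A : Type} [Ring A] {ι : Type} (P : ι → Mdl A) (T : Mdl A) : Prop :=
  ∃ (κ : Type) (_ : Fintype κ) (C : κ → Mdl A), ST P C ∧ Nonempty (T ≃ₗ[A] ∀ k, C k)

/-- `M` is a basic τ-rigid module without maps from the projectives in `J`. -/
structure BP {A : Type} [Ring A] {ι : Type} (P : ι → Mdl A) (J : Set ι) (M : Mdl A) : Prop where
  fin : Module.Finite A M
  dd : DD M M
  van : Van P J M
  basic : ∃ (m : Type) (_ : Fintype m) (D : m → Mdl A), (∀ i, Loc (D i)) ∧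
    (∀ i j, Nonempty (D i ≃ₗ[A] D j) → i = j) ∧ Nonempty (M ≃ₗ[A] ∀ i, D i)

/-- The members of `sτtilt` attached to the pair given by `M` and `J`. -/
def InSet {A : Type} [Ring A] {ι : Type} (P : ι → Mdl A) (J : Set ι) (M T : Mdl A) : Prop :=
  InAdd M T ∧ Van P J T

lemma gen_pi_iff [Finite κ] (hC : ∀ k, Module.Finite A (C k)) (φ : T ≃ₗ[A] ∀ k, C k) :
    Gen (fun _ : Unit => T) Y ↔ Gen C Y := by
  classical
  have := Fintype.ofFinite κ
  have hT : Module.Finite A T := Module.Finite.equiv φ.symm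
  constructor
  · refine Gen.trans fun _ => ?_
    exact (Gen.pi fun k => Gen.self (C := C) k).of_surj (Y := ModuleCat.of A (∀ k, C k))
      φ.symm.toLinearMap φ.symm.surjective
  · refine Gen.trans fun k => ?_
    exact (Gen.self (C := fun _ : Unit => T) ()).of_surj (LinearMap.proj k ∘ₗ φ.toLinearMap)
      fun y => ⟨φ.symm (Pi.single k y), by simp⟩

lemma memFac_iff_gen (K : Type) [Field K] [Algebra K A] [Module.Finite K A] [Module.Finite A T] :
    MemFac T Y ↔ Gen (fun _ : Unit => T) Y := by
  constructor
  · rintro ⟨n, f, hf⟩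
    exact (Gen.pi fun _ : Fin n => Gen.self (C := fun _ : Unit => T) ()).of_surj
      (Y := ModuleCat.of A (Fin n → T)) f hf
  · intro h
    obtain ⟨n, j, f, hf⟩ := exists_surj_of_gen K h
    exact ⟨n, f, hf⟩

lemma ST.memFac_iff [Finite κ] (hC : ST P C) (K : Type) [Field K] [Algebra K A] [Module.Finite K A]
    (φ : T ≃ₗ[A] ∀ k, C k) : MemFac T Y ↔ Gen C Y := by
  have := hC.fin
  have hT : Module.Finite A T := Module.Finite.equiv φ.symm
  rw [memFac_iff_gen K, gen_pi_iff hC.fin φ]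

lemma exists_bt (hP : IsProjFam P) (K : Type) [Field K] [Algebra K A] [Module.Finite K A]
    [Module.Finite A M] (hM : DD M M) :
    ∃ T, BT P T ∧ ∀ Y, MemFac T Y ↔ Gen (fun _ : Unit => M) Y := by
  obtain ⟨κ, _, C, hC, h⟩ := exists_st hP K hM
  exact ⟨ModuleCat.of A (∀ k, C k), ⟨κ, ‹_›, C, hC, ⟨LinearEquiv.refl A _⟩⟩, fun Y =>
    (hC.memFac_iff K (T := ModuleCat.of A (∀ k, C k)) (LinearEquiv.refl A _)).trans (h Y)⟩

lemma RF.exists_bt [Finite κ] (hC : RF C) (hP : IsProjFam P) (K : Type) [Field K] [Algebra K A]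
    [Module.Finite K A] : ∃ T, BT P T ∧ ∀ Y, MemFac T Y ↔ Gen C Y := by
  have := hC.fin
  have h1 : Module.Finite A (ModuleCat.of A (∀ k, C k) : Mdl A) :=
    inferInstanceAs (Module.Finite A (∀ k, C k))
  obtain ⟨T, hT, h⟩ := TauTilting.exists_bt hP K (M := ModuleCat.of A (∀ k, C k))
    (hP.dd_pi_right K fun i => DD.pi_left fun j => hC.dd j i)
  exact ⟨T, hT, fun Y => (h Y).trans
    (gen_pi_iff hC.fin (T := ModuleCat.of A (∀ k, C k)) (LinearEquiv.refl A _))⟩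

lemma BP.tors (h : BP P J M) : Tors P J M M := ⟨h.fin, h.dd, h.van⟩

lemma BP.tors_of_gen (h : BP P J M) (hP : IsProjFam P) (K : Type) [Field K] [Algebra K A]
    [Module.Finite K A] (hY : Gen (fun _ : Unit => M) Y) : Tors P J M Y :=
  have := h.fin
  Tors.of_gen hP K (fun _ => h.tors) hY

lemma BP.inSet_iff (h : BP P J M) (hP : IsProjFam P) (K : Type) [Field K] [Algebra K A]
    [Module.Finite K A] (hT : BT P T) :
    InSet P J M T ↔ (∀ Y, Gen (fun _ : Unit => M) Y → MemFac T Y) ∧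
      ∀ Y, MemFac T Y → Tors P J M Y := by
  classical
  obtain ⟨κ, _, C, hC, ⟨φ⟩⟩ := hT
  have := h.fin
  have hCfin := hC.fin
  have hTfin : Module.Finite A T := Module.Finite.equiv φ.symm
  have hTC : Ad C T := (Ad.pi fun k => Ad.self (C := C) k).of_equiv
    (Y := ModuleCat.of A (∀ k, C k)) φ.symm
  have hCT : ∀ k, Ad (fun _ : Unit => T) (C k) := fun k =>
    (Ad.self ()).of_retract (φ.symm.toLinearMap ∘ₗ LinearMap.single A (fun k => (C k : Type)) k)
      (LinearMap.proj k ∘ₗ φ.toLinearMap) (by ext x; simp)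
  have hTT : Gen C T := hTC.gen hC.fin
  unfold InSet
  rw [inAdd_iff]
  constructor
  · rintro ⟨hM, hv⟩
    have hMC : Ad C M := Ad.trans (fun _ => hTC) hM
    refine ⟨fun Y => ?_, fun Y hY => ?_⟩
    · rw [hC.memFac_iff K φ]
      exact Gen.trans fun _ => hMC.gen hC.fin
    · have hY' := hY
      rw [hC.memFac_iff K φ] at hY
      obtain ⟨l, _, k, a, b, hab⟩ := hMC
      refine ⟨hY.1, ?_, Van.of_gen hP (fun _ => hv) ((memFac_iff_gen K).1 hY')⟩
      exact (DD.pi_left fun i => hC.dd_gen hP K (k i) hY).of_retract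
        (M := ModuleCat.of A (∀ i, C (k i))) a b hab
  · rintro ⟨h1, h2⟩
    refine ⟨?_, (h2 T ((hC.memFac_iff K φ).2 hTT)).van⟩
    obtain ⟨m, _, D, hD, -, ⟨ψ⟩⟩ := h.basic
    have hDM : ∀ i, Gen (fun _ : Unit => M) (D i) := fun i =>
      (Gen.self (C := fun _ : Unit => M) ()).of_surj (LinearMap.proj i ∘ₗ ψ.toLinearMap)
        fun y => ⟨ψ.symm (Pi.single i y), by simp⟩
    have hDfin := fun i => (hDM i).1
    have hMD : ∀ {Y}, DD M Y → ∀ i, DD (D i) Y := fun h =>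
      DD.pi_iff.1 (h.of_equiv (N := ModuleCat.of A (∀ i, D i)) ψ)
    refine (Ad.pi (Y := D) fun i => ?_).of_equiv ψ.symm
    have h3 := ST.dd_of_gen hC hP K ((hC.memFac_iff K φ).1 (h1 _ (hDM i)))
    obtain ⟨j, ⟨θ⟩⟩ := hC.exists_equiv hP K (hD i) h3.2 h3.1
      (fun j => hMD (h2 _ ((hC.memFac_iff K φ).2 (hC.gen_self j))).dd i)
      (hMD (h.tors_of_gen hP K (hDM i)).dd i)
    exact (hCT j).of_equiv θ.symm

/-- The Bongartz completion of a τ-rigid pair, together with the summands coming from the pair. -/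
lemma BP.exists_st (h : BP P J M) (hP : IsProjFam P) (K : Type) [Field K] [Algebra K A]
    [Module.Finite K A] : ∃ (κ : Type) (_ : Fintype κ) (C : κ → Mdl A), ST P C ∧
      ∀ Y, Gen C Y ↔ Tors P J M Y := by
  have := h.fin
  obtain ⟨E, x, -, -, hE, hEY, -, -⟩ := exists_completion hP K h.dd h.van
  have := hE.fin
  obtain ⟨κ, _, C, hC, hCE⟩ := TauTilting.exists_st hP K (hEY E hE).1
  refine ⟨κ, ‹_›, C, hC, fun Y => (hCE Y).trans
    ⟨Tors.of_gen hP K fun _ => hE, fun hY => ⟨hY.fin, top_le_iff.1 fun y _ => ?_⟩⟩⟩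
  obtain ⟨g, rfl⟩ := (hEY Y hY).2 y
  exact apply_mem_tr (C := fun _ : Unit => E) (j := ()) g x

lemma BP.exists_subset (h : BP P J M) (hP : IsProjFam P) (K : Type) [Field K] [Algebra K A]
    [Module.Finite K A] [Fintype κ] (hC : ST P C) (hCM : ∀ Y, Gen C Y ↔ Tors P J M Y) :
    ∃ s : Set κ, (∀ j, j ∉ s → ¬ Gen (rst C {j}ᶜ) (C j)) ∧
      (∀ Y, Gen (fun _ : Unit => M) Y ↔ Gen (rst C s) Y) ∧
      Nonempty (M ≃ₗ[A] ∀ j : s, C j) := by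
  have := h.fin
  have := hC.fin
  obtain ⟨m, _, D, hD, hDinj, ⟨φ⟩⟩ := h.basic
  obtain ⟨s, hs, h1, h2⟩ := hC.exists_subset hP K h.dd h.van hCM hD φ
  obtain ⟨-, -, ⟨ψ⟩⟩ := nonempty_pi_equiv (C := rst C s) hDinj (hC.restrict s).inj
    (fun i => by
      obtain ⟨j, hj, hij⟩ := h2 i
      exact ⟨⟨j, hj⟩, hij⟩) (fun j => h1 j j.2)
  exact ⟨s, hs, fun Y => gen_pi_iff (hC.restrict s).fin (φ.trans ψ), ⟨φ.trans ψ⟩⟩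

lemma BP.exists_interval (h : BP P J M) (hP : IsProjFam P) (K : Type) [Field K] [Algebra K A]
    [Module.Finite K A] : ∃ U V, BT P U ∧ BT P V ∧
      (∀ Y, MemFac U Y ↔ Gen (fun _ : Unit => M) Y) ∧ (∀ Y, MemFac V Y ↔ Tors P J M Y) ∧
      IsMeetInterval (BT P) U V := by
  have := h.fin
  obtain ⟨κ, _, C, hC, hCM⟩ := h.exists_st hP K
  obtain ⟨U, hU, hUM⟩ := exists_bt hP K h.dd
  obtain ⟨s, hs, hsM, -⟩ := h.exists_subset hP K hC hCM
  let V : Mdl A := ModuleCat.of A (∀ k, C k)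
  have hV : BT P V := ⟨κ, ‹_›, C, hC, ⟨LinearEquiv.refl A _⟩⟩
  have hVC : ∀ Y, MemFac V Y ↔ Gen C Y := fun Y => hC.memFac_iff K (T := V) (LinearEquiv.refl A _)
  have hsub : ∀ j, j ∉ s → s ⊆ {j}ᶜ := fun j hj k hk hkj => hj (hkj ▸ hk)
  refine ⟨U, V, hU, hV, hUM, fun Y => (hVC Y).trans (hCM Y),
    fun t => BT P t ∧ ∃ j, j ∉ s ∧ ∀ Y, MemFac t Y ↔ Gen (rst C {j}ᶜ) Y, ?_, ?_, ?_, ?_⟩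
  · rintro t ⟨ht, j, hj, htj⟩
    refine ⟨hV, ht, ⟨fun Y hY => (hVC Y).2 ((htj Y).1 hY).of_rst, fun hVt => hs j hj
      ((htj _).1 (hVt _ ((hVC _).2 (hC.gen_self j))))⟩, ?_⟩
    rintro W ⟨κ', _, C', hC', ⟨φ⟩⟩ htW hWV
    have hW : ∀ Y, MemFac W Y ↔ Gen C' Y := fun Y => hC'.memFac_iff K φ
    refine htW.2 fun Y hY => (htj Y).2 (hC.gen_of_cover hP K hC'.toRF ?_ ?_ ?_ ((hW Y).1 hY))
    · exact fun Z hZ => (hVC Z).1 (hWV.1 Z ((hW Z).2 hZ))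
    · exact fun hle => hWV.2 fun Z hZ => (hW Z).2 (hle Z ((hVC Z).1 hZ))
    · exact fun Z hZ => (hW Z).1 (htW.1 Z ((htj Z).2 hZ))
  · exact fun Y hY => (hVC Y).2 ((hCM Y).2 (h.tors_of_gen hP K ((hUM Y).1 hY)))
  · rintro t ⟨ht, j, hj, htj⟩ Y hY
    exact (htj Y).2 (((hsM Y).1 ((hUM Y).1 hY)).mono_rst (hsub j hj))
  · intro W hW hWV hWS Y hY
    refine (hUM Y).2 ((hsM Y).2 (hC.gen_rst hP K hs ((hVC Y).1 (hWV Y hY)) fun j hj => ?_))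
    obtain ⟨t, ht, htj⟩ := (hC.restrict {j}ᶜ).exists_bt hP K
    exact (htj Y).1 (hWS t ⟨ht, j, hj, htj⟩ Y hY)

lemma IsMeetInterval.exists_bp (hP : IsProjFam P) (K : Type) [Field K] [Algebra K A]
    [Module.Finite K A] (hV : BT P V) (h : IsMeetInterval (BT P) U V) :
    ∃ J M, BP P J M ∧ (∀ Y, MemFac U Y ↔ Gen (fun _ : Unit => M) Y) ∧
      ∀ Y, MemFac V Y ↔ Tors P J M Y := by
  classical
  obtain ⟨κ, _, C, hC, ⟨φ⟩⟩ := id hV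
  have hCfin := hC.fin
  have hVC : ∀ Y, MemFac V Y ↔ Gen C Y := fun Y => hC.memFac_iff K φ
  obtain ⟨S, hS, hUV, hUS, hmax⟩ := h
  have hSj : ∀ t, S t → ∃ j, ¬ Gen (rst C {j}ᶜ) (C j) ∧ ∀ Y, MemFac t Y ↔ Gen (rst C {j}ᶜ) Y := by
    intro t ht
    obtain ⟨-, ⟨κ', _, C', hC', ⟨ψ⟩⟩, htV, hcov⟩ := hS t ht
    have htC : ∀ Y, MemFac t Y ↔ Gen C' Y := fun Y => hC'.memFac_iff K ψ
    obtain ⟨j, hj, hle⟩ := hC.exists_split_of_lt hP K hC'.toRF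
      (fun Y hY => (hVC Y).1 (htV.1 Y ((htC Y).2 hY)))
      (fun hle => htV.2 fun Y hY => (htC Y).2 (hle Y ((hVC Y).1 hY)))
    obtain ⟨W, hW, hWj⟩ := (hC.restrict {j}ᶜ).exists_bt hP K
    have htW : FacLE t W := fun Y hY => (hWj Y).2 (hle Y ((htC Y).1 hY))
    refine ⟨j, hj, fun Y => ⟨fun hY => (hWj Y).1 (htW Y hY), fun hY => ?_⟩⟩
    by_contra hne
    refine hcov W hW ⟨htW, fun h => hne (h Y ((hWj Y).2 hY))⟩
      ⟨fun Z hZ => (hVC Z).2 ((hWj Z).1 hZ).of_rst, fun h => hj ?_⟩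
    exact (hWj _).1 (h _ ((hVC _).2 (hC.gen_self j)))
  let s : Set κ := {j | ¬ (¬ Gen (rst C {j}ᶜ) (C j) ∧ ∃ t, S t ∧
    ∀ Y, MemFac t Y ↔ Gen (rst C {j}ᶜ) Y)}
  have hs : ∀ j, j ∉ s → ¬ Gen (rst C {j}ᶜ) (C j) := fun j hj => (not_not.1 hj).1
  let M : Mdl A := ModuleCat.of A (∀ j : s, C j)
  have hMfin : Module.Finite A M := inferInstanceAs (Module.Finite A (∀ j : s, C j))
  have hMM : ∀ Y, Gen (fun _ : Unit => M) Y ↔ Gen (rst C s) Y := fun Y =>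
    gen_pi_iff (hC.restrict s).fin (T := M) (LinearEquiv.refl A _)
  refine ⟨(spp P C)ᶜ, M, ⟨hMfin, ?_, Van.pi fun j => van_spp_compl _, s, inferInstance, rst C s,
    (hC.restrict s).loc, (hC.restrict s).inj, ⟨LinearEquiv.refl A _⟩⟩, fun Y => ?_, fun Y => ?_⟩
  · exact hP.dd_pi_right K fun i => DD.pi_left fun j => hC.dd j i
  · rw [hMM]
    constructor
    · intro hY
      refine hC.gen_rst hP K hs ((hVC Y).1 (hUV Y hY)) fun j hj => ?_
      obtain ⟨-, t, ht, htj⟩ := not_not.1 hj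
      exact (htj Y).1 (hUS t ht Y hY)
    · intro hY
      obtain ⟨W, hW, hWs⟩ := (hC.restrict s).exists_bt hP K
      refine hmax W hW (fun Z hZ => (hVC Z).2 ((hWs Z).1 hZ).of_rst) (fun t ht Z hZ => ?_) Y
        ((hWs Y).2 hY)
      obtain ⟨j, hj, htj⟩ := hSj t ht
      have hjs : j ∉ s := fun h => h ⟨hj, t, ht, htj⟩
      exact (htj Z).2 (((hWs Z).1 hZ).mono_rst fun k hk hkj => hjs (hkj ▸ hk))
  · rw [hVC]
    constructor
    · intro hY
      have h1 := ST.dd_of_gen hC hP K hY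
      exact ⟨hY.1, DD.pi_left fun j => h1.1 j, h1.2⟩
    · intro hY
      have := hY.fin
      exact hC.gen_of_dd_subset hP K hs (fun j hj => DD.pi_iff.1 hY.dd ⟨j, hj⟩) hY.van

lemma BP.unique (h : BP P J M) (h' : BP P J' M') (hP : IsProjFam P) (K : Type) [Field K]
    [Algebra K A] [Module.Finite K A] (heq : ∀ T, BT P T → (InSet P J M T ↔ InSet P J' M' T)) :
    J = J' ∧ Nonempty (M ≃ₗ[A] M') := by
  have := h.fin
  have := h'.fin
  have key : ∀ {J J' : Set ι} {M M' : Mdl A}, BP P J M → BP P J' M' →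
      (∀ T, BT P T → (InSet P J M T ↔ InSet P J' M' T)) →
      (∀ Y, Gen (fun _ : Unit => M') Y → Gen (fun _ : Unit => M) Y) ∧
      ∀ Y, Tors P J M Y → Tors P J' M' Y := by
    intro J J' M M' h h' heq
    obtain ⟨U, V, hU, hV, hUM, hVM, -⟩ := h.exists_interval hP K
    have hle : ∀ Y, MemFac U Y → MemFac V Y := fun Y hY =>
      (hVM Y).2 (h.tors_of_gen hP K ((hUM Y).1 hY))
    have hU' := (h'.inSet_iff hP K hU).1 ((heq U hU).1 ((h.inSet_iff hP K hU).2
      ⟨fun Y => (hUM Y).2, fun Y hY => (hVM Y).1 (hle Y hY)⟩))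
    have hV' := (h'.inSet_iff hP K hV).1 ((heq V hV).1 ((h.inSet_iff hP K hV).2
      ⟨fun Y hY => hle Y ((hUM Y).2 hY), fun Y => (hVM Y).1⟩))
    exact ⟨fun Y hY => (hUM Y).1 (hU'.1 Y hY), fun Y hY => hV'.2 Y ((hVM Y).2 hY)⟩
  obtain ⟨hG1, hT1⟩ := key h h' heq
  obtain ⟨hG2, hT2⟩ := key h' h fun T hT => (heq T hT).symm
  have hJ : ∀ {J J' : Set ι} {M M' : Mdl A}, BP P J M → (∀ Y, Tors P J M Y → Tors P J' M' Y) →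
      J' ⊆ J := by
    intro J J' M M' h hT i hi
    by_contra hiJ
    have := h.fin
    obtain ⟨Y, hY, hne⟩ := Tors.exists_not_homZero hP K h.dd h.van hiJ
    exact hne ((hT Y hY).van i hi)
  refine ⟨(hJ h' hT2).antisymm (hJ h hT1), ?_⟩
  obtain ⟨κ, _, C, hC, hCM⟩ := h.exists_st hP K
  obtain ⟨s, hs, hsM, ⟨φ⟩⟩ := h.exists_subset hP K hC hCM
  obtain ⟨s', hs', hsM', ⟨φ'⟩⟩ := h'.exists_subset hP K hC fun Y =>
    (hCM Y).trans ⟨hT1 Y, hT2 Y⟩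
  have hCfin := hC.fin
  have hsub : ∀ {s s' : Set κ}, (∀ j, j ∉ s' → ¬ Gen (rst C {j}ᶜ) (C j)) →
      (∀ Y, Gen (rst C s) Y → Gen (rst C s') Y) → s ⊆ s' := by
    intro s s' hs' hle j hj
    by_contra hj'
    exact hs' j hj' ((hle _ (Gen.self (C := rst C s) ⟨j, hj⟩)).mono_rst
      fun k hk hkj => hj' (hkj ▸ hk))
  have hss : s = s' := (hsub hs' fun Y hY => (hsM' Y).1 (hG2 Y ((hsM Y).2 hY))).antisymm
    (hsub hs fun Y hY => (hsM Y).1 (hG1 Y ((hsM' Y).2 hY)))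
  subst hss
  exact ⟨φ.trans φ'.symm⟩

lemma BP.exists_map {B : Type} [Ring B] [IsArtinianRing B] {ι' : Type} [Fintype ι']
    {P' : ι' → Mdl B} (h : BP P J M) (hP : IsProjFam P) (hP' : IsProjFam P')
    (K : Type) [Field K] [Algebra K A] [Module.Finite K A] [Algebra K B] [Module.Finite K B]
    (ρ : PosetIsoP (BT P) (BT P')) :
    ∃ J' M', BP P' J' M' ∧ ∀ T, BT P T → (InSet P J M T ↔ InSet P' J' M' (ρ.toFun T)) := by
  obtain ⟨U, V, hU, hV, hUM, hVM, hI⟩ := h.exists_interval hP K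
  obtain ⟨J', M', h', hUM', hVM'⟩ := (hI.map ρ hU hV).exists_bp hP' K (ρ.maps V hV)
  refine ⟨J', M', h', fun T hT => ?_⟩
  rw [h.inSet_iff hP K hT, h'.inSet_iff hP' K (ρ.maps T hT)]
  simp_rw [← hUM, ← hVM, ← hUM', ← hVM']
  exact and_congr (ρ.le_iff U T hU hT) (ρ.le_iff T V hT hV)

end Intervals
end TauTilting

namespace TauTilting
open MulOpposite
open scoped ModuleCat
set_option linter.unusedSectionVars false

section Idem
variable {Λ : Type} [Ring Λ] {x : Λ} {Y : Mdl Λᵐᵒᵖ}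

/-- The standard generator of `xΛ`. -/
def pgen (x : Λ) : projMod Λ x := (rSpan Λ {1 - x}).mkQ (1 : Λ)

lemma op_smul_pgen (x b : Λ) : op b • pgen x = (rSpan Λ {1 - x}).mkQ b := by
  change op b • (rSpan Λ {1 - x}).mkQ (1 : Λ) = _
  rw [← map_smul, op_smul_eq_mul, one_mul]

lemma exists_smul_pgen (y : projMod Λ x) : ∃ b : Λ, y = op b • pgen x := by
  obtain ⟨b, rfl⟩ := (rSpan Λ {1 - x}).mkQ_surjective y
  exact ⟨b, (op_smul_pgen x b).symm⟩

lemma op_smul_pgen_self (x : Λ) : op x • pgen x = pgen x := by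
  rw [op_smul_pgen]
  refine (Submodule.Quotient.eq _).2 ?_
  rw [← neg_sub 1 x]
  exact (rSpan Λ {1 - x}).neg_mem (Submodule.subset_span (Set.mem_singleton _))

lemma projMod_hom_ext {f g : projMod Λ x →ₗ[Λᵐᵒᵖ] Y} (h : f (pgen x) = g (pgen x)) : f = g := by
  ext y
  obtain ⟨b, rfl⟩ := exists_smul_pgen y
  rw [map_smul, map_smul, h]

/-- The homomorphism `xΛ → Y` sending the standard generator to `y`. -/
def projHom (x : Λ) (y : Y) (h : op x • y = y) : projMod Λ x →ₗ[Λᵐᵒᵖ] Y :=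
  (rSpan Λ {1 - x}).liftQ
    { toFun := fun b => op b • y
      map_add' := fun a b => by rw [op_add, add_smul]
      map_smul' := fun a b => by
        rw [RingHom.id_apply, smul_smul]
        rfl } (by
    rw [rSpan, Submodule.span_le]
    rintro _ rfl
    change op (1 - x) • y = 0
    rw [op_sub, op_one, sub_smul, one_smul, h, sub_self])

lemma projHom_pgen {y : Y} (h : op x • y = y) : projHom x y h (pgen x) = y := by
  change op (1 : Λ) • y = y
  rw [op_one, one_smul]

lemma homZero_projMod (hx : IsIdempotentElem x) :
    HomZero (projMod Λ x) Y ↔ ∀ y : Y, op x • y = 0 := by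
  constructor
  · intro h y
    have hy : op x • op x • y = op x • y := by rw [smul_smul, ← op_mul, hx.eq]
    rw [← projHom_pgen hy, h (projHom x _ hy), LinearMap.zero_apply]
  · intro h f
    refine projMod_hom_ext ?_
    rw [LinearMap.zero_apply, ← op_smul_pgen_self, map_smul, h]

lemma finite_projMod (x : Λ) : Module.Finite Λᵐᵒᵖ (projMod Λ x) :=
  Module.Finite.of_surjective (LinearMap.toSpanSingleton Λᵐᵒᵖ (projMod Λ x) (pgen x)) fun y => by
    obtain ⟨b, rfl⟩ := exists_smul_pgen y
    exact ⟨op b, rfl⟩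

lemma projective_projMod (hx : IsIdempotentElem x) : Module.Projective Λᵐᵒᵖ (projMod Λ x) :=
  Module.Projective.of_split
    (projHom (Y := ModuleCat.of Λᵐᵒᵖ Λᵐᵒᵖ) x (op x) (by rw [smul_eq_mul, ← op_mul, hx.eq]))
    (LinearMap.toSpanSingleton Λᵐᵒᵖ (projMod Λ x) (pgen x))
    (projMod_hom_ext (by
      rw [LinearMap.comp_apply, projHom_pgen]
      exact op_smul_pgen_self x))

lemma mul_eq_of_smul_pgen (hx : IsIdempotentElem x) {a b : Λ} (h : op a • pgen x = op b • pgen x) :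
    x * a = x * b := by
  let y : regMod Λ := x
  have hy : op x • y = y := hx
  have h' := congr_arg (projHom x y hy) h
  rw [map_smul, map_smul, projHom_pgen] at h'
  exact h'

lemma isIndec_projMod (hx : IsPrimIdem Λ x) : IsIndec (projMod Λ x) := by
  obtain ⟨hi, h0, hx⟩ := hx
  refine ⟨⟨pgen x, 0, fun h => h0 ?_⟩, fun N N' hN => ?_⟩
  · have := mul_eq_of_smul_pgen hi (a := 1) (b := 0) (by rw [h, smul_zero, smul_zero])
    rwa [mul_one, mul_zero] at this
  set p : Module.End Λᵐᵒᵖ (projMod Λ x) := N.subtype ∘ₗ N.projectionOnto N' hN with hp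
  have hpp : ∀ y, p (p y) = p y := fun y => by simp [hp]
  obtain ⟨b, hb⟩ := exists_smul_pgen (p (pgen x))
  set a := x * b * x with ha
  have hpa : p (pgen x) = op a • pgen x := by
    rw [ha, op_mul, op_mul, mul_smul, mul_smul, op_smul_pgen_self, ← hb, ← map_smul,
      op_smul_pgen_self]
  have hxa : x * a = a := by rw [ha, mul_assoc, ← mul_assoc, hi.eq]
  have hax : a * x = a := by rw [ha, mul_assoc, hi.eq]
  have haa : a * a = a := by
    have := hpp (pgen x)
    rw [hpa, map_smul, hpa, smul_smul, ← op_mul] at this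
    have := mul_eq_of_smul_pgen hi this
    rwa [← mul_assoc, hxa] at this
  rcases hx a (x - a) haa (by
    rw [IsIdempotentElem, mul_sub, sub_mul, sub_mul, hi.eq, hxa, hax, haa]; abel)
    (by rw [mul_sub, hax, haa, sub_self]) (by rw [sub_mul, hxa, haa, sub_self]) (by abel) with h | h
  · left
    have hp0 : p = 0 := projMod_hom_ext (by rw [hpa, h, op_zero, zero_smul, LinearMap.zero_apply])
    refine (Submodule.eq_bot_iff _).2 fun y hy => ?_
    have : p y = y := by
      simpa [hp] using congr_arg Subtype.val (Submodule.projectionOnto_apply_left hN ⟨y, hy⟩)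
    rw [← this, hp0, LinearMap.zero_apply]
  · right
    have hp1 : p = LinearMap.id := projMod_hom_ext (by
      rw [hpa, ← sub_eq_zero.1 h, op_smul_pgen_self, LinearMap.id_apply])
    refine (Submodule.eq_bot_iff _).2 fun y hy => ?_
    have : p y = 0 := by
      simp [hp, hy]
    rwa [hp1] at this

lemma isArtinianRing_op (K : Type) [Field K] [Algebra K Λ] [Module.Finite K Λ] :
    IsArtinianRing Λᵐᵒᵖ := IsArtinianRing.of_finite K Λᵐᵒᵖ

variable {ι : Type} [Fintype ι] {e : ι → Λ}

lemma isProjFam_projMod [IsArtinianRing Λᵐᵒᵖ] (he : CompletePrimIdems Λ e)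
    (hb : IsBasicAlg Λ e) : IsProjFam fun i => projMod Λ (e i) where
  fin i := finite_projMod _
  proj i := projective_projMod (he.1 i).1
  loc i := by
    have := finite_projMod (e i)
    exact (isIndec_projMod (he.1 i)).loc
  inj i j h := by
    by_contra hij
    exact (hb i j hij).elim h.some
  tr_eq Y := top_le_iff.1 fun y _ => by
    have hy : y = ∑ i, op (e i) • y := by
      rw [← Finset.sum_smul, ← Finset.op_sum, he.2.2, op_one, one_smul]
    rw [hy]
    refine Submodule.sum_mem _ fun i _ => ?_
    have h : op (e i) • op (e i) • y = op (e i) • y := by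
      rw [smul_smul, ← op_mul, (he.1 i).1.eq]
    rw [← projHom_pgen h]
    exact apply_mem_tr (C := fun i => projMod Λ (e i)) (j := i) _ _

lemma mem_supp_iff (he : CompletePrimIdems Λ e) {i : ι} :
    i ∈ Supp Λ e Y ↔ ¬ HomZero (projMod Λ (e i)) Y := by
  rw [homZero_projMod (he.1 i).1, not_forall]
  rfl

lemma supp_eq_spp {κ : Type} {C : κ → Mdl Λᵐᵒᵖ} (he : CompletePrimIdems Λ e)
    (φ : Y ≃ₗ[Λᵐᵒᵖ] ∀ k, C k) : Supp Λ e Y = spp (fun i => projMod Λ (e i)) C := by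
  classical
  ext i
  rw [mem_supp_iff he]
  constructor
  · intro h
    by_contra hc
    refine h fun f => ?_
    ext y
    refine φ.injective (funext fun k => ?_)
    have := not_not.1 (fun hk => hc ⟨k, hk⟩) (LinearMap.proj k ∘ₗ φ.toLinearMap ∘ₗ f)
    rw [LinearMap.zero_apply, map_zero]
    exact LinearMap.congr_fun this y
  · rintro ⟨k, hk⟩ h
    refine hk (h.of_inj (φ.symm.toLinearMap ∘ₗ LinearMap.single _ (fun k => (C k : Type)) k) ?_)
    exact φ.symm.injective.comp
      (Pi.single_injective (M := fun k => (C k : Type)) k)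

lemma van_iff (he : CompletePrimIdems Λ e) {J : Set ι} :
    Van (fun i => projMod Λ (e i)) J Y ↔ J ⊆ (Supp Λ e Y)ᶜ :=
  forall₂_congr fun i _ => by rw [Set.mem_compl_iff, mem_supp_iff he, not_not]

lemma mul_cIdem (he : CompletePrimIdems Λ e) {i : ι} (hi : i ∉ Supp Λ e Y) :
    e i * cIdem Λ e Y = e i := by
  classical
  rw [cIdem, Finset.mul_sum, Finset.sum_eq_single i]
  · rw [if_neg hi, (he.1 i).1.eq]
  · intro j _ hj
    split_ifs
    · exact mul_zero _
    · exact he.2.1 hj.symm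
  · simp

lemma op_cIdem_smul_pgen (he : CompletePrimIdems Λ e) {i : ι} (hi : i ∉ Supp Λ e Y) :
    op (cIdem Λ e Y) • pgen (e i) = pgen (e i) := by
  rw [← op_smul_pgen_self, smul_smul, ← op_mul, mul_cIdem he hi]

lemma op_smul_op_smul_pgen (he : CompletePrimIdems Λ e) (i : ι) (x : Λ) :
    op (e i) • op (e i) • pgen x = op (e i) • pgen x := by
  rw [smul_smul, ← op_mul, (he.1 i).1.eq]

lemma ad_projMod_cIdem (he : CompletePrimIdems Λ e) :
    Ad (rst (fun i => projMod Λ (e i)) (Supp Λ e Y)ᶜ) (projMod Λ (cIdem Λ e Y)) := by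
  classical
  let c := cIdem Λ e Y
  refine ⟨((Supp Λ e Y)ᶜ : Set ι), inferInstance, id,
    LinearMap.pi fun i => projHom c (pgen (e i)) (op_cIdem_smul_pgen he i.2),
    ∑ i : ((Supp Λ e Y)ᶜ : Set ι), projHom (e i) (op (e i) • pgen c)
      (op_smul_op_smul_pgen he i c) ∘ₗ LinearMap.proj i, projMod_hom_ext ?_⟩
  rw [LinearMap.comp_apply, LinearMap.sum_apply, LinearMap.id_apply]
  have h1 : ∀ i : ((Supp Λ e Y)ᶜ : Set ι), (projHom (e i) (op (e i) • pgen c)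
      (op_smul_op_smul_pgen he i c) ∘ₗ LinearMap.proj i)
      ((LinearMap.pi fun i : ((Supp Λ e Y)ᶜ : Set ι) =>
        projHom c (pgen (e i)) (op_cIdem_smul_pgen he i.2)) (pgen c)) = op (e i) • pgen c := by
    intro i
    rw [LinearMap.comp_apply, LinearMap.proj_apply, LinearMap.pi_apply, projHom_pgen, projHom_pgen]
  refine (Finset.sum_congr rfl fun i _ => h1 i).trans ?_
  have h2 : ∑ i : ((Supp Λ e Y)ᶜ : Set ι), e i = c := by
    rw [show c = ∑ i : ι, if i ∈ Supp Λ e Y then 0 else e i from rfl, Finset.sum_ite,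
      Finset.sum_const_zero, zero_add]
    exact (Finset.sum_subtype _ (by simp) _).symm
  rw [← Finset.sum_smul, ← Finset.op_sum, h2, op_smul_pgen_self]

lemma inAdd_projMod_cIdem (he : CompletePrimIdems Λ e) {i : ι} (hi : i ∉ Supp Λ e Y) :
    Ad (fun _ : Unit => projMod Λ (cIdem Λ e Y)) (projMod Λ (e i)) :=
  (Ad.self ()).of_retract (projHom (e i) _ (op_smul_op_smul_pgen he i (cIdem Λ e Y)))
    (projHom _ (pgen (e i)) (op_cIdem_smul_pgen he hi)) (projMod_hom_ext (by
      rw [LinearMap.comp_apply, projHom_pgen, map_smul, projHom_pgen, op_smul_pgen_self]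
      rfl))

end Idem
end TauTilting

namespace TauTilting
open MulOpposite
open scoped ModuleCat
set_option linter.unusedSectionVars false

section Decomp
variable {A : Type} [Ring A] {M N T : Mdl A}

lemma IsDecompOf.nonempty_equiv {n : ℕ} {F : Fin n → Submodule A M} (h : IsDecompOf M F) :
    Nonempty (M ≃ₗ[A] ∀ k, F k) := by
  classical
  have h1 : DirectSum.IsInternal F :=
    DirectSum.isInternal_submodule_of_iSupIndep_of_iSup_eq_top h.1 h.2.1
  exact ⟨(LinearEquiv.ofBijective (DirectSum.coeLinearMap F) h1).symm.trans
    (DirectSum.linearEquivFunOnFintype A (Fin n) fun k => F k)⟩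

lemma exists_isDecompOf {m : Type} [Fintype m] {D : m → Mdl A} (hD : ∀ i, Loc (D i))
    (φ : M ≃ₗ[A] ∀ i, D i) {n : ℕ} (hn : Nat.card m = n) :
    ∃ (F : Fin n → Submodule A M) (σ : Fin n ≃ m), IsDecompOf M F ∧
      ∀ k, Nonempty (F k ≃ₗ[A] D (σ k)) := by
  classical
  subst hn
  let σ : Fin (Nat.card m) ≃ m := (Finite.equivFin m).symm
  let u : ∀ k, D (σ k) →ₗ[A] M := fun k =>
    φ.symm.toLinearMap ∘ₗ LinearMap.single A (fun i => (D i : Type)) (σ k)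
  have hu : ∀ k, Function.Injective (u k) := fun k =>
    φ.symm.injective.comp (Pi.single_injective (M := fun i => (D i : Type)) (σ k))
  have hF : ∀ k, Nonempty (LinearMap.range (u k) ≃ₗ[A] D (σ k)) := fun k =>
    ⟨(LinearEquiv.ofInjective (u k) (hu k)).symm⟩
  refine ⟨fun k => LinearMap.range (u k), σ, ⟨?_, ?_, fun k => ?_⟩, hF⟩
  · intro k
    rw [disjoint_iff_inf_le]
    rintro _ ⟨⟨y, rfl⟩, hy⟩
    have hle : ⨆ j, ⨆ (_ : j ≠ k), LinearMap.range (u j) ≤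
        LinearMap.ker (LinearMap.proj (σ k) ∘ₗ φ.toLinearMap) := by
      refine iSup₂_le fun j hj => ?_
      rintro _ ⟨z, rfl⟩
      simp [u, Pi.single_eq_of_ne (σ.injective.ne hj.symm)]
    have := hle hy
    have hy0 : y = 0 := by simpa [u] using this
    rw [hy0, map_zero]
    exact Submodule.zero_mem _
  · refine top_le_iff.1 fun x _ => ?_
    have hx : x = ∑ k, u k (φ x (σ k)) := by
      apply φ.injective
      rw [map_sum]
      have : ∀ k, φ (u k (φ x (σ k))) = Pi.single (σ k) (φ x (σ k)) := fun k => by simp [u]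
      simp_rw [this]
      rw [Equiv.sum_comp σ fun i => (Pi.single i (φ x i) : ∀ i, D i), Finset.univ_sum_single]
    rw [hx]
    exact Submodule.sum_mem _ fun k _ => Submodule.mem_iSup_of_mem k ⟨_, rfl⟩
  · exact ((hD (σ k)).of_equiv (Y := ModuleCat.of A (LinearMap.range (u k)))
      (hF k).some.symm).isIndec

variable [IsArtinianRing A]

lemma IsDecompOf.loc [Module.Finite A M] {n : ℕ} {F : Fin n → Submodule A M}
    (h : IsDecompOf M F) (k : Fin n) : Loc (ModuleCat.of A (F k)) :=
  IsIndec.loc (X := ModuleCat.of A (F k)) (h.2.2 k)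

lemma isBasicMod_iff [Module.Finite A M] :
    IsBasicMod M ↔ ∃ (m : Type) (_ : Fintype m) (D : m → Mdl A), (∀ i, Loc (D i)) ∧
      (∀ i j, Nonempty (D i ≃ₗ[A] D j) → i = j) ∧ Nonempty (M ≃ₗ[A] ∀ i, D i) := by
  constructor
  · rintro ⟨n, F, hF, h⟩
    refine ⟨Fin n, inferInstance, fun k => ModuleCat.of A (F k), hF.loc, fun i j ⟨φ⟩ => ?_,
      hF.nonempty_equiv⟩
    by_contra hij
    exact (h i j hij).elim φ
  · rintro ⟨m, _, D, hD, hinj, ⟨φ⟩⟩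
    obtain ⟨F, σ, hF, h⟩ := exists_isDecompOf hD φ rfl
    refine ⟨_, F, hF, fun k l hkl => ⟨fun ψ => hkl (σ.injective (hinj _ _ ?_))⟩⟩
    exact ⟨(h k).some.symm.trans (ψ.trans (h l).some)⟩

/-- The number of summands in a decomposition agrees with that of a basic one. -/
lemma card_eq_of_equiv (K : Type) [Field K] [Algebra K A] [Module.Finite K A]
    {m n : Type} [Fintype m] [Fintype n] {D : m → Mdl A} {E : n → Mdl A}
    (hD : ∀ i, Loc (D i)) (hE : ∀ i, Loc (E i)) (hfin : ∀ i, Module.Finite A (D i))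
    (hinj : ∀ i j, Nonempty (D i ≃ₗ[A] D j) → i = j)
    (φ : (∀ i, E i) ≃ₗ[A] ∀ i, D i) : Nat.card n = Nat.card m := by
  classical
  have hk : ∀ k, ∃ i, Nonempty (E k ≃ₗ[A] D i) := fun k =>
    Ad.exists_equiv hD (hE k) ((Ad.pi fun i => Ad.self (C := D) i).of_retract
      (φ.toLinearMap ∘ₗ LinearMap.single A (fun i => (E i : Type)) k)
      (LinearMap.proj k ∘ₗ φ.symm.toLinearMap) (by ext x; simp))
  have hi : ∀ i, ∃ k, Nonempty (D i ≃ₗ[A] E k) := fun i =>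
    Ad.exists_equiv hE (hD i) ((Ad.pi fun k => Ad.self (C := E) k).of_retract
      (φ.symm.toLinearMap ∘ₗ LinearMap.single A (fun i => (D i : Type)) i)
      (LinearMap.proj i ∘ₗ φ.toLinearMap) (by ext x; simp))
  choose f hf using hk
  choose g hg using hi
  have hfg : ∀ i, f (g i) = i := fun i => (hinj _ _ ⟨(hg i).some.trans (hf (g i)).some⟩).symm
  have hKD : ∀ i, Module.Finite K (D i) := fun i => have := hfin i; finite_base K (D i)
  have hKE : ∀ k, Module.Finite K (E k) := fun k =>
    have := hfin (f k)
    have : Module.Finite A (E k) := Module.Finite.equiv (hf k).some.symm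
    finite_base K (E k)
  have hEf : ∀ k, Module.finrank K (E k) = Module.finrank K (D (f k)) := fun k =>
    ((hf k).some.restrictScalars K).finrank_eq
  have hdim : ∑ k, Module.finrank K (D (f k)) = ∑ i, Module.finrank K (D i) := by
    simp_rw [← hEf]
    rw [← Module.finrank_pi_fintype K, ← Module.finrank_pi_fintype K]
    exact (φ.restrictScalars K).finrank_eq
  have hgf : ∀ k, g (f k) = k := by
    intro k
    by_contra hne
    have h1 : ∑ i, Module.finrank K (D i) = ∑ k' ∈ Finset.univ.image g,
        Module.finrank K (D (f k')) := by
      rw [Finset.sum_image fun i _ j _ hij => by rw [← hfg i, hij, hfg]]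
      exact Finset.sum_congr rfl fun i _ =>
        congr_arg (fun i => Module.finrank K (D i)) (hfg i).symm
    have h2 : ∑ k' ∈ Finset.univ.image g, Module.finrank K (D (f k')) <
        ∑ k', Module.finrank K (D (f k')) := by
      have := (hD (f k)).1
      refine Finset.sum_lt_sum_of_subset (Finset.subset_univ _) (Finset.mem_univ k) ?_
        Module.finrank_pos fun _ _ _ => Nat.zero_le _
      simp only [Finset.mem_image, Finset.mem_univ, true_and, not_exists]
      rintro i rfl
      exact hne (by rw [hfg])
    omega
  exact Nat.card_congr ⟨f, g, hgf, hfg⟩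

variable {K : Type} [Field K] [Algebra K A] [Module.Finite K A] {ι : Type} [Fintype ι]
  {P : ι → Mdl A}

lemma isTauRigid_iff (hP : IsProjFam P) (K : Type) [Field K] [Algebra K A] [Module.Finite K A] :
    IsTauRigid M ↔ Module.Finite A M ∧ DD M M := by
  refine and_congr_right fun hM => ⟨fun h Y q hq => lift_iff.2 (h Y ?_), fun h Y hY => ?_⟩
  · exact ⟨1, q ∘ₗ LinearMap.proj 0, hq.comp fun y => ⟨fun _ => y, rfl⟩⟩
  · exact lift_iff.1 (hP.dd_of_gen K (fun _ : Unit => h) ((memFac_iff_gen K).1 hY)).lift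

end Decomp

section Main
variable {K Λ : Type} [Field K] [Ring Λ] [Algebra K Λ] [Module.Finite K Λ] {ι : Type} [Fintype ι]
  {e : ι → Λ} {M N T : Mdl Λᵐᵒᵖ}

lemma isBSTT_iff [IsArtinianRing Λᵐᵒᵖ] (he : CompletePrimIdems Λ e) (hb : IsBasicAlg Λ e)
    (K : Type) [Field K] [Algebra K Λ] [Module.Finite K Λ] :
    IsBSTT Λ e T ↔ BT (fun i => projMod Λ (e i)) T := by
  have hP := isProjFam_projMod he hb
  constructor
  · rintro ⟨⟨hfin, hT, F, hF⟩, hB⟩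
    obtain ⟨m, _, D, hD, hinj, ⟨φ⟩⟩ := isBasicMod_iff.1 hB
    classical
    have hDfin : ∀ i, Module.Finite Λᵐᵒᵖ (D i) := fun i =>
      Module.Finite.of_surjective (LinearMap.proj i ∘ₗ φ.toLinearMap)
        fun y => ⟨φ.symm (Pi.single i y), by simp⟩
    have hdd := ((isTauRigid_iff hP K).1 hT).2
    refine ⟨m, ‹_›, D, ⟨⟨hDfin, hD, hinj, fun i j => ?_⟩, ?_⟩, ⟨φ⟩⟩
    · exact DD.pi_iff.1 ((hdd.of_equiv (N := ModuleCat.of Λᵐᵒᵖ (∀ i, D i)) φ).of_surj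
        (LinearMap.proj j ∘ₗ φ.toLinearMap) fun y => ⟨φ.symm (Pi.single j y), by simp⟩) i
    · rw [← supp_eq_spp he φ, ← card_eq_of_equiv K hD hF.loc hDfin hinj
        (hF.nonempty_equiv.some.symm.trans φ), Nat.card_fin]
  · rintro ⟨κ, _, C, hC, ⟨φ⟩⟩
    have := hC.fin
    have hfin : Module.Finite Λᵐᵒᵖ T := Module.Finite.equiv φ.symm
    have hCM : Module.Finite Λᵐᵒᵖ (ModuleCat.of Λᵐᵒᵖ (∀ k, C k)) :=
      inferInstanceAs (Module.Finite Λᵐᵒᵖ (∀ k, C k))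
    have hdd : DD T T := ((hP.dd_pi_right K (M := ModuleCat.of Λᵐᵒᵖ (∀ k, C k))
      fun i => DD.pi_left fun j => hC.dd j i).of_surj φ.symm.toLinearMap φ.symm.surjective).of_equiv
        φ.symm
    obtain ⟨F, -, hF, -⟩ := exists_isDecompOf hC.loc φ (hC.card.trans (by
      rw [← supp_eq_spp he φ]))
    exact ⟨⟨hfin, (isTauRigid_iff hP K).2 ⟨hfin, hdd⟩, F, hF⟩,
      isBasicMod_iff.2 ⟨κ, ‹_›, C, hC.loc, hC.inj, ⟨φ⟩⟩⟩

lemma homZero_pi_iff {A : Type} [Ring A] {J : Type} [Finite J] {P : J → Mdl A} {N T : Mdl A}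
    (φ : N ≃ₗ[A] ∀ j, P j) : HomZero N T ↔ ∀ j, HomZero (P j) T := by
  classical
  have := Fintype.ofFinite J
  constructor
  · intro h j f
    ext x
    have := LinearMap.congr_fun (h (f ∘ₗ LinearMap.proj j ∘ₗ φ.toLinearMap)) (φ.symm (Pi.single j x))
    simpa using this
  · intro h f
    have : f ∘ₗ φ.symm.toLinearMap = 0 := LinearMap.pi_ext' fun j => h j _
    ext x
    simpa using LinearMap.congr_fun this (φ x)

lemma isBasicTRP_iff [IsArtinianRing Λᵐᵒᵖ] (he : CompletePrimIdems Λ e) (hb : IsBasicAlg Λ e)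
    (K : Type) [Field K] [Algebra K Λ] [Module.Finite K Λ] :
    IsBasicTRP Λ e M N ↔ ∃ J : Set ι, BP (fun i => projMod Λ (e i)) J M ∧
      Nonempty (N ≃ₗ[Λᵐᵒᵖ] ∀ j : J, projMod Λ (e j)) := by
  have hP := isProjFam_projMod he hb
  constructor
  · rintro ⟨⟨hM, hN, -, hA⟩, hMb, hNb⟩
    obtain ⟨hMf, hdd⟩ := (isTauRigid_iff hP K).1 hM
    obtain ⟨m, _, D, hD, hinj, ⟨φ⟩⟩ := isBasicMod_iff.1 hNb
    have hi : ∀ k, ∃ i : ((Supp Λ e M)ᶜ : Set ι), Nonempty (D k ≃ₗ[Λᵐᵒᵖ] projMod Λ (e i)) :=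
      fun k => by
        classical
        refine Ad.exists_equiv (C := rst (fun i => projMod Λ (e i)) (Supp Λ e M)ᶜ)
          (fun i => hP.loc i) (hD k) (Ad.of_retract (Y := N)
            (Ad.trans (fun _ => ad_projMod_cIdem he) (inAdd_iff.1 hA))
            (φ.symm.toLinearMap ∘ₗ LinearMap.single _ (fun i => (D i : Type)) k)
            (LinearMap.proj k ∘ₗ φ.toLinearMap) (by ext x; simp))
    let J : Set ι := {i | ∃ k, Nonempty (D k ≃ₗ[Λᵐᵒᵖ] projMod Λ (e i))}
    have hJ : J ⊆ (Supp Λ e M)ᶜ := by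
      rintro i ⟨k, ⟨ψ⟩⟩
      obtain ⟨j, ⟨ψ'⟩⟩ := hi k
      rw [hP.inj i j ⟨ψ.symm.trans ψ'⟩]
      exact j.2
    refine ⟨J, ⟨hMf, hdd, (van_iff he).2 hJ, isBasicMod_iff.1 hMb⟩, ?_⟩
    obtain ⟨-, -, ⟨ψ⟩⟩ := nonempty_pi_equiv (C := rst (fun i => projMod Λ (e i)) J) hinj
      (fun i j h => Subtype.ext (hP.inj i j h))
      (fun k => by
        obtain ⟨i, hi⟩ := hi k
        exact ⟨⟨i, k, hi⟩, hi⟩) (fun j => j.2)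
    exact ⟨φ.trans ψ⟩
  · rintro ⟨J, h, ⟨φ⟩⟩
    have := h.fin
    have hPfin := hP.fin
    have hN : Module.Finite Λᵐᵒᵖ N := Module.Finite.equiv φ.symm
    have hproj : Module.Projective Λᵐᵒᵖ (∀ j : J, projMod Λ (e j)) :=
      projective_pi fun j => hP.proj j
    have hJ := (van_iff he).1 h.van
    refine ⟨⟨(isTauRigid_iff hP K).2 ⟨h.fin, h.dd⟩, hN, Module.Projective.of_equiv φ.symm,
      inAdd_iff.2 ?_⟩, isBasicMod_iff.2 h.basic, isBasicMod_iff.2 ⟨J, Fintype.ofFinite J,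
        fun j => projMod Λ (e j), fun j => hP.loc j, fun i j h => Subtype.ext (hP.inj i j h), ⟨φ⟩⟩⟩
    have := Fintype.ofFinite J
    exact (Ad.pi (Y := fun j : J => projMod Λ (e j)) fun j =>
      inAdd_projMod_cIdem he (hJ j.2)).of_equiv φ.symm

lemma inPairSet_iff {J : Set ι} (φ : N ≃ₗ[Λᵐᵒᵖ] ∀ j : J, projMod Λ (e j)) :
    InPairSet Λ M N T ↔ InSet (fun i => projMod Λ (e i)) J M T :=
  and_congr_right fun _ => (homZero_pi_iff (P := fun j : J => projMod Λ (e j)) φ).trans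
    ⟨fun h j hj => h ⟨j, hj⟩, fun h j => h j j.2⟩

lemma BP.inSet_congr {A : Type} [Ring A] [IsArtinianRing A] {K : Type} [Field K] [Algebra K A]
    [Module.Finite K A] {P : ι → Mdl A} {J : Set ι} {M T T' : Mdl A} (h : BP P J M)
    (hP : IsProjFam P) (hT : BT P T) (hT' : BT P T') (hTT : PE T T') :
    InSet P J M T ↔ InSet P J M T' := by
  rw [h.inSet_iff hP K hT, h.inSet_iff hP K hT']
  have : ∀ Y, MemFac T Y ↔ MemFac T' Y := fun Y => ⟨hTT.1 Y, hTT.2 Y⟩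
  simp_rw [this]

variable {Γ : Type} [Ring Γ] [Algebra K Γ] [Module.Finite K Γ] {ι' : Type} [Fintype ι']
  {f : ι' → Γ}

lemma exists_basicTRP (K : Type) [Field K] [Algebra K Λ] [Module.Finite K Λ] [Algebra K Γ]
    [Module.Finite K Γ] (he : CompletePrimIdems Λ e) (hb : IsBasicAlg Λ e)
    (hf : CompletePrimIdems Γ f) (hb' : IsBasicAlg Γ f) (ρ : PosetIsoP (IsBSTT Λ e) (IsBSTT Γ f))
    (X : Mdl Λᵐᵒᵖ × Mdl Λᵐᵒᵖ) : ∃ Y : Mdl Γᵐᵒᵖ × Mdl Γᵐᵒᵖ, IsBasicTRP Λ e X.1 X.2 →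
      IsBasicTRP Γ f Y.1 Y.2 ∧ ∀ T, IsBSTT Λ e T →
        (InPairSet Λ X.1 X.2 T ↔ InPairSet Γ Y.1 Y.2 (ρ.toFun T)) := by
  have := isArtinianRing_op (Λ := Λ) K
  have := isArtinianRing_op (Λ := Γ) K
  by_cases hX : IsBasicTRP Λ e X.1 X.2
  swap
  · exact ⟨(ModuleCat.of _ Γ, ModuleCat.of _ Γ), fun h => (hX h).elim⟩
  obtain ⟨J, h, ⟨φ⟩⟩ := (isBasicTRP_iff he hb K).1 hX
  have key : ∀ (PA : Mdl Λᵐᵒᵖ → Prop) (PB : Mdl Γᵐᵒᵖ → Prop) (ρ : PosetIsoP PA PB),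
      PA = BT (fun i => projMod Λ (e i)) → PB = BT (fun i => projMod Γ (f i)) →
      ∃ J' M', BP (fun i => projMod Γ (f i)) J' M' ∧ ∀ T, PA T →
        (InSet (fun i => projMod Λ (e i)) J X.1 T ↔
          InSet (fun i => projMod Γ (f i)) J' M' (ρ.toFun T)) := by
    rintro _ _ ρ rfl rfl
    exact h.exists_map (isProjFam_projMod he hb) (isProjFam_projMod hf hb') K ρ
  obtain ⟨J', M', h', H⟩ := key _ _ ρ (funext fun T => propext (isBSTT_iff he hb K))
    (funext fun T => propext (isBSTT_iff hf hb' K))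
  refine ⟨(M', ModuleCat.of _ (∀ j : J', projMod Γ (f j))), fun _ =>
    ⟨(isBasicTRP_iff hf hb' K).2 ⟨J', h', ⟨LinearEquiv.refl _ _⟩⟩, fun T hT => ?_⟩⟩
  rw [inPairSet_iff φ, inPairSet_iff (N := ModuleCat.of _ (∀ j : J', projMod Γ (f j)))
    (LinearEquiv.refl _ _)]
  exact H T hT

lemma modIso_of_inPairSet (K : Type) [Field K] [Algebra K Λ] [Module.Finite K Λ]
    (he : CompletePrimIdems Λ e) (hb : IsBasicAlg Λ e)
    (ρ : PosetIsoP (IsBSTT Λ e) (IsBSTT Γ f)) {X X' : Mdl Λᵐᵒᵖ × Mdl Λᵐᵒᵖ}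
    {Y : Mdl Γᵐᵒᵖ × Mdl Γᵐᵒᵖ} (hX : IsBasicTRP Λ e X.1 X.2) (hX' : IsBasicTRP Λ e X'.1 X'.2)
    (h : ∀ T, IsBSTT Λ e T → (InPairSet Λ X.1 X.2 T ↔ InPairSet Γ Y.1 Y.2 (ρ.toFun T)))
    (h' : ∀ S, IsBSTT Γ f S → (InPairSet Γ Y.1 Y.2 S ↔ InPairSet Λ X'.1 X'.2 (ρ.invFun S))) :
    ModIso X'.1 X.1 ∧ ModIso X'.2 X.2 := by
  have := isArtinianRing_op (Λ := Λ) K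
  have hP := isProjFam_projMod he hb
  obtain ⟨J, hJ, ⟨φ⟩⟩ := (isBasicTRP_iff he hb K).1 hX
  obtain ⟨J', hJ', ⟨φ'⟩⟩ := (isBasicTRP_iff he hb K).1 hX'
  obtain ⟨rfl, hM⟩ := hJ'.unique hJ hP K fun T hT => by
    have hT' := (isBSTT_iff he hb K).2 hT
    have hρ := ρ.maps T hT'
    rw [← inPairSet_iff φ, h T hT', h' _ hρ, inPairSet_iff φ']
    exact hJ'.inSet_congr (K := K) hP hT ((isBSTT_iff he hb K).1 (ρ.maps' _ hρ))
      (ρ.left_inv T hT').symm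
  exact ⟨hM, ⟨φ'.trans φ.symm⟩⟩

end Main
end TauTilting

open TauTilting in
/-- If `ρ : sτtilt Λ → sτtilt Γ` is a poset isomorphism and
`sτtilt Λ` is a lattice, then there is a bijection `ρ̃` (given by a pair of
mutually inverse maps `F`, `G` on iso-classes) between basic τ-rigid pairs of
`Λ` and of `Γ` such that `ρ` restricts to a poset isomorphism
`sτtilt_X Λ ≅ sτtilt_{ρ̃(X)} Γ` for every basic τ-rigid pair `X`. -/
theorem statement4
    (K : Type) [Field K]
    (Λ : Type) [Ring Λ] [Algebra K Λ] [FiniteDimensional K Λ]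
    (ι : Type) [Fintype ι] (e : ι → Λ)
    (he : CompletePrimIdems Λ e) (hbasic : IsBasicAlg Λ e)
    (Γ : Type) [Ring Γ] [Algebra K Γ] [FiniteDimensional K Γ]
    (ι' : Type) [Fintype ι'] (f : ι' → Γ)
    (hf : CompletePrimIdems Γ f) (hbasic' : IsBasicAlg Γ f)
    (ρ : PosetIsoP (IsBSTT Λ e) (IsBSTT Γ f))
    (hlat : IsLatticeP (IsBSTT Λ e)) :
    ∃ (F : Mdl Λᵐᵒᵖ × Mdl Λᵐᵒᵖ → Mdl Γᵐᵒᵖ × Mdl Γᵐᵒᵖ)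
      (G : Mdl Γᵐᵒᵖ × Mdl Γᵐᵒᵖ → Mdl Λᵐᵒᵖ × Mdl Λᵐᵒᵖ),
      (∀ X, IsBasicTRP Λ e X.1 X.2 → IsBasicTRP Γ f (F X).1 (F X).2) ∧
      (∀ Y, IsBasicTRP Γ f Y.1 Y.2 → IsBasicTRP Λ e (G Y).1 (G Y).2) ∧
      (∀ X, IsBasicTRP Λ e X.1 X.2 → ModIso (G (F X)).1 X.1 ∧ ModIso (G (F X)).2 X.2) ∧
      (∀ Y, IsBasicTRP Γ f Y.1 Y.2 → ModIso (F (G Y)).1 Y.1 ∧ ModIso (F (G Y)).2 Y.2) ∧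
      (∀ X, IsBasicTRP Λ e X.1 X.2 → ∀ T, IsBSTT Λ e T →
        (InPairSet Λ X.1 X.2 T ↔ InPairSet Γ (F X).1 (F X).2 (ρ.toFun T))) := by
  choose F hF using exists_basicTRP K he hbasic hf hbasic' ρ
  choose G hG using exists_basicTRP K hf hbasic' he hbasic ρ.symm
  refine ⟨F, G, fun X hX => (hF X hX).1, fun Y hY => (hG Y hY).1, fun X hX => ?_, fun Y hY => ?_,
    fun X hX => (hF X hX).2⟩
  · have hY := (hF X hX).1
    exact modIso_of_inPairSet K he hbasic ρ hX (hG _ hY).1 (hF X hX).2 (hG _ hY).2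
  · have hX := (hG Y hY).1
    exact modIso_of_inPairSet K hf hbasic' ρ.symm hY (hF _ hX).1 (hG Y hY).2 (hF _ hX).2
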